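/- arXiv:math/0307248 — 3 statements merged into one kernel-verified Lean document; each statement's English description precedes it below -/
import Mathlib

section
/- Let θ' and θ'' be Lie algebra automorphisms of g, both of order exactly m, such that θ' ∘ (θ'')^{-1} is inner. Suppose there are nilpotent elements e' ∈ g_1' (the ζ-eigenspace of θ') and e'' ∈ g_1'' (the ζ-eigenspace of θ''), lying in the same Int g-orbit (i.e., τ_0(e') = e'' for some τ_0 ∈ Int g), such that e' is semiregular. Then there exists τ ∈ Int g with θ' = τ ∘ θ'' ∘ τ^{-1}. -/
open LieAlgebra Module

variable (k : Type*) [Field k] [IsAlgClosed k] [CharZero k]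
variable (g : Type*) [LieRing g] [LieAlgebra k g] [FiniteDimensional k g]
  [LieAlgebra.IsSemisimple k g]

/-- The `ζ^i`-eigenspace of the automorphism `θ`, i.e. the graded piece `g_i`. -/
noncomputable def gradePiece {m : ℕ} (ζ : k) (θ : g ≃ₗ[k] g) (i : ZMod m) : Submodule k g :=
  Module.End.eigenspace (θ : g →ₗ[k] g) (ζ ^ i.val)

/-- The centraliser `z(x) = {y : ⁅x, y⁆ = 0}` of `x`. -/
noncomputable def zc (x : g) : Submodule k g := LinearMap.ker (LieAlgebra.ad k g x)

/-- Truncated exponential of an endomorphism; it agrees with the exponential series for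
nilpotent endomorphisms of a finite-dimensional space. -/
noncomputable def expEnd (N : Module.End k g) : Module.End k g :=
  ∑ i ∈ Finset.range (Module.finrank k g + 1), ((i.factorial : k))⁻¹ • N ^ i

/-- The group `Int g` of inner automorphisms: the subgroup of the automorphism group
generated by `exp (ad n)` for `n` with `ad n` nilpotent. -/
noncomputable def IntG : Subgroup (g ≃ₗ[k] g) :=
  Subgroup.closure {τ | ∃ n : g, IsNilpotent (LieAlgebra.ad k g n) ∧
    (τ : g →ₗ[k] g) = expEnd k g (LieAlgebra.ad k g n)}

/-- A Cartan subspace of `g_1`: a commutative subspace consisting of semisimple elements,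
maximal among subspaces of `g_1` with these two properties. -/
def IsCartanSubspace (m : ℕ) (ζ : k) (θ : g ≃ₗ[k] g) (c : Submodule k g) : Prop :=
  c ≤ gradePiece k g ζ θ (1 : ZMod m) ∧
  (∀ x ∈ c, ∀ y ∈ c, ⁅x, y⁆ = 0) ∧
  (∀ x ∈ c, (LieAlgebra.ad k g x).IsSemisimple) ∧
  ∀ c' : Submodule k g, c' ≤ gradePiece k g ζ θ (1 : ZMod m) →
    (∀ x ∈ c', ∀ y ∈ c', ⁅x, y⁆ = 0) → (∀ x ∈ c', (LieAlgebra.ad k g x).IsSemisimple) →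
    c ≤ c' → c = c'

/-- Polynomial functions on `g`: functions arising from the symmetric algebra of `g*`. -/
def IsPolyFun (F : g → k) : Prop :=
  ∃ p : MvPolynomial (Module.Dual k g) k, ∀ x, F x = MvPolynomial.eval (fun φ => φ x) p

/-- The number `k_i = Σ_{c ∈ ℤ, c ≡ i (mod m)} dim {v ∈ z(e) : ⁅h, v⁆ = 2c • v}`. -/
noncomputable def kNum (m : ℕ) (e h : g) (i : ZMod m) : ℕ :=
  ∑ᶠ c : ℤ, if ((c : ZMod m) = i) then
    Module.finrank k ↥(zc k g e ⊓ Module.End.eigenspace (LieAlgebra.ad k g h) (2 * (c : k)))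
  else 0

theorem coeff_zero_of_forall_nat {K V : Type*} [Field K] [CharZero K] [AddCommGroup V] [Module K V]
    (M : ℕ) (v : ℕ → V) (h : ∀ j : ℕ, ∑ i ∈ Finset.range M, ((j : K) ^ i) • v i = 0)
    (i : ℕ) (hi : i < M) : v i = 0 := by
  rw [← Module.forall_dual_apply_eq_zero_iff K]
  intro φ
  let p : Polynomial K := ∑ i ∈ Finset.range M, Polynomial.C (φ (v i)) * Polynomial.X ^ i
  have hp : p = 0 := by
    apply Polynomial.eq_zero_of_infinite_isRoot
    refine Set.Infinite.mono (s := Set.range (fun j : ℕ => (j : K))) ?_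
      (Set.infinite_range_of_injective Nat.cast_injective)
    rintro _ ⟨j, rfl⟩
    have := congrArg φ (h j)
    simp only [map_sum, map_smul, smul_eq_mul, map_zero] at this
    change Polynomial.eval (j : K) p = 0
    simp only [p, Polynomial.eval_finsetSum]
    rw [← this]
    refine Finset.sum_congr rfl fun i _ => ?_
    rw [Polynomial.eval_mul, Polynomial.eval_C, Polynomial.eval_pow, Polynomial.eval_X]
    exact mul_comm _ _
  have h2 : p.coeff i = φ (v i) := by
    simp only [p, Polynomial.finsetSum_coeff, Polynomial.coeff_C_mul_X_pow]
    rw [Finset.sum_eq_single i] <;> simp +contextual [hi, eq_comm]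
  rw [← h2, hp, Polynomial.coeff_zero]

theorem mul_aeval_mem {K A : Type*} [Field K] [Ring A] [Algebra K A]
    (I : Submodule K A) (hmul : ∀ a ∈ I, ∀ b ∈ I, a * b ∈ I) (b a : A) (hb : b ∈ I) (ha : a ∈ I)
    (p : Polynomial K) : b * Polynomial.aeval a p ∈ I := by
  have hpow : ∀ n : ℕ, b * a ^ n ∈ I := by
    intro n
    induction n with
    | zero => simpa using hb
    | succ n ih => rw [pow_succ, ← mul_assoc]; exact hmul _ ih _ ha
  rw [Polynomial.aeval_eq_sum_range, Finset.mul_sum]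
  refine I.sum_mem fun i _ => ?_
  rw [mul_smul_comm]
  exact I.smul_mem _ (hpow i)

theorem isNilpotent_of_trace_zero {K V : Type*} [Field K] [CharZero K] [AddCommGroup V]
    [Module K V] [FiniteDimensional K V] (I : Submodule K (Module.End K V))
    (hmul : ∀ a ∈ I, ∀ b ∈ I, a * b ∈ I) (htr : ∀ a ∈ I, LinearMap.trace K V a = 0)
    (a : Module.End K V) (ha : a ∈ I) : IsNilpotent a := by
  have hne : Polynomial.X * (LinearMap.charpoly a) ≠ 0 :=
    mul_ne_zero Polynomial.X_ne_zero (LinearMap.charpoly_monic a).ne_zero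
  obtain ⟨q, hq, hndvd⟩ := Polynomial.exists_eq_pow_rootMultiplicity_mul_and_not_dvd _ hne (0 : K)
  set r := Polynomial.rootMultiplicity 0 (Polynomial.X * (LinearMap.charpoly a)) with hr
  simp only [Polynomial.C_0, sub_zero] at hq hndvd
  have hr1 : r ≠ 0 := by
    have : 0 < r := by
      rw [hr, Polynomial.rootMultiplicity_pos hne]; simp
    omega
  have hcop : IsCoprime (Polynomial.X ^ r) q :=
    IsCoprime.pow_left ((Polynomial.irreducible_X.coprime_iff_not_dvd).2 hndvd)
  obtain ⟨u, v, huv⟩ := hcop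
  have h0 : a ^ r * Polynomial.aeval a q = 0 := by
    have := congrArg (Polynomial.aeval a) hq
    rw [map_mul, LinearMap.aeval_self_charpoly, mul_zero] at this
    simpa using this.symm
  have h1 : Polynomial.aeval a u * a ^ r + Polynomial.aeval a v * Polynomial.aeval a q = 1 := by
    have := congrArg (Polynomial.aeval a) huv
    simpa using this
  set e := Polynomial.aeval a u * a ^ r with he
  have hc : Commute (Polynomial.aeval a q) (Polynomial.aeval a v) := by
    rw [commute_iff_eq, ← map_mul, ← map_mul, mul_comm]
  have he1 : a ^ r * Polynomial.aeval a v * Polynomial.aeval a q = 0 := by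
    rw [mul_assoc, ← hc.eq, ← mul_assoc, h0, zero_mul]
  have hee : e * e = e := by
    have h2 : Polynomial.aeval a v * Polynomial.aeval a q = 1 - e := by rw [← h1]; abel
    have h3 : e * (1 - e) = 0 := by
      rw [← h2, he, mul_assoc, ← mul_assoc (a ^ r), he1, mul_zero]
    rw [mul_sub, mul_one, sub_eq_zero] at h3
    exact h3.symm
  have heI : e ∈ I := by
    obtain ⟨s, hs⟩ := Nat.exists_eq_succ_of_ne_zero hr1
    have : e = a * Polynomial.aeval a (Polynomial.X ^ s * u) := by
      have h5 : e = Polynomial.aeval a (u * Polynomial.X ^ r) := by simp [he]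
      have h6 : a * Polynomial.aeval a (Polynomial.X ^ s * u) =
        Polynomial.aeval a (Polynomial.X * (Polynomial.X ^ s * u)) := by simp
      rw [h5, h6, hs]; congr 1; rw [Nat.succ_eq_add_one]; ring
    rw [this]
    exact mul_aeval_mem I hmul a a ha ha _
  have he0 : e = 0 := LinearMap.IsIdempotentElem.eq_zero_of_trace_eq_zero hee (htr e heI)
  refine ⟨r, ?_⟩
  rw [he0, zero_add] at h1
  calc a ^ r = a ^ r * 1 := (mul_one _).symm
    _ = 0 := by rw [← h1, ← mul_assoc, he1]

theorem exists_pow_eq_bot {K V : Type*} [Field K] [AddCommGroup V]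
    [Module K V] [FiniteDimensional K V] (I : Submodule K (Module.End K V))
    (hmul : ∀ a ∈ I, ∀ b ∈ I, a * b ∈ I) (hnil : ∀ a ∈ I, IsNilpotent a) :
    ∃ N : ℕ, I ^ N = ⊥ := by
  let _ := LieRing.ofAssociativeRing (A := Module.End K V)
  let L : LieSubalgebra K (Module.End K V) :=
    { I with
      lie_mem' := by
        intro x y hx hy
        rw [Ring.lie_def]
        exact I.sub_mem (hmul _ hx _ hy) (hmul _ hy _ hx) }
  have h : LieModule.IsNilpotent L V := by
    rw [LieModule.isNilpotent_iff_forall' (R := K)]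
    intro x
    exact hnil x.1 x.2
  obtain ⟨N, hN⟩ := (LieModule.isNilpotent_iff K L V).1 h
  refine ⟨N, ?_⟩
  have key : ∀ n : ℕ, ∀ a ∈ I ^ n, ∀ v : V, a v ∈ LieModule.lowerCentralSeries K L V n := by
    intro n
    induction n with
    | zero => intro a _ v; simp
    | succ n ih =>
      intro a ha v
      rw [pow_succ'] at ha
      induction ha using Submodule.mul_induction_on' with
      | mem_mul_mem x hx y hy =>
        rw [LieModule.lowerCentralSeries_succ]
        exact LieSubmodule.lie_mem_lie (x := (⟨x, hx⟩ : L)) (LieSubmodule.mem_top _) (ih y hy v)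
      | add x hx y hy h1 h2 => exact add_mem h1 h2
  rw [eq_bot_iff]
  intro a ha
  rw [Submodule.mem_bot]
  ext v
  have := key N a ha v
  rw [hN] at this
  simpa using this

theorem exp_expand {K A : Type*} [Field K] [CharZero K] [Ring A] [Algebra K A] [Module ℚ A]
    (a : A) (ha : IsNilpotent a) :
    ∃ G : Polynomial K, IsNilpotent.exp a = 1 + a + a ^ 2 * Polynomial.aeval a G := by
  obtain ⟨n, hn⟩ := ha
  have hn2 : a ^ (n + 2) = 0 := by rw [pow_add, hn, zero_mul]
  refine ⟨∑ i ∈ Finset.range n, Polynomial.C (((i + 2).factorial : K)⁻¹) * Polynomial.X ^ i, ?_⟩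
  rw [IsNilpotent.exp_eq_sum hn2, Finset.sum_range_succ', Finset.sum_range_succ']
  have h : ∀ i : ℕ, a ^ 2 * Polynomial.aeval a (Polynomial.C (((i + 2).factorial : K)⁻¹)
      * Polynomial.X ^ i) = (((i + 1 + 1).factorial : ℚ)⁻¹) • a ^ (i + 1 + 1) := by
    intro i
    rw [← Rat.cast_smul_eq_qsmul K, map_mul, Polynomial.aeval_C, map_pow, Polynomial.aeval_X,
      ← Algebra.smul_def, mul_smul_comm, ← pow_add]
    congr 1
    · simp
    · congr 1; ring
  rw [map_sum, Finset.mul_sum, Finset.sum_congr rfl (fun i _ => h i)]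
  simp
  abel

theorem isNilpotent_aeval_of_dvd {K A : Type*} [Field K] [Ring A] [Algebra K A]
    (N : A) (hN : IsNilpotent N) (F : Polynomial K) (hF : Polynomial.X ∣ F) :
    IsNilpotent (Polynomial.aeval N F) := by
  obtain ⟨G, rfl⟩ := hF
  rw [map_mul, Polynomial.aeval_X]
  refine Commute.isNilpotent_mul_right ?_ hN
  have h : N * Polynomial.aeval N G = Polynomial.aeval N G * N := by
    calc N * Polynomial.aeval N G = Polynomial.aeval N (Polynomial.X * G) := by simp
      _ = Polynomial.aeval N (G * Polynomial.X) := by rw [mul_comm]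
      _ = _ := by simp
  exact h

theorem exists_log {K A : Type*} [Field K] [CharZero K] [Ring A] [Algebra K A] [Module ℚ A]
    (N : A) (hN : IsNilpotent N) :
    ∃ P : Polynomial K, IsNilpotent.exp (N + N ^ 2 * Polynomial.aeval N P) = 1 + N := by
  have key : ∀ j : ℕ, ∃ P R : Polynomial K,
      (1 + N) * IsNilpotent.exp (Polynomial.aeval N (-(Polynomial.X + Polynomial.X ^ 2 * P)))
      = 1 + Polynomial.aeval N (Polynomial.X ^ (j + 2) * R) := by
    intro j
    induction j with
    | zero =>
      obtain ⟨G, hG⟩ := exp_expand (K := K) (-N) hN.neg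
      refine ⟨0, -1 + (1 + Polynomial.X) * G.comp (-Polynomial.X), ?_⟩
      have : Polynomial.aeval N (-(Polynomial.X + Polynomial.X ^ 2 * 0) : Polynomial K) = -N := by
        simp
      rw [this, hG]
      have h2 : Polynomial.aeval (-N) G = Polynomial.aeval N (G.comp (-Polynomial.X)) := by
        rw [Polynomial.aeval_comp]; simp
      rw [h2]
      have : (1 + N) * (1 + -N + (-N) ^ 2 * Polynomial.aeval N (G.comp (-Polynomial.X))) =
        Polynomial.aeval N ((1 + Polynomial.X) * (1 + -Polynomial.X + (-Polynomial.X) ^ 2 *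
          (G.comp (-Polynomial.X)))) := by simp
      rw [this, ← map_one (Polynomial.aeval (R := K) N), ← map_add]
      congr 1
      ring
    | succ j ih =>
      obtain ⟨P, R, h⟩ := ih
      set W : Polynomial K := Polynomial.X ^ (j + 2) * R with hW
      have hWn : IsNilpotent (Polynomial.aeval N (-W)) :=
        isNilpotent_aeval_of_dvd N hN _ (by
          rw [dvd_neg]
          exact Dvd.dvd.mul_right (dvd_pow_self _ (by omega)) _)
      obtain ⟨G, hG⟩ := exp_expand (K := K) (Polynomial.aeval N (-W)) hWn
      refine ⟨P + Polynomial.X ^ j * R, Polynomial.X ^ (j + 1) * R ^ 2 *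
        (-1 + (1 + W) * G.comp (-W)), ?_⟩
      have e1 : Polynomial.aeval N (-(Polynomial.X + Polynomial.X ^ 2 *
          (P + Polynomial.X ^ j * R)) : Polynomial K) =
          Polynomial.aeval N (-(Polynomial.X + Polynomial.X ^ 2 * P)) +
          Polynomial.aeval N (-W) := by
        rw [← map_add]; congr 1; rw [hW]; ring
      rw [e1, IsNilpotent.exp_add_of_commute ?_ ?_ hWn, ← mul_assoc, h, hG,
        ← Polynomial.aeval_comp]
      · rw [← map_one (Polynomial.aeval (R := K) N), ← map_add, ← map_add, ← map_pow, ← map_mul,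
          ← map_add, ← map_mul, ← map_add]
        congr 1
        rw [hW]
        ring
      · rw [commute_iff_eq, ← map_mul, ← map_mul, mul_comm]
      · refine isNilpotent_aeval_of_dvd N hN _ ?_
        rw [dvd_neg]
        exact dvd_add dvd_rfl (Dvd.dvd.mul_right (dvd_pow_self _ (by omega)) _)
  obtain ⟨n, hn⟩ := hN
  obtain ⟨P, R, h⟩ := key n
  refine ⟨P, ?_⟩
  have hz : Polynomial.aeval N (Polynomial.X ^ (n + 2) * R) = 0 := by
    simp [pow_add, hn]
  have hD : Polynomial.aeval N (-(Polynomial.X + Polynomial.X ^ 2 * P)) =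
    -(N + N ^ 2 * Polynomial.aeval N P) := by simp
  have hnil : IsNilpotent (N + N ^ 2 * Polynomial.aeval N P) := by
    have := isNilpotent_aeval_of_dvd N ⟨n, hn⟩ (Polynomial.X + Polynomial.X ^ 2 * P)
      (dvd_add dvd_rfl (Dvd.dvd.mul_right (dvd_pow_self _ (by omega)) _))
    simpa using this
  rw [hz, hD, add_zero] at h
  calc IsNilpotent.exp (N + N ^ 2 * Polynomial.aeval N P)
      = ((1 + N) * IsNilpotent.exp (-(N + N ^ 2 * Polynomial.aeval N P))) *
        IsNilpotent.exp (N + N ^ 2 * Polynomial.aeval N P) := by rw [h, one_mul]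
    _ = 1 + N := by rw [mul_assoc, IsNilpotent.exp_neg_mul_exp_self hnil, mul_one]

theorem isNilpotent_log {K A : Type*} [Field K] [Ring A] [Algebra K A]
    (N : A) (hN : IsNilpotent N) (P : Polynomial K) :
    IsNilpotent (N + N ^ 2 * Polynomial.aeval N P) := by
  have := isNilpotent_aeval_of_dvd N hN (Polynomial.X + Polynomial.X ^ 2 * P)
      (dvd_add dvd_rfl (Dvd.dvd.mul_right (dvd_pow_self _ (by omega)) _))
  simpa using this

theorem exp_nsmul_eq_pow {A : Type*} [Ring A] [Module ℚ A] (a : A) (ha : IsNilpotent a) (j : ℕ) :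
    IsNilpotent.exp (j • a) = IsNilpotent.exp a ^ j := by
  induction j with
  | zero => simp
  | succ j ih =>
    rw [succ_nsmul, IsNilpotent.exp_add_of_commute, ih, pow_succ]
    · exact (Commute.refl a).smul_left j
    · exact ha.smul j
    · exact ha

theorem exp_nsmul_eq_sum {K A : Type*} [Field K] [CharZero K] [Ring A] [Algebra K A] [Module ℚ A]
    (a : A) (M : ℕ) (ha : a ^ M = 0) (j : ℕ) :
    IsNilpotent.exp a ^ j = ∑ i ∈ Finset.range M, (j : K) ^ i • ((i.factorial : K)⁻¹ • a ^ i) := by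
  rw [← exp_nsmul_eq_pow a ⟨M, ha⟩, IsNilpotent.exp_eq_sum (k := M)]
  · refine Finset.sum_congr rfl fun i _ => ?_
    rw [← Rat.cast_smul_eq_qsmul K, smul_comm]
    congr 1
    · simp
    · rw [← Nat.cast_smul_eq_nsmul K, smul_pow]
  · rw [← Nat.cast_smul_eq_nsmul K, smul_pow, ha, smul_zero]

theorem intertwine_of_exp {K V W : Type*} [Field K] [CharZero K] [AddCommGroup V] [Module K V]
    [AddCommGroup W] [Module K W] [Module ℚ (Module.End K V)] [Module ℚ (Module.End K W)]
    (B : W →ₗ[K] V) (E : Module.End K W) (D : Module.End K V) (hE : IsNilpotent E)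
    (hD : IsNilpotent D) (h : ∀ w, IsNilpotent.exp D (B w) = B (IsNilpotent.exp E w)) (w : W) :
    D (B w) = B (E w) := by
  have hj : ∀ j : ℕ, ∀ w, (IsNilpotent.exp D ^ j) (B w) = B ((IsNilpotent.exp E ^ j) w) := by
    intro j
    induction j with
    | zero => simp
    | succ j ih =>
      intro w
      rw [pow_succ, pow_succ, Module.End.mul_apply, Module.End.mul_apply, h, ih]
  obtain ⟨n1, h1⟩ := hE
  obtain ⟨n2, h2⟩ := hD
  set M := n1 + n2 + 2
  have h1' : E ^ M = 0 := pow_eq_zero_of_le (by omega) h1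
  have h2' : D ^ M = 0 := pow_eq_zero_of_le (by omega) h2
  have := coeff_zero_of_forall_nat (K := K) M
    (fun i => (i.factorial : K)⁻¹ • ((D ^ i) (B w) - B ((E ^ i) w))) (by
      intro j
      have := hj j w
      rw [exp_nsmul_eq_sum (K := K) D M h2', exp_nsmul_eq_sum (K := K) E M h1'] at this
      simp only [LinearMap.sum_apply, LinearMap.smul_apply, map_sum, map_smul] at this
      rw [← sub_eq_zero, ← Finset.sum_sub_distrib] at this
      simpa [smul_sub] using this) 1 (by omega)
  simpa [sub_eq_zero] using this

section Descent

variable {K A G : Type*} [Field K] [CharZero K] [Ring A] [Algebra K A] [Module ℚ A] [Group G]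

theorem pow_succ_mul_mem (I : Submodule K A) (hmul : ∀ a ∈ I, ∀ b ∈ I, a * b ∈ I) (n : ℕ) :
    I ^ (n + 2) ≤ I ^ (n + 1) := by
  have h : I * I ≤ I := Submodule.mul_le.2 hmul
  calc I ^ (n + 2) = I ^ n * (I * I) := by rw [pow_add, pow_two]
    _ ≤ I ^ n * I := by gcongr
    _ = I ^ (n + 1) := (pow_succ _ _).symm

theorem pow_succ_le_self (I : Submodule K A) (hmul : ∀ a ∈ I, ∀ b ∈ I, a * b ∈ I) (n : ℕ) :
    I ^ (n + 1) ≤ I := by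
  induction n with
  | zero => simp
  | succ n ih => exact (pow_succ_mul_mem I hmul n).trans ih

theorem mul_mem_pow (I : Submodule K A) (hmul : ∀ a ∈ I, ∀ b ∈ I, a * b ∈ I) (n : ℕ)
    (a b : A) (ha : a ∈ I ^ (n + 1)) (hb : b ∈ I) : a * b ∈ I ^ (n + 2) := by
  rw [pow_succ]; exact Submodule.mul_mem_mul ha hb

theorem sq_mul_aeval_mem (I : Submodule K A) (hmul : ∀ a ∈ I, ∀ b ∈ I, a * b ∈ I) (n : ℕ)
    (a : A) (ha : a ∈ I ^ (n + 1)) (P : Polynomial K) :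
    a ^ 2 * Polynomial.aeval a P ∈ I ^ (n + 2) := by
  rw [pow_two, mul_assoc]
  have haI := pow_succ_le_self I hmul n ha
  exact mul_mem_pow I hmul n _ _ ha (mul_aeval_mem I hmul a a haI haI P)

theorem conj_mem_pow (I : Submodule K A) (φ : G →* A) (θ : G)
    (hI : ∀ a ∈ I, φ θ * a * φ θ⁻¹ ∈ I) (n : ℕ) (a : A) (ha : a ∈ I ^ (n + 1)) :
    φ θ * a * φ θ⁻¹ ∈ I ^ (n + 1) := by
  have h1 : φ θ⁻¹ * φ θ = 1 := by rw [← map_mul]; simp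
  induction n generalizing a with
  | zero => simpa using hI a (by simpa using ha)
  | succ n ih =>
    rw [pow_succ] at ha ⊢
    induction ha using Submodule.mul_induction_on' with
    | mem_mul_mem x hx y hy =>
      have : φ θ * (x * y) * φ θ⁻¹ = (φ θ * x * φ θ⁻¹) * (φ θ * y * φ θ⁻¹) := by
        calc φ θ * (x * y) * φ θ⁻¹ = φ θ * x * 1 * y * φ θ⁻¹ := by noncomm_ring
          _ = _ := by rw [← h1]; noncomm_ring
      rw [this]
      exact Submodule.mul_mem_mul (ih x hx) (hI y hy)
    | add x hx y hy h1 h2 => rw [mul_add, add_mul]; exact add_mem h1 h2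

theorem descent (φ : G →* A) (hφ : Function.Injective φ) (Z : Subgroup G) (L I : Submodule K A)
    (hI : ∀ z ∈ Z, φ z - 1 ∈ I) (hmul : ∀ a ∈ I, ∀ b ∈ I, a * b ∈ I)
    (M : ℕ) (hM : I ^ (M + 1) = ⊥) (hnil : ∀ a ∈ I, IsNilpotent a)
    (hlog : ∀ z ∈ Z, ∃ P : Polynomial K,
      (φ z - 1) + (φ z - 1) ^ 2 * Polynomial.aeval (φ z - 1) P ∈ L)
    (hexp : ∀ D ∈ L, IsNilpotent D → ∃ z ∈ Z, φ z = IsNilpotent.exp D)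
    (m : ℕ) (hm : 1 ≤ m) (θ : G) (hθ : θ ^ m = 1) (hθZ : ∀ z ∈ Z, θ * z * θ⁻¹ ∈ Z)
    (hθI : ∀ a ∈ I, φ θ * a * φ θ⁻¹ ∈ I)
    (d j : ℕ) (hdj : j + d = M) (θ₁ : G) (h₁ : θ₁ ^ m = 1) (hσ : θ * θ₁⁻¹ ∈ Z)
    (hσI : φ (θ * θ₁⁻¹) - 1 ∈ I ^ (j + 1)) :
    ∃ z ∈ Z, θ = z * θ₁ * z⁻¹ := by
  induction d generalizing j θ₁ with
  | zero =>
    have : j = M := by omega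
    subst this
    rw [hM, Submodule.mem_bot, sub_eq_zero, ← map_one φ] at hσI
    have := hφ hσI
    exact ⟨1, Z.one_mem, by simpa [mul_inv_eq_one] using this⟩
  | succ d ih =>
    have hmulJ : ∀ z ∈ Z, ∀ n : ℕ, ∀ a ∈ I ^ (n + 1), a * φ z ∈ I ^ (n + 1) := by
      intro z hz n a ha
      have : a * φ z = a + a * (φ z - 1) := by noncomm_ring
      rw [this]
      exact add_mem ha (pow_succ_mul_mem I hmul n (mul_mem_pow I hmul n _ _ ha (hI z hz)))
    let zz : ℕ → G := fun i => θ ^ i * (θ₁ ^ i)⁻¹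
    have hzsucc : ∀ i, zz (i + 1) = θ * zz i * θ⁻¹ * (θ * θ₁⁻¹) := by
      intro i
      simp only [zz]
      rw [pow_succ' θ, pow_succ θ₁]
      rw [show (θ₁ ^ i * θ₁)⁻¹ = (θ₁ ^ i)⁻¹ * θ₁⁻¹ by
        rw [← pow_succ, pow_succ', mul_inv_rev]]
      group
    have hzZ : ∀ i, zz i ∈ Z := by
      intro i
      induction i with
      | zero => simp [zz, Z.one_mem]
      | succ i ih2 => rw [hzsucc]; exact Z.mul_mem (hθZ _ ih2) hσ
    have hzI : ∀ i, φ (zz i) - 1 ∈ I ^ (j + 1) := by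
      intro i
      induction i with
      | zero => simp [zz]
      | succ i ih2 =>
        have e1 : φ (zz (i + 1)) - 1 =
            (φ θ * (φ (zz i) - 1) * φ θ⁻¹) * φ (θ * θ₁⁻¹) + (φ (θ * θ₁⁻¹) - 1) := by
          have : φ θ * φ θ⁻¹ = 1 := by rw [← map_mul]; simp
          rw [mul_sub, mul_one, sub_mul, this, sub_mul, one_mul, hzsucc, map_mul, map_mul, map_mul]
          abel
        rw [e1]
        exact add_mem (hmulJ _ hσ _ _ (conj_mem_pow I φ θ hθI j _ ih2)) hσI
    choose P hP using fun i => hlog (zz i) (hzZ i)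
    set Dl : ℕ → A := fun i =>
      (φ (zz i) - 1) + (φ (zz i) - 1) ^ 2 * Polynomial.aeval (φ (zz i) - 1) (P i) with hDl
    have hDsub : ∀ i, Dl i - (φ (zz i) - 1) ∈ I ^ (j + 2) := by
      intro i
      simp only [hDl, add_sub_cancel_left]
      exact sq_mul_aeval_mem I hmul j _ (hzI i) _
    have hm0 : (m : K) ≠ 0 := by
      rw [Nat.cast_ne_zero]; omega
    set D : A := (m : K)⁻¹ • ∑ i ∈ Finset.range m, Dl i with hD
    set T : A := (m : K)⁻¹ • ∑ i ∈ Finset.range m, φ (zz i) with hT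
    have hDL : D ∈ L := L.smul_mem _ (L.sum_mem fun i _ => hP i)
    have hDT : 1 + D - T ∈ I ^ (j + 2) := by
      have : 1 + D - T = (m : K)⁻¹ • ∑ i ∈ Finset.range m, (Dl i - (φ (zz i) - 1)) := by
        rw [hD, hT]
        simp only [Finset.sum_sub_distrib, smul_sub, Finset.sum_const, Finset.card_range]
        rw [← Nat.cast_smul_eq_nsmul K, smul_smul, inv_mul_cancel₀ hm0, one_smul]
        abel
      rw [this]
      exact Submodule.smul_mem _ _ (Submodule.sum_mem _ fun i _ => hDsub i)
    have hDI : D ∈ I ^ (j + 1) := by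
      refine Submodule.smul_mem _ _ (Submodule.sum_mem _ fun i _ => ?_)
      have := add_mem (pow_succ_mul_mem I hmul j (hDsub i)) (hzI i)
      simpa using this
    have hDn := hnil D (pow_succ_le_self I hmul j hDI)
    obtain ⟨z, hzZ', hz⟩ := hexp D hDL hDn
    have hzT : φ z - T ∈ I ^ (j + 2) := by
      obtain ⟨Q, hQ⟩ := exp_expand (K := K) D hDn
      have : φ z - T = (1 + D - T) + D ^ 2 * Polynomial.aeval D Q := by
        rw [hz, hQ]; abel
      rw [this]
      exact add_mem hDT (sq_mul_aeval_mem I hmul j _ hDI _)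
    have hTint : φ θ * T * φ θ₁⁻¹ = T := by
      have h2 : ∀ i, φ θ * φ (zz i) * φ θ₁⁻¹ = φ (zz (i + 1)) := by
        intro i
        rw [hzsucc, ← map_mul, ← map_mul]
        congr 1
        group
      rw [hT, mul_smul_comm, smul_mul_assoc, Finset.mul_sum, Finset.sum_mul,
        Finset.sum_congr rfl (fun i _ => h2 i)]
      congr 1
      have h3 := Finset.sum_range_succ (fun i => φ (zz i)) m
      rw [Finset.sum_range_succ'] at h3
      have h4 : φ (zz m) = φ (zz 0) := by simp [zz, hθ, h₁]
      rw [h4] at h3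
      exact add_right_cancel h3
    have hnew : θ * (z * θ₁ * z⁻¹)⁻¹ = (θ * z * θ⁻¹) * (θ * θ₁⁻¹) * z⁻¹ := by group
    have hnewI : φ (θ * (z * θ₁ * z⁻¹)⁻¹) - 1 ∈ I ^ (j + 1 + 1) := by
      have hzz : φ z * φ z⁻¹ = 1 := by rw [← map_mul]; simp
      have e1 : φ (θ * (z * θ₁ * z⁻¹)⁻¹) = φ θ * φ z * φ θ₁⁻¹ * φ z⁻¹ := by
        rw [← map_mul, ← map_mul, ← map_mul]; congr 1; group
      have e2 : φ θ * (φ z - T) * φ θ⁻¹ * φ (θ * θ₁⁻¹) = φ θ * φ z * φ θ₁⁻¹ - T := by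
        have : φ θ⁻¹ * φ (θ * θ₁⁻¹) = φ θ₁⁻¹ := by rw [← map_mul]; congr 1; group
        rw [mul_assoc, this, mul_sub, sub_mul, hTint]
      have e3 : φ (θ * (z * θ₁ * z⁻¹)⁻¹) - 1 =
          (φ θ * (φ z - T) * φ θ⁻¹ * φ (θ * θ₁⁻¹) - (φ z - T)) * φ z⁻¹ := by
        rw [e2, e1, ← hzz]; noncomm_ring
      rw [e3]
      refine hmulJ _ (Z.inv_mem hzZ') (j + 1) _ (sub_mem ?_ hzT)
      exact hmulJ _ hσ (j + 1) _ (conj_mem_pow I φ θ hθI (j + 1) _ hzT)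
    obtain ⟨w, hw, hw2⟩ := ih (j + 1) (by omega) (z * θ₁ * z⁻¹)
      (by rw [conj_pow, h₁]; simp)
      (by rw [hnew]; exact Z.mul_mem (Z.mul_mem (hθZ _ hzZ') hσ) (Z.inv_mem hzZ')) hnewI
    exact ⟨w * z, Z.mul_mem hw hzZ', by rw [hw2]; group⟩

end Descent

section Concrete

/-- The coercion from linear automorphisms to endomorphisms, as a monoid homomorphism. -/
def autHom : (g ≃ₗ[k] g) →* Module.End k g where
  toFun f := (f : g →ₗ[k] g)
  map_one' := rfl
  map_mul' _ _ := rfl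

theorem expEnd_eq [LieAlgebra ℚ g] (N : Module.End k g) (hN : IsNilpotent N) :
    expEnd k g N = IsNilpotent.exp N := by
  have h0 : N ^ (Module.finrank k g) = 0 := by
    have := LinearMap.aeval_self_charpoly N
    rw [(LinearMap.isNilpotent_iff_charpoly N).1 hN] at this
    simpa using this
  have h1 : N ^ (Module.finrank k g + 1) = 0 := by rw [pow_succ, h0, zero_mul]
  rw [IsNilpotent.exp_eq_sum h1, expEnd]
  refine Finset.sum_congr rfl fun i _ => ?_
  rw [← Rat.cast_smul_eq_qsmul k]
  simp

theorem exp_ad_lie [LieAlgebra ℚ g] (n : g) (hn : IsNilpotent (LieAlgebra.ad k g n)) (x y : g) :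
    IsNilpotent.exp (LieAlgebra.ad k g n) ⁅x, y⁆ =
      ⁅IsNilpotent.exp (LieAlgebra.ad k g n) x, IsNilpotent.exp (LieAlgebra.ad k g n) y⁆ := by
  let D : LieDerivation k g g := LieDerivation.ad k g n
  have hD : D.toLinearMap = LieAlgebra.ad k g n := by ext x; simp [D]
  have hDn : IsNilpotent D.toLinearMap := by rw [hD]; exact hn
  have := (LieDerivation.exp D hDn).map_lie x y
  simp only [LieDerivation.exp_map_apply, hD] at this
  exact this

theorem intG_lie [LieAlgebra ℚ g] (τ : g ≃ₗ[k] g) (hτ : τ ∈ IntG k g) (x y : g) :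
    τ ⁅x, y⁆ = ⁅τ x, τ y⁆ := by
  induction hτ using Subgroup.closure_induction generalizing x y with
  | mem τ h =>
    obtain ⟨n, hn, h⟩ := h
    rw [expEnd_eq k g _ hn] at h
    have := exp_ad_lie k g n hn x y
    rw [← h] at this
    exact this
  | one => rfl
  | mul a b _ _ ha hb =>
    change a (b ⁅x, y⁆) = ⁅a (b x), a (b y)⁆
    rw [hb, ha]
  | inv a _ ha =>
    apply a.injective
    rw [ha]
    simp

theorem exp_mem_intG [LieAlgebra ℚ g] (n : g) (hn : IsNilpotent (LieAlgebra.ad k g n)) :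
    ∃ τ ∈ IntG k g, autHom k g τ = IsNilpotent.exp (LieAlgebra.ad k g n) := by
  have hb := (Module.End.isUnit_iff _).1 (IsNilpotent.isUnit_exp hn)
  refine ⟨LinearEquiv.ofBijective _ hb, ?_, ?_⟩
  · apply Subgroup.subset_closure
    refine ⟨n, hn, ?_⟩
    rw [expEnd_eq k g _ hn]
    ext; rfl
  · ext; rfl

theorem ad_conj (θ : g ≃ₗ[k] g) (hθ : ∀ x y : g, θ ⁅x, y⁆ = ⁅θ x, θ y⁆) (n : g) :
    LieAlgebra.ad k g (θ n) = θ.conjAlgEquiv k (LieAlgebra.ad k g n) := by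
  ext x
  simp [LinearEquiv.conjAlgEquiv_apply, hθ]

theorem intG_normal [LieAlgebra ℚ g] (θ : g ≃ₗ[k] g) (hθ : ∀ x y : g, θ ⁅x, y⁆ = ⁅θ x, θ y⁆)
    (τ : g ≃ₗ[k] g) (hτ : τ ∈ IntG k g) : θ * τ * θ⁻¹ ∈ IntG k g := by
  induction hτ using Subgroup.closure_induction with
  | mem τ h =>
    obtain ⟨n, hn, h⟩ := h
    have hn' : IsNilpotent (LieAlgebra.ad k g (θ n)) := by
      rw [ad_conj k g θ hθ]; exact hn.map _
    apply Subgroup.subset_closure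
    refine ⟨θ n, hn', ?_⟩
    rw [expEnd_eq k g _ hn', ad_conj k g θ hθ, ← IsNilpotent.map_exp hn, ← expEnd_eq k g _ hn, ← h]
    rfl
  | one => simpa using (IntG k g).one_mem
  | mul a b _ _ ha hb =>
    have : θ * (a * b) * θ⁻¹ = (θ * a * θ⁻¹) * (θ * b * θ⁻¹) := by group
    rw [this]; exact mul_mem ha hb
  | inv a _ ha =>
    have : θ * a⁻¹ * θ⁻¹ = (θ * a * θ⁻¹)⁻¹ := by group
    rw [this]; exact inv_mem ha

open TensorProduct in
theorem exists_ad_of_exp [LieAlgebra ℚ g] (u : g ≃ₗ[k] g)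
    (hu : ∀ x y : g, u ⁅x, y⁆ = ⁅u x, u y⁆) (D : Module.End k g) (hD : IsNilpotent D)
    (h : IsNilpotent.exp D = (u : g →ₗ[k] g)) : ∃ x : g, LieAlgebra.ad k g x = D := by
  let B : g ⊗[k] g →ₗ[k] g := TensorProduct.lift (LieModule.toEnd k g g : g →ₗ[k] Module.End k g)
  let DL : Module.End k (g ⊗[k] g) := D.lTensor g
  let DR : Module.End k (g ⊗[k] g) := D.rTensor g
  let _ : Module ℚ (g ⊗[k] g) := Module.compHom _ (algebraMap ℚ k)
  have h_nilL : IsNilpotent DL := hD.map <| Module.End.lTensorAlgHom k g g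
  have h_nilR : IsNilpotent DR := hD.map <| Module.End.rTensorAlgHom k g g
  have h_comm : Commute DL DR := by ext; simp [DL, DR]
  have h₂ : IsNilpotent.exp DL = (IsNilpotent.exp D).lTensor g :=
    (hD.map_exp (Module.End.lTensorAlgHom k g g)).symm
  have h₃ : IsNilpotent.exp DR = (IsNilpotent.exp D).rTensor g :=
    (hD.map_exp (Module.End.rTensorAlgHom k g g)).symm
  have key := intertwine_of_exp B (DL + DR) D (h_comm.isNilpotent_add h_nilL h_nilR) hD (by
    intro w
    rw [IsNilpotent.exp_add_of_commute h_comm h_nilL h_nilR, h₂, h₃, h]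
    induction w using TensorProduct.induction_on with
    | zero => simp
    | tmul x y => simp [B, hu]
    | add x y hx hy => rw [map_add, map_add, hx, hy, map_add, map_add])
  let D' : LieDerivation k g g :=
    { D with
      leibniz' := by
        intro a b
        have := key (a ⊗ₜ b)
        simp [B, DL, DR] at this
        change D ⁅a, b⁆ = ⁅a, D b⁆ - ⁅b, D a⁆
        rw [this, ← lie_skew (D a) b]
        abel }
  obtain ⟨x, hx⟩ := LieDerivation.IsKilling.exists_eq_ad D'
  refine ⟨x, ?_⟩
  ext y
  have := congrArg (fun d : LieDerivation k g g => d y) hx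
  have h : ⁅x, y⁆ = D' y := by simpa using this
  exact h

theorem unip_log [LieAlgebra ℚ g] (u : g ≃ₗ[k] g)
    (hu : ∀ x y : g, u ⁅x, y⁆ = ⁅u x, u y⁆) (hn : IsNilpotent (autHom k g u - 1)) :
    ∃ (P : Polynomial k) (x : g), LieAlgebra.ad k g x = (autHom k g u - 1) +
      (autHom k g u - 1) ^ 2 * Polynomial.aeval (autHom k g u - 1) P ∧
      IsNilpotent (LieAlgebra.ad k g x) ∧
      IsNilpotent.exp (LieAlgebra.ad k g x) = autHom k g u := by
  obtain ⟨P, hP⟩ := exists_log (K := k) _ hn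
  rw [add_sub_cancel] at hP
  have hnil := isNilpotent_log (K := k) _ hn P
  obtain ⟨x, hx⟩ := exists_ad_of_exp k g u hu _ hnil hP
  exact ⟨P, x, hx, by rw [hx]; exact hnil, by rw [hx]; exact hP⟩

theorem unip_mem_intG [LieAlgebra ℚ g] (u : g ≃ₗ[k] g)
    (hu : ∀ x y : g, u ⁅x, y⁆ = ⁅u x, u y⁆) (hn : IsNilpotent (autHom k g u - 1)) :
    u ∈ IntG k g := by
  obtain ⟨P, x, -, hx, he⟩ := unip_log k g u hu hn
  apply Subgroup.subset_closure
  exact ⟨x, hx, by rw [expEnd_eq k g _ hx, he]; rfl⟩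

theorem lie_mem_genEig (σ : g ≃ₗ[k] g) (hσ : ∀ x y : g, σ ⁅x, y⁆ = ⁅σ x, σ y⁆) (a b : k)
    (n : ℕ) : ∀ (N M : ℕ) (x y : g), N + M = n →
      (((σ : g →ₗ[k] g) - a • (1 : Module.End k g)) ^ N) x = 0 →
      (((σ : g →ₗ[k] g) - b • (1 : Module.End k g)) ^ M) y = 0 →
      (((σ : g →ₗ[k] g) - (a * b) • (1 : Module.End k g)) ^ n) ⁅x, y⁆ = 0 := by
  induction n with
  | zero =>
    intro N M x y h hx hy
    obtain rfl : N = 0 := by omega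
    have : x = 0 := by simpa using hx
    simp [this]
  | succ n ih =>
    intro N M x y h hx hy
    rcases Nat.eq_zero_or_pos N with rfl | hN
    · have : x = 0 := by simpa using hx
      simp [this]
    rcases Nat.eq_zero_or_pos M with rfl | hM
    · have : y = 0 := by simpa using hy
      simp [this]
    obtain ⟨N, rfl⟩ := Nat.exists_eq_succ_of_ne_zero hN.ne'
    obtain ⟨M, rfl⟩ := Nat.exists_eq_succ_of_ne_zero hM.ne'
    have e : ((σ : g →ₗ[k] g) - (a * b) • (1 : Module.End k g)) ⁅x, y⁆ =
      ⁅((σ : g →ₗ[k] g) - a • (1 : Module.End k g)) x, σ y⁆ +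
      a • ⁅x, ((σ : g →ₗ[k] g) - b • (1 : Module.End k g)) y⁆ := by
      simp [hσ, smul_sub, smul_smul]
    rw [pow_succ, Module.End.mul_apply, e, map_add, map_smul]
    have hc : Commute ((σ : g →ₗ[k] g) - b • (1 : Module.End k g)) (σ : g →ₗ[k] g) :=
      (Commute.refl _).sub_left ((Commute.one_left _).smul_left b)
    rw [ih N (M + 1) _ (σ y) (by omega) (by rw [pow_succ] at hx; exact hx) ?_,
      ih (N + 1) M x _ (by omega) hx (by rw [pow_succ] at hy; exact hy)]
    · simp
    · have := LinearMap.congr_fun (hc.pow_left (M + 1)).eq y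
      simp only [Module.End.mul_apply] at this
      change (((σ : g →ₗ[k] g) - b • (1 : Module.End k g)) ^ (M + 1)) ((σ : g →ₗ[k] g) y) = 0
      rw [this]
      have hy' : (((σ : g →ₗ[k] g) - b • (1 : Module.End k g)) ^ (M + 1)) y = 0 := hy
      rw [hy', map_zero]

theorem jordan (σ : g ≃ₗ[k] g) (hσ : ∀ x y : g, σ ⁅x, y⁆ = ⁅σ x, σ y⁆) :
    ∃ s : g ≃ₗ[k] g, (∀ x y : g, s ⁅x, y⁆ = ⁅s x, s y⁆) ∧
      Module.End.IsSemisimple (s : g →ₗ[k] g) ∧ IsNilpotent (autHom k g (s⁻¹ * σ) - 1) ∧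
      ∀ e, σ e = e → s e = e := by
  set f : Module.End k g := (σ : g →ₗ[k] g) with hf
  obtain ⟨n, hn, s, hs, hnil, hss, hsum⟩ := Module.End.exists_isNilpotent_isSemisimple (f := f)
  have hcfs : Commute f s := Algebra.commute_of_mem_adjoin_self hs
  have hcfn : Commute f n := Algebra.commute_of_mem_adjoin_self hn
  have hcns : Commute n s := by
    have : n = f - s := by rw [hsum]; abel
    rw [this]; exact hcfs.sub_left (Commute.refl s)
  have hfu : IsUnit f := (Module.End.isUnit_iff _).2 σ.bijective
  have hsu : IsUnit s := by
    have : s = f + (-n) := by rw [hsum]; abel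
    rw [this]
    exact IsNilpotent.isUnit_add_left_of_commute hnil.neg hfu hcfn.symm.neg_left
  let s' : g ≃ₗ[k] g := LinearEquiv.ofBijective s ((Module.End.isUnit_iff _).1 hsu)
  have hs' : (s' : g →ₗ[k] g) = s := by ext; rfl
  have heig : ∀ (a : k) (x : g), x ∈ f.maxGenEigenspace a → s x = a • x := by
    intro a x hx
    refine Module.End.apply_eq_of_mem_of_comm_of_isFinitelySemisimple_of_isNil hx hcfs
      hss.isFinitelySemisimple ?_
    have : f - s = n := by rw [hsum]; abel
    rw [this]; exact hnil
  refine ⟨s', ?_, ?_, ?_, ?_⟩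
  · intro x y
    change s ⁅x, y⁆ = ⁅s x, s y⁆
    have htop := Module.End.iSup_maxGenEigenspace_eq_top f
    have hx : x ∈ ⨆ μ : k, f.maxGenEigenspace μ := by rw [htop]; trivial
    have hy : y ∈ ⨆ μ : k, f.maxGenEigenspace μ := by rw [htop]; trivial
    induction hx using Submodule.iSup_induction' with
    | zero => simp
    | add x1 x2 _ _ h1 h2 => rw [add_lie, map_add, h1, h2, map_add, add_lie]
    | mem a x hx =>
      induction hy using Submodule.iSup_induction' with
      | zero => simp
      | add x1 x2 _ _ h1 h2 => rw [lie_add, map_add, h1, h2, map_add, lie_add]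
      | mem b y hy =>
        rw [heig a x hx, heig b y hy, heig (a * b) ⁅x, y⁆]
        · rw [smul_lie, lie_smul, smul_smul]
        · rw [Module.End.mem_maxGenEigenspace] at hx hy ⊢
          obtain ⟨N, hN⟩ := hx
          obtain ⟨M, hM⟩ := hy
          exact ⟨N + M, lie_mem_genEig k g σ hσ a b _ N M x y rfl hN hM⟩
  · rw [hs']; exact hss
  · have e1 : autHom k g (s'⁻¹ * σ) - 1 = autHom k g s'⁻¹ * n := by
      have h1 : autHom k g s'⁻¹ * s = 1 := by
        rw [← hs']; change autHom k g s'⁻¹ * autHom k g s' = 1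
        rw [← map_mul]; simp
      rw [map_mul, ← h1]
      change _ * f - _ = _
      rw [hsum]; noncomm_ring
    rw [e1]
    refine Commute.isNilpotent_mul_left ?_ hnil
    have h1 : autHom k g s'⁻¹ * s = 1 := by
      rw [← hs']; change autHom k g s'⁻¹ * autHom k g s' = 1
      rw [← map_mul]; simp
    have h2 : s * autHom k g s'⁻¹ = 1 := by
      rw [← hs']; change autHom k g s' * autHom k g s'⁻¹ = 1
      rw [← map_mul]; simp
    rw [commute_iff_eq]
    calc autHom k g s'⁻¹ * n = autHom k g s'⁻¹ * n * (s * autHom k g s'⁻¹) := by rw [h2, mul_one]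
      _ = autHom k g s'⁻¹ * (n * s) * autHom k g s'⁻¹ := by noncomm_ring
      _ = autHom k g s'⁻¹ * s * n * autHom k g s'⁻¹ := by rw [hcns.eq]; noncomm_ring
      _ = n * autHom k g s'⁻¹ := by rw [h1, one_mul]
  · intro e he
    change s e = e
    rw [heig 1 e, one_smul]
    rw [Module.End.mem_maxGenEigenspace]
    exact ⟨1, by simp [hf, he]⟩

end Concrete
theorem conj_of_semiregular
    (m : ℕ) (hm : 1 ≤ m) (ζ : k) (hζ : IsPrimitiveRoot ζ m)
    (θ' θ'' : g ≃ₗ[k] g)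
    (hb' : ∀ x y : g, θ' ⁅x, y⁆ = ⁅θ' x, θ' y⁆)
    (hb'' : ∀ x y : g, θ'' ⁅x, y⁆ = ⁅θ'' x, θ'' y⁆)
    (ho' : orderOf θ' = m) (ho'' : orderOf θ'' = m)
    (hinner : θ' * θ''⁻¹ ∈ IntG k g)
    (e' e'' : g)
    (hn' : IsNilpotent (LieAlgebra.ad k g e')) (hn'' : IsNilpotent (LieAlgebra.ad k g e''))
    (he' : e' ∈ gradePiece k g ζ θ' (1 : ZMod m))
    (he'' : e'' ∈ gradePiece k g ζ θ'' (1 : ZMod m))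
    (τ₀ : g ≃ₗ[k] g) (hτ₀ : τ₀ ∈ IntG k g) (hτ₀e : τ₀ e' = e'')
    (hsemireg : ∀ τ : g ≃ₗ[k] g, τ ∈ IntG k g → τ e' = e' →
      Module.End.IsSemisimple (τ : g →ₗ[k] g) → τ = 1) :
    ∃ τ ∈ IntG k g, θ' = τ * θ'' * τ⁻¹ := by
  letI : Module ℚ g := Module.compHom g (algebraMap ℚ k)
  letI : LieAlgebra ℚ g :=
    { lie_smul := fun q x y => by
        change ⁅x, (algebraMap ℚ k q) • y⁆ = (algebraMap ℚ k q) • ⁅x, y⁆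
        rw [lie_smul] }
  set c : k := ζ ^ (1 : ZMod m).val with hc
  have hc0 : c ≠ 0 := pow_ne_zero _ (hζ.ne_zero (by omega))
  have he1 : θ' e' = c • e' := Module.End.mem_eigenspace_iff.1 he'
  have he2 : θ'' e'' = c • e'' := Module.End.mem_eigenspace_iff.1 he''
  have inv_e : ∀ θ : g ≃ₗ[k] g, θ e' = c • e' → θ⁻¹ e' = c⁻¹ • e' := by
    intro θ h
    apply θ.injective
    rw [map_smul, h, smul_smul, inv_mul_cancel₀ hc0, one_smul]
    exact θ.apply_symm_apply e'
  let θ₁ : g ≃ₗ[k] g := τ₀⁻¹ * θ'' * τ₀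
  have hθ₁e : θ₁ e' = c • e' := by
    change τ₀.symm (θ'' (τ₀ e')) = _
    rw [hτ₀e, he2, map_smul, ← hτ₀e, τ₀.symm_apply_apply]
  have hθm : θ' ^ m = 1 := by rw [← ho']; exact pow_orderOf_eq_one _
  have hθ''m : θ'' ^ m = 1 := by rw [← ho'']; exact pow_orderOf_eq_one _
  have hθ₁m : θ₁ ^ m = 1 := by
    have := conj_pow (i := m) (a := τ₀⁻¹) (b := θ'')
    rw [inv_inv, hθ''m] at this
    rw [this]; group
  let Z : Subgroup (g ≃ₗ[k] g) :=
    { carrier := {τ | τ ∈ IntG k g ∧ τ e' = e'}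
      mul_mem' := by
        rintro a b ⟨ha, ha'⟩ ⟨hb, hb'⟩
        refine ⟨mul_mem ha hb, ?_⟩
        change a (b e') = e'
        rw [hb', ha']
      one_mem' := ⟨one_mem _, rfl⟩
      inv_mem' := by
        rintro a ⟨ha, ha'⟩
        refine ⟨inv_mem ha, ?_⟩
        change a.symm e' = e'
        rw [LinearEquiv.symm_apply_eq, ha'] }
  have hunip : ∀ z ∈ Z, IsNilpotent (autHom k g z - 1) := by
    rintro z ⟨hz, hze⟩
    have hzl := intG_lie k g z hz
    obtain ⟨s, hsl, hss, hsn, hse⟩ := jordan k g z hzl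
    have hu : s⁻¹ * z ∈ IntG k g := by
      refine unip_mem_intG k g _ ?_ hsn
      intro x y
      change s.symm (z ⁅x, y⁆) = ⁅s.symm (z x), s.symm (z y)⁆
      rw [LinearEquiv.symm_apply_eq, hsl, hzl]
      simp
    have hs : s ∈ IntG k g := by
      have : s = z * (s⁻¹ * z)⁻¹ := by group
      rw [this]; exact mul_mem hz (inv_mem hu)
    have hs1 := hsemireg s hs (hse _ hze) hss
    rw [hs1] at hsn
    simpa using hsn
  let I : Submodule k (Module.End k g) :=
    Submodule.span k {a | ∃ z ∈ Z, a = autHom k g z - 1}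
  have hI : ∀ z ∈ Z, autHom k g z - 1 ∈ I := fun z hz => Submodule.subset_span ⟨z, hz, rfl⟩
  have hmul : ∀ a ∈ I, ∀ b ∈ I, a * b ∈ I := by
    intro a ha b hb
    induction ha using Submodule.span_induction with
    | zero => rw [zero_mul]; exact zero_mem _
    | add x y _ _ hx hy => rw [add_mul]; exact add_mem hx hy
    | smul r x _ hx => rw [smul_mul_assoc]; exact I.smul_mem r hx
    | mem x hx =>
      induction hb using Submodule.span_induction with
      | zero => rw [mul_zero]; exact zero_mem _
      | add x y _ _ hx hy => rw [mul_add]; exact add_mem hx hy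
      | smul r x _ hx => rw [mul_smul_comm]; exact I.smul_mem r hx
      | mem y hy =>
        obtain ⟨u, hu, rfl⟩ := hx
        obtain ⟨w, hw, rfl⟩ := hy
        have : (autHom k g u - 1) * (autHom k g w - 1) =
            (autHom k g (u * w) - 1) - (autHom k g u - 1) - (autHom k g w - 1) := by
          rw [map_mul]; noncomm_ring
        rw [this]
        exact sub_mem (sub_mem (hI _ (mul_mem hu hw)) (hI _ hu)) (hI _ hw)
  have htr : ∀ a ∈ I, LinearMap.trace k g a = 0 := by
    intro a ha
    induction ha using Submodule.span_induction with
    | zero => simp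
    | add x y _ _ hx hy => rw [map_add, hx, hy, add_zero]
    | smul r x _ hx => rw [map_smul, hx, smul_zero]
    | mem x hx =>
      obtain ⟨u, hu, rfl⟩ := hx
      exact (LinearMap.isNilpotent_trace_of_isNilpotent (hunip u hu)).eq_zero
  have hnil : ∀ a ∈ I, IsNilpotent a := fun a ha => isNilpotent_of_trace_zero I hmul htr a ha
  obtain ⟨M, hM⟩ := exists_pow_eq_bot I hmul hnil
  have hM' : I ^ (M + 1) = ⊥ := by rw [pow_succ, hM, Submodule.bot_mul]
  let L : Submodule k (Module.End k g) :=
    (LinearMap.ker (LieAlgebra.ad k g e')).map (LieAlgebra.ad k g : g →ₗ[k] Module.End k g)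
  have hlog : ∀ z ∈ Z, ∃ P : Polynomial k, (autHom k g z - 1) +
      (autHom k g z - 1) ^ 2 * Polynomial.aeval (autHom k g z - 1) P ∈ L := by
    intro z hz
    obtain ⟨P, x, hx, -, -⟩ := unip_log k g z (intG_lie k g z hz.1) (hunip z hz)
    refine ⟨P, x, ?_, hx⟩
    have h0 : (autHom k g z - 1) e' = 0 := by
      have : autHom k g z e' = e' := hz.2
      simp [this]
    have hcomm : Commute (autHom k g z - 1) (Polynomial.aeval (autHom k g z - 1) P) :=
      (Algebra.commute_of_mem_adjoin_self (Polynomial.aeval_mem_adjoin_singleton k _))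
    have hxe : LieAlgebra.ad k g x e' = 0 := by
      rw [hx, (hcomm.pow_left 2).eq, pow_two]
      simp only [LinearMap.add_apply, Module.End.mul_apply, h0, map_zero, add_zero]
    rw [SetLike.mem_coe, LinearMap.mem_ker]
    rw [LieAlgebra.ad_apply] at hxe ⊢
    rw [← lie_skew, hxe, neg_zero]
  have hexp : ∀ D ∈ L, IsNilpotent D → ∃ z ∈ Z, autHom k g z = IsNilpotent.exp D := by
    rintro D ⟨x, hx, rfl⟩ hD
    have hD : IsNilpotent (LieAlgebra.ad k g x) := hD
    obtain ⟨τ, hτ, h⟩ := exp_mem_intG k g x hD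
    refine ⟨τ, ⟨hτ, ?_⟩, h⟩
    have hxe : LieAlgebra.ad k g x e' = 0 := by
      rw [SetLike.mem_coe, LinearMap.mem_ker] at hx
      rw [LieAlgebra.ad_apply] at hx ⊢
      rw [← lie_skew, hx, neg_zero]
    change autHom k g τ e' = e'
    rw [h, ← expEnd_eq k g _ hD, expEnd, Finset.sum_range_succ']
    simp only [LinearMap.add_apply, LinearMap.sum_apply, LinearMap.smul_apply, pow_succ,
      Module.End.mul_apply, hxe, map_zero, smul_zero, Finset.sum_const_zero, zero_add]
    simp
  have hθZ : ∀ z ∈ Z, θ' * z * θ'⁻¹ ∈ Z := by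
    rintro z ⟨hz, hze⟩
    refine ⟨intG_normal k g θ' hb' z hz, ?_⟩
    change θ' (z (θ'⁻¹ e')) = e'
    rw [inv_e θ' he1, map_smul, hze, map_smul, he1, smul_smul, inv_mul_cancel₀ hc0, one_smul]
  have hθI : ∀ a ∈ I, autHom k g θ' * a * autHom k g θ'⁻¹ ∈ I := by
    intro a ha
    induction ha using Submodule.span_induction with
    | zero => rw [mul_zero, zero_mul]; exact zero_mem _
    | add x y _ _ hx hy => rw [mul_add, add_mul]; exact add_mem hx hy
    | smul r x _ hx => rw [mul_smul_comm, smul_mul_assoc]; exact I.smul_mem r hx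
    | mem x hx =>
      obtain ⟨z, hz, rfl⟩ := hx
      have : autHom k g θ' * (autHom k g z - 1) * autHom k g θ'⁻¹ =
          autHom k g (θ' * z * θ'⁻¹) - 1 := by
        rw [mul_sub, sub_mul, mul_one, ← map_mul, ← map_mul, ← map_mul, mul_inv_cancel, map_one]
      rw [this]
      exact hI _ (hθZ z hz)
  have hσ : θ' * θ₁⁻¹ ∈ Z := by
    constructor
    · have : θ' * θ₁⁻¹ = (θ' * τ₀⁻¹ * θ'⁻¹) * (θ' * θ''⁻¹) * τ₀ := by
        simp only [θ₁]; group
      rw [this]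
      exact mul_mem (mul_mem (intG_normal k g θ' hb' _ (inv_mem hτ₀)) hinner) hτ₀
    · change θ' (θ₁⁻¹ e') = e'
      rw [inv_e θ₁ hθ₁e, map_smul, he1, smul_smul, inv_mul_cancel₀ hc0, one_smul]
  have hinj : Function.Injective (autHom k g) := fun a b h => by
    ext x
    exact LinearMap.congr_fun h x
  obtain ⟨z, hz, h⟩ := descent (autHom k g) hinj Z L I hI hmul M hM' hnil hlog hexp m hm θ' hθm
    hθZ hθI M 0 (by omega) θ₁ hθ₁m hσ (by rw [zero_add, pow_one]; exact hI _ hσ)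
  refine ⟨z * τ₀⁻¹, mul_mem hz.1 (inv_mem hτ₀), ?_⟩
  rw [h]
  simp only [θ₁]
  group
end

section
/- Let μ be a finite-order Lie algebra automorphism of g such that F ∘ μ = F for every Int g-invariant polynomial function F on g. Then μ is inner, i.e., μ ∈ Int g. -/
open LieAlgebra Module

variable (k : Type*) [Field k] [IsAlgClosed k] [CharZero k]
variable (g : Type*) [LieRing g] [LieAlgebra k g] [FiniteDimensional k g]
  [LieAlgebra.IsSemisimple k g]

section CommAlg

/-- Homomorphisms to an algebraically closed field extend along integral extensions. -/
theorem hom_ext_integral {A C K : Type*} [CommRing A] [CommRing C] [Algebra A C]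
    [Algebra.IsIntegral A C] [Field K] [IsAlgClosed K]
    (inj : Function.Injective (algebraMap A C)) (ψ : A →+* K) :
    ∃ Ψ : C →+* K, Ψ.comp (algebraMap A C) = ψ := by
  have hP : (RingHom.ker ψ).IsPrime := RingHom.ker_isPrime ψ
  obtain ⟨Q, -, hQ, hQP⟩ := Ideal.exists_ideal_over_prime_of_isIntegral (S := C) (RingHom.ker ψ) ⊥
    (by
      intro x hx
      have h0 : algebraMap A C x = 0 := by simpa using hx
      have : x = 0 := inj (by simpa using h0)
      simp [this])
  have : Q.LiesOver (RingHom.ker ψ) := ⟨hQP.symm⟩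
  let _ : Algebra (A ⧸ RingHom.ker ψ) K := (RingHom.kerLift ψ).toAlgebra
  have : FaithfulSMul (A ⧸ RingHom.ker ψ) K :=
    (faithfulSMul_iff_algebraMap_injective _ _).2 (RingHom.kerLift_injective ψ)
  have : Algebra.IsIntegral (A ⧸ RingHom.ker ψ) (C ⧸ Q) := inferInstance
  have : Algebra.IsAlgebraic (A ⧸ RingHom.ker ψ) (C ⧸ Q) := inferInstance
  have : FaithfulSMul (A ⧸ RingHom.ker ψ) (C ⧸ Q) := inferInstance
  have hdom : IsDomain (C ⧸ Q) := Ideal.Quotient.isDomain Q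
  have hdomA : IsDomain (A ⧸ RingHom.ker ψ) := Ideal.Quotient.isDomain _
  have t1 : Module.IsTorsionFree (A ⧸ RingHom.ker ψ) (C ⧸ Q) :=
    Module.isTorsionFree_iff_faithfulSMul.2 inferInstance
  have t2 : Module.IsTorsionFree (A ⧸ RingHom.ker ψ) K :=
    Module.isTorsionFree_iff_faithfulSMul.2 inferInstance
  let l : (C ⧸ Q) →ₐ[A ⧸ RingHom.ker ψ] K := IsAlgClosed.lift
  refine ⟨l.toRingHom.comp (Ideal.Quotient.mk Q), ?_⟩
  ext a
  have := l.commutes (Ideal.Quotient.mk _ a)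
  have h2 : algebraMap (A ⧸ RingHom.ker ψ) K (Ideal.Quotient.mk _ a) = ψ a := RingHom.kerLift_mk ψ a
  rw [h2] at this
  exact this

/-- Generic extension lemma. -/
theorem ext_lemma (R B K : Type*) [CommRing R] [IsDomain R] [IsIntegrallyClosed R] [CommRing B]
    [IsDomain B] [Algebra R B] [FaithfulSMul R B] [Algebra.IsAlgebraic R B]
    [Algebra.FiniteType R B] [Field K] [IsAlgClosed K] :
    ∃ b : R, b ≠ 0 ∧ ∀ z : B, IsIntegral R z → ∀ ψ : R →+* K, ψ b ≠ 0 →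
      ∀ r, ((minpoly R z).map ψ).IsRoot r →
        ∃ Ψ : B →+* K, Ψ.comp (algebraMap R B) = ψ ∧ Ψ z = r := by
  obtain ⟨S, hS⟩ := (inferInstance : Algebra.FiniteType R B).out
  obtain ⟨b, hb0, hb⟩ := Algebra.IsAlgebraic.exists_integral_multiples (R := R) (A := B) S
  have hmul : ∀ x : B, ∃ N : ℕ, IsIntegral R (b ^ N • x) := by
    intro x
    have hx : x ∈ Algebra.adjoin R (S : Set B) := by rw [hS]; trivial
    induction hx using Algebra.adjoin_induction with
    | mem x hx => exact ⟨1, by simpa using hb x hx⟩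
    | algebraMap r => exact ⟨0, by simpa using isIntegral_algebraMap⟩
    | add x y _ _ hx hy =>
      obtain ⟨N, hN⟩ := hx
      obtain ⟨M, hM⟩ := hy
      refine ⟨N + M, ?_⟩
      have : b ^ (N + M) • (x + y) = b ^ M • (b ^ N • x) + b ^ N • (b ^ M • y) := by
        simp only [Algebra.smul_def, map_pow]; ring
      rw [this]
      exact (hN.smul _).add (hM.smul _)
    | mul x y _ _ hx hy =>
      obtain ⟨N, hN⟩ := hx
      obtain ⟨M, hM⟩ := hy
      refine ⟨N + M, ?_⟩
      have : b ^ (N + M) • (x * y) = (b ^ N • x) * (b ^ M • y) := by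
        simp only [Algebra.smul_def, map_pow]; ring
      rw [this]
      exact hN.mul hM
  refine ⟨b, hb0, fun z hz ψ hψ r hr => ?_⟩
  -- extend to the integral closure
  let A := AdjoinRoot (minpoly R z)
  let C := integralClosure R B
  obtain ⟨ΨC, hC1, hC2⟩ : ∃ ΨC : C →+* K, (∀ a : R, ΨC (algebraMap R C a) = ψ a) ∧
      ΨC ⟨z, hz⟩ = r := by
    let zC : C := ⟨z, hz⟩
    have hzC : Polynomial.aeval zC (minpoly R z) = 0 := by
      apply Subtype.ext
      have := Polynomial.aeval_algebraMap_apply B zC (minpoly R z)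
      have h3 : algebraMap C B zC = z := rfl
      rw [h3, minpoly.aeval] at this
      exact this.symm
    let f : A →ₐ[R] C := AdjoinRoot.liftAlgHom (minpoly R z) (Algebra.ofId R C) zC hzC
    let _ : Algebra A C := f.toRingHom.toAlgebra
    have : IsScalarTower R A C := IsScalarTower.of_algebraMap_eq fun x => (f.commutes x).symm
    have : Algebra.IsIntegral R C := inferInstance
    have : Algebra.IsIntegral A C := Algebra.IsIntegral.tower_top R
    have finj : Function.Injective (algebraMap A C) := by
      change Function.Injective f
      rw [injective_iff_map_eq_zero]
      intro a ha
      obtain ⟨p, rfl⟩ := AdjoinRoot.mk_surjective a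
      have h1 : Polynomial.aeval zC p = 0 := by
        have : f (AdjoinRoot.mk _ p) = Polynomial.aeval zC p := by
          simp [f, Polynomial.aeval_def]; rfl
        rw [← this, ha]
      have h2 : Polynomial.aeval z p = 0 := by
        have := Polynomial.aeval_algebraMap_apply B zC p
        have h3 : algebraMap C B zC = z := rfl
        rw [h3, h1, map_zero] at this
        exact this
      rw [AdjoinRoot.mk_eq_zero]
      exact minpoly.isIntegrallyClosed_dvd hz h2
    let ψA : A →+* K := AdjoinRoot.lift ψ r (by
      rw [← Polynomial.eval_map]; exact hr)
    obtain ⟨Ψ, hΨ⟩ := hom_ext_integral finj ψA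
    refine ⟨Ψ, fun a => ?_, ?_⟩
    · have := congrArg (fun g : A →+* K => g (algebraMap R A a)) hΨ
      simp only [RingHom.comp_apply] at this
      rw [← IsScalarTower.algebraMap_apply] at this
      rw [this]
      exact AdjoinRoot.lift_of _
    · have := congrArg (fun g : A →+* K => g (AdjoinRoot.root _)) hΨ
      simp only [RingHom.comp_apply] at this
      have h4 : algebraMap A C (AdjoinRoot.root _) = zC := by
        change f (AdjoinRoot.root _) = zC
        exact AdjoinRoot.liftAlgHom_root _ _ _ _
      rw [h4] at this
      rw [this]
      exact AdjoinRoot.lift_root _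
  -- extend to `B`
  let P : B → K → Prop := fun x v => ∃ (N : ℕ) (c : C), (c : B) = b ^ N • x ∧ ΨC c = ψ b ^ N * v
  have hex : ∀ x, ∃ v, P x v := by
    intro x
    obtain ⟨N, hN⟩ := hmul x
    refine ⟨ΨC ⟨_, hN⟩ / ψ b ^ N, N, ⟨_, hN⟩, rfl, ?_⟩
    field_simp
  have huniq : ∀ x v w, P x v → P x w → v = w := by
    rintro x v w ⟨N, c, hc, hv⟩ ⟨M, d, hd, hw⟩
    have : algebraMap R C (b ^ M) * c = algebraMap R C (b ^ N) * d := by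
      apply Subtype.ext
      change algebraMap R B (b ^ M) * (c : B) = algebraMap R B (b ^ N) * (d : B)
      rw [hc, hd]
      simp only [Algebra.smul_def, map_pow]; ring
    have h5 := congrArg ΨC this
    rw [map_mul, map_mul, hC1, hC1, hv, hw, map_pow, map_pow] at h5
    have h6 : ψ b ^ M * ψ b ^ N ≠ 0 := by positivity
    apply mul_left_cancel₀ h6
    linear_combination h5
  choose Φ hΦ using hex
  have hPC : ∀ c : C, Φ c = ΨC c := fun c => huniq c _ _ (hΦ _) ⟨0, c, by simp, by simp⟩
  have hone : Φ 1 = 1 := by simpa using hPC 1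
  have hzero : Φ 0 = 0 := by simpa using hPC 0
  refine ⟨{ toFun := Φ, map_one' := hone, map_zero' := hzero, map_mul' := ?_, map_add' := ?_ },
    ?_, ?_⟩
  · intro x y
    obtain ⟨N, c, hc, hv⟩ := hΦ x
    obtain ⟨M, d, hd, hw⟩ := hΦ y
    refine huniq _ _ _ (hΦ _) ⟨N + M, c * d, ?_, ?_⟩
    · rw [MulMemClass.coe_mul, hc, hd]; simp only [Algebra.smul_def, map_pow]; ring
    · rw [map_mul, hv, hw]; ring
  · intro x y
    obtain ⟨N, c, hc, hv⟩ := hΦ x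
    obtain ⟨M, d, hd, hw⟩ := hΦ y
    refine huniq _ _ _ (hΦ _) ⟨N + M, algebraMap R C (b ^ M) * c + algebraMap R C (b ^ N) * d, ?_, ?_⟩
    · change algebraMap R B (b ^ M) * (c : B) + algebraMap R B (b ^ N) * (d : B) = _
      rw [hc, hd]; simp only [Algebra.smul_def, map_pow]; ring
    · rw [map_add, map_mul, map_mul, hC1, hC1, hv, hw, map_pow, map_pow]; ring
  · ext a
    change Φ (algebraMap R B a) = ψ a
    rw [← hC1 a]
    exact hPC (algebraMap R C a)
  · exact (hPC ⟨z, hz⟩).trans hC2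

end CommAlg

section Dominance
open MvPolynomial

theorem chain_rule {k A ι : Type*} [Field k] [CommRing A] [Algebra k A] [Fintype ι]
    (D : Derivation k A A) (y : ι → A) (p : MvPolynomial ι k) :
    D (aeval y p) = ∑ i, aeval y (pderiv i p) * D (y i) := by
  classical
  induction p using MvPolynomial.induction_on with
  | C a => simp [MvPolynomial.algebraMap_eq]
  | add p q hp hq => simp [hp, hq, add_mul, Finset.sum_add_distrib]
  | mul_X p j hp =>
    simp only [map_mul, aeval_X, Derivation.leibniz, hp, smul_eq_mul, pderiv_X, map_add, add_mul,
      Finset.sum_add_distrib, Finset.mul_sum]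
    congr 1
    · rw [Finset.sum_eq_single j]
      · simp
      · intro i _ hij; simp [Pi.single_apply, hij.symm]
      · simp
    · exact Finset.sum_congr rfl fun i _ => by ring

theorem jac_algInd {k ι : Type*} [Field k] [CharZero k] [Fintype ι] [DecidableEq ι]
    (P : ι → MvPolynomial ι k) (h : (Matrix.of fun i j => pderiv j (P i)).det ≠ 0) :
    AlgebraicIndependent k P := by
  rw [algebraicIndependent_iff]
  have key : ∀ N : ℕ, ∀ F : MvPolynomial ι k, F.totalDegree < N → aeval P F = 0 → F = 0 := by
    intro N
    induction N with
    | zero => intro F hF; omega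
    | succ N ih =>
      intro F hF h0
      have h1 : (fun i => aeval P (pderiv i F)) = 0 := by
        apply Matrix.eq_zero_of_vecMul_eq_zero h
        ext1 j
        have := chain_rule (pderiv (R := k) j) P F
        rw [h0, map_zero] at this
        simp only [Matrix.vecMul, dotProduct, Matrix.of_apply, Pi.zero_apply]
        exact this.symm
      have h2 : ∀ m : ι →₀ ℕ, m ≠ 0 → coeff m F = 0 := by
        intro m hm
        obtain ⟨i, hi⟩ : ∃ i, m i ≠ 0 := by
          by_contra! hc; exact hm (Finsupp.ext hc)
        have hmi : m - Finsupp.single i 1 + Finsupp.single i 1 = m := by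
          apply tsub_add_cancel_of_le
          rw [Finsupp.single_le_iff]; omega
        have hc := coeff_pderiv (i := i) F (m - Finsupp.single i 1)
        rw [hmi] at hc
        have hne : ((m i - 1 : ℕ) : k) + 1 ≠ 0 := Nat.cast_add_one_ne_zero _
        by_cases hz : pderiv i F = 0
        · rw [hz, coeff_zero] at hc
          have := hc.symm
          simpa [hne] using this
        · exfalso
          apply hz
          apply ih _ _ (congrFun h1 i)
          rcases Nat.eq_zero_or_pos (totalDegree (pderiv i F)) with h3 | h3
          · have : 0 < F.totalDegree := by
              by_contra h4
              have h5 : F.totalDegree = 0 := by omega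
              rw [totalDegree_eq_zero_iff_eq_C] at h5
              apply hz; rw [h5]; simp
            omega
          · have : totalDegree (pderiv i F) + 1 ≤ totalDegree F := by
              have h4 : totalDegree (pderiv i F) ≤ totalDegree F - 1 := by
                refine Finset.sup_le fun s hs => ?_
                have h5 := coeff_pderiv (i := i) F s
                have h6 : coeff (s + Finsupp.single i 1) F ≠ 0 := by
                  intro h7
                  rw [h7, zero_mul] at h5
                  exact (mem_support_iff.1 hs) h5
                have h7 := le_totalDegree (mem_support_iff.2 h6)
                have h8 : (s + Finsupp.single i 1).sum (fun _ e => e) = s.sum (fun _ e => e) + 1 := by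
                  rw [Finsupp.sum_add_index' (by simp) (by simp)]; simp
                simp only [Finsupp.sum] at *
                omega
              omega
            omega
      have h3 : F = C (coeff 0 F) := by
        ext m
        by_cases hm : m = 0
        · simp [hm]
        · rw [h2 m hm, coeff_C, if_neg (Ne.symm hm)]
      rw [h3] at h0 ⊢
      simpa using h0
  exact fun F => key _ F (Nat.lt_succ_self _)

theorem ext_lemma_hom {R B : Type*} (K : Type*) [CommRing R] [IsDomain R] [IsIntegrallyClosed R]
    [CommRing B] [IsDomain B] [Field K] [IsAlgClosed K]
    (f : R →+* B) (hf : Function.Injective f) (ft : f.FiniteType)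
    (alg : ∀ z, ∃ p : Polynomial R, p ≠ 0 ∧ p.eval₂ f z = 0) :
    ∃ b : R, b ≠ 0 ∧ ∀ z : B, f.IsIntegralElem z → ∃ m : Polynomial R, m.Monic ∧
      m.eval₂ f z = 0 ∧ ∀ ψ : R →+* K, ψ b ≠ 0 → ∀ r, (m.map ψ).IsRoot r →
        ∃ Ψ : B →+* K, Ψ.comp f = ψ ∧ Ψ z = r := by
  let _ : Algebra R B := f.toAlgebra
  have : FaithfulSMul R B := (faithfulSMul_iff_algebraMap_injective _ _).2 hf
  have : Algebra.FiniteType R B := ft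
  have : Algebra.IsAlgebraic R B := ⟨alg⟩
  obtain ⟨b, hb, h⟩ := ext_lemma R B K
  exact ⟨b, hb, fun z hz => ⟨minpoly R z, minpoly.monic hz, minpoly.aeval R z, h z hz⟩⟩

theorem dom_ext {k ι : Type*} [Field k] [IsAlgClosed k] [Fintype ι]
    (P : ι → MvPolynomial ι k) (hP : AlgebraicIndependent k P) :
    ∃ b : MvPolynomial ι k, b ≠ 0 ∧ ∀ z : MvPolynomial ι k,
      (aeval P : _ →ₐ[k] MvPolynomial ι k).toRingHom.IsIntegralElem z →
      ∃ m : Polynomial (MvPolynomial ι k), m.Monic ∧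
        m.eval₂ (aeval P : _ →ₐ[k] MvPolynomial ι k).toRingHom z = 0 ∧
        ∀ x : ι → k, eval x b ≠ 0 → ∀ r, (m.map (eval x)).IsRoot r →
          ∃ v : ι → k, (∀ i, eval v (P i) = x i) ∧ eval v z = r := by
  have tb : IsTranscendenceBasis k P := by
    apply hP.isTranscendenceBasis_of_lift_trdeg_le_of_finite
    rw [MvPolynomial.trdeg_of_isDomain]
    simp
  have alg := tb.isAlgebraic
  obtain ⟨b, hb, h⟩ := ext_lemma_hom k (aeval P : _ →ₐ[k] MvPolynomial ι k).toRingHom hP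
    (by
      have h1 : (algebraMap k (MvPolynomial ι k)).FiniteType := by
        rw [RingHom.finiteType_algebraMap]; infer_instance
      apply RingHom.FiniteType.of_comp_finiteType (f := algebraMap k (MvPolynomial ι k))
      convert h1
      ext a
      simp)
    (by
      intro z
      obtain ⟨p, hp, hz⟩ := alg.isAlgebraic z
      refine ⟨p.map hP.aevalEquiv.symm.toRingHom, ?_, ?_⟩
      · rw [Ne, Polynomial.map_eq_zero_iff]
        · exact hp
        · exact hP.aevalEquiv.symm.injective
      · rw [Polynomial.eval₂_map]
        rw [← hz, Polynomial.aeval_def]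
        congr 1
        ext1 a
        have := hP.algebraMap_aevalEquiv (hP.aevalEquiv.symm a)
        rw [AlgEquiv.apply_symm_apply] at this
        exact this.symm)
  refine ⟨b, hb, fun z hz => ?_⟩
  obtain ⟨m, hm, hmz, H⟩ := h z hz
  refine ⟨m, hm, hmz, fun x hx r hr => ?_⟩
  obtain ⟨Ψ, h1, h2⟩ := H (eval x) hx r hr
  have h3 : ∀ p, Ψ (aeval P p) = eval x p := fun p => congrArg (fun f : _ →+* k => f p) h1
  have h4 : Ψ = eval (fun i => Ψ (X i)) := by
    apply MvPolynomial.ringHom_ext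
    · intro a
      have := h3 (C a)
      simpa [MvPolynomial.algebraMap_eq] using this
    · intro i; simp
  refine ⟨fun i => Ψ (X i), fun i => ?_, ?_⟩
  · rw [← h4]
    have := h3 (X i)
    simpa using this
  · rw [← h4, h2]

end Dominance

section PolyFun

/-- The algebra of polynomial functions on a vector space. -/
noncomputable def polyFun (k V : Type*) [Field k] [AddCommGroup V] [Module k V] :
    Subalgebra k (V → k) :=
  Algebra.adjoin k (Set.range fun ψ : Dual k V => (ψ : V → k))

/-- Polynomial maps between vector spaces. -/
def IsPolyMap (k : Type*) {W V : Type*} [Field k] [AddCommGroup V] [Module k V]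
    [AddCommGroup W] [Module k W] (f : W → V) : Prop :=
  ∀ ψ : Dual k V, (fun w => ψ (f w)) ∈ polyFun k W

variable {k U V W : Type*} [Field k] [AddCommGroup U] [Module k U] [AddCommGroup V] [Module k V]
    [AddCommGroup W] [Module k W]

theorem dual_mem_polyFun (ψ : Dual k V) : (fun v => ψ v) ∈ polyFun k V :=
  Algebra.subset_adjoin ⟨ψ, rfl⟩

theorem const_mem_polyFun (c : k) : (fun _ => c) ∈ polyFun k V :=
  (polyFun k V).algebraMap_mem c

theorem IsPolyMap.linear (L : W →ₗ[k] V) : IsPolyMap k (fun w => L w) :=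
  fun ψ => dual_mem_polyFun (ψ ∘ₗ L)

theorem IsPolyMap.const (v : V) : IsPolyMap k (fun _ : W => v) :=
  fun ψ => const_mem_polyFun (ψ v)

theorem IsPolyMap.add {f f' : W → V} (h : IsPolyMap k f) (h' : IsPolyMap k f') :
    IsPolyMap k (fun w => f w + f' w) := fun ψ => by
  have := (polyFun k W).add_mem (h ψ) (h' ψ)
  simp only [map_add]
  exact this

theorem IsPolyMap.smul {f : W → V} {c : W → k} (hc : c ∈ polyFun k W) (h : IsPolyMap k f) :
    IsPolyMap k (fun w => c w • f w) := fun ψ => by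
  have := (polyFun k W).mul_mem hc (h ψ)
  simp only [map_smul]
  exact this

theorem IsPolyMap.sum {ι : Type*} (s : Finset ι) {f : ι → W → V} (h : ∀ i ∈ s, IsPolyMap k (f i)) :
    IsPolyMap k (fun w => ∑ i ∈ s, f i w) := fun ψ => by
  have := (polyFun k W).sum_mem (fun i hi => h i hi ψ)
  simp only [map_sum]
  convert this using 1
  ext w; simp

theorem polyFun_comp {F : V → k} (hF : F ∈ polyFun k V) {f : W → V} (h : IsPolyMap k f) :
    (fun w => F (f w)) ∈ polyFun k W := by
  induction hF using Algebra.adjoin_induction with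
  | mem x hx => obtain ⟨ψ, rfl⟩ := hx; exact h ψ
  | algebraMap r => exact const_mem_polyFun r
  | add x y _ _ hx hy => exact (polyFun k W).add_mem hx hy
  | mul x y _ _ hx hy => exact (polyFun k W).mul_mem hx hy

theorem IsPolyMap.comp {f : V → U} {f' : W → V} (h : IsPolyMap k f) (h' : IsPolyMap k f') :
    IsPolyMap k (fun w => f (f' w)) := fun ψ => polyFun_comp (h ψ) h'

theorem IsPolyMap.linear_comp (L : V →ₗ[k] U) {f' : W → V} (h' : IsPolyMap k f') :
    IsPolyMap k (fun w => L (f' w)) := (IsPolyMap.linear L).comp h'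

theorem id_mem_polyFun : (fun t : k => t) ∈ polyFun k k := dual_mem_polyFun (LinearMap.id : k →ₗ[k] k)

theorem polyFun_curve {F : k → k} (hF : F ∈ polyFun k k) : ∃ p : Polynomial k, ∀ t, F t = p.eval t := by
  induction hF using Algebra.adjoin_induction with
  | mem x hx =>
    obtain ⟨ψ, rfl⟩ := hx
    refine ⟨Polynomial.C (ψ 1) * Polynomial.X, fun t => ?_⟩
    have : ψ t = t * ψ 1 := by rw [← smul_eq_mul, ← map_smul]; simp
    change ψ t = _
    rw [this, Polynomial.eval_mul, Polynomial.eval_C, Polynomial.eval_X, mul_comm]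
  | algebraMap r => exact ⟨Polynomial.C r, fun t => by simp⟩
  | add x y _ _ hx hy =>
    obtain ⟨p, hp⟩ := hx
    obtain ⟨q, hq⟩ := hy
    exact ⟨p + q, fun t => by simp [hp, hq]⟩
  | mul x y _ _ hx hy =>
    obtain ⟨p, hp⟩ := hx
    obtain ⟨q, hq⟩ := hy
    exact ⟨p * q, fun t => by simp [hp, hq]⟩

/-- Evaluation of a polynomial function. -/
noncomputable def evp (x : V) : polyFun k V →ₐ[k] k :=
  (Pi.evalAlgHom k (fun _ : V => k) x).comp (polyFun k V).val

@[simp] theorem evp_apply (x : V) (F : polyFun k V) : evp x F = F.1 x := rfl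

/-- Pullback of polynomial functions. -/
noncomputable def pbk (φ : W → V) (hφ : IsPolyMap k φ) : polyFun k V →ₐ[k] polyFun k W where
  toFun F := ⟨fun w => F.1 (φ w), polyFun_comp F.2 hφ⟩
  map_one' := rfl
  map_mul' _ _ := rfl
  map_zero' := rfl
  map_add' _ _ := rfl
  commutes' _ := rfl

@[simp] theorem pbk_apply (φ : W → V) (hφ : IsPolyMap k φ) (F : polyFun k V) (w : W) :
  (pbk φ hφ F).1 w = F.1 (φ w) := rfl

/-- Coordinates on the algebra of polynomial functions. -/
noncomputable def toPF {ι : Type*} (b : Basis ι k V) : MvPolynomial ι k →ₐ[k] polyFun k V :=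
  MvPolynomial.aeval (fun i => ⟨fun v => b.coord i v, dual_mem_polyFun (b.coord i)⟩)

theorem toPF_apply {ι : Type*} (b : Basis ι k V) (p : MvPolynomial ι k) (v : V) :
    (toPF b p).1 v = MvPolynomial.eval (fun i => b.repr v i) p := by
  change evp v (toPF b p) = _
  induction p using MvPolynomial.induction_on with
  | C a => simp [toPF]
  | add p q hp hq => rw [map_add, map_add, map_add, hp, hq]
  | mul_X p i hp =>
    rw [map_mul, map_mul, map_mul, hp]
    congr 1
    simp [toPF]

theorem toPF_bijective [Infinite k] {ι : Type*} [Finite ι] (b : Basis ι k V) :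
    Function.Bijective (toPF b) := by
  cases nonempty_fintype ι
  constructor
  · rw [injective_iff_map_eq_zero]
    intro p hp
    apply MvPolynomial.funext
    intro x
    have h1 := toPF_apply b p (b.equivFun.symm x)
    have h2 : (fun i => b.repr (b.equivFun.symm x) i) = x := by
      ext i
      exact congrFun (b.equivFun.apply_symm_apply x) i
    rw [h2] at h1
    rw [← h1, hp, map_zero]
    rfl
  · rintro ⟨F, hF⟩
    suffices h : polyFun k V ≤ (((polyFun k V).val.comp (toPF b)).range) by
      obtain ⟨p, hp⟩ := h hF
      exact ⟨p, Subtype.ext hp⟩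
    apply Algebra.adjoin_le
    rintro _ ⟨ψ, rfl⟩
    refine ⟨∑ i, MvPolynomial.C (ψ (b i)) * MvPolynomial.X i, ?_⟩
    ext v
    change (toPF b _).1 v = _
    rw [toPF_apply]
    simp only [map_sum, map_mul, MvPolynomial.eval_C, MvPolynomial.eval_X]
    conv_rhs => rw [← b.sum_repr v]
    rw [map_sum]
    refine Finset.sum_congr rfl fun i _ => ?_
    rw [map_smul, smul_eq_mul, mul_comm]

/-- Coordinates on the algebra of polynomial functions. -/
noncomputable def ePF [Infinite k] {ι : Type*} [Finite ι] (b : Basis ι k V) :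
    MvPolynomial ι k ≃ₐ[k] polyFun k V := AlgEquiv.ofBijective (toPF b) (toPF_bijective b)

theorem evp_ePF [Infinite k] {ι : Type*} [Finite ι] (b : Basis ι k V) (p : MvPolynomial ι k) (v : V) :
    (ePF b p).1 v = MvPolynomial.eval (fun i => b.repr v i) p := toPF_apply b p v

instance [Infinite k] [FiniteDimensional k V] : IsDomain (polyFun k V) :=
  (ePF (Module.finBasis k V)).symm.toMulEquiv.isDomain _

theorem polyFun_dom [Infinite k] [FiniteDimensional k V] {F G : V → k} (hF : F ∈ polyFun k V)
    (hG : G ∈ polyFun k V) (hF0 : F ≠ 0) (hG0 : G ≠ 0) : F * G ≠ 0 := by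
  have h1 : (⟨F, hF⟩ : polyFun k V) ≠ 0 := fun h => hF0 (congrArg Subtype.val h)
  have h2 : (⟨G, hG⟩ : polyFun k V) ≠ 0 := fun h => hG0 (congrArg Subtype.val h)
  exact fun h => mul_ne_zero h1 h2 (Subtype.ext h)

/-- Main consequence of dominance. -/
theorem dom_ext_V_aux {ι : Type*} [Fintype ι] (B : Basis ι k V) [IsAlgClosed k] [CharZero k] (φ : V → V)
    (hφ : IsPolyMap k φ) (a : V) (L : V →ₗ[k] V) (hLinj : Function.Injective L)
    (hL : ∀ v, ∃ r : k → V, IsPolyMap k r ∧ ∀ t : k, φ (a + t • v) = φ a + t • L v + t ^ 2 • r t) :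
    ∃ b : polyFun k V, b ≠ 0 ∧ ∀ z : polyFun k V, (pbk φ hφ).toRingHom.IsIntegralElem z →
      ∃ m : Polynomial (polyFun k V), m.Monic ∧
        (∀ v, (m.map (evp (φ v)).toRingHom).IsRoot (z.1 v)) ∧
        ∀ x, b.1 x ≠ 0 → ∀ r, (m.map (evp x).toRingHom).IsRoot r → ∃ v, φ v = x ∧ z.1 v = r := by
  classical
  have hR : ∀ x : ι → k, (fun i => B.repr (B.equivFun.symm x) i) = x := fun x => by
      ext i
      exact congrFun (B.equivFun.apply_symm_apply x) i
  let e := ePF B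
  let P : ι → MvPolynomial ι k := fun i =>
    e.symm ⟨fun v => B.coord i (φ v), hφ _⟩
  have hP : ∀ i v, MvPolynomial.eval (fun j => B.repr v j) (P i) = B.repr (φ v) i := by
    intro i v
    rw [← evp_ePF B]
    simp only [P, e, AlgEquiv.apply_symm_apply]
    rfl
  have hind : AlgebraicIndependent k P := by
    apply jac_algInd
    intro hdet
    have h1 : ((Matrix.of fun i j => MvPolynomial.pderiv j (P i)).map
      (MvPolynomial.eval (fun j => B.repr a j))).det = 0 := by
      have := RingHom.map_det (MvPolynomial.eval (fun j => B.repr a j))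
        (Matrix.of fun i j => MvPolynomial.pderiv j (P i))
      rw [hdet, map_zero] at this
      exact this.symm
    obtain ⟨w, hw0, hw⟩ := Matrix.exists_mulVec_eq_zero_iff.2 h1
    apply hw0
    let v := B.equivFun.symm w
    have hvw : ∀ i, B.repr v i = w i := fun i => congrFun (hR w) i
    obtain ⟨r, hr, hrt⟩ := hL v
    have hLv : L v = 0 := by
      apply B.repr.injective
      ext i
      rw [map_zero, Finsupp.zero_apply]
      let y : ι → Polynomial k := fun j =>
        Polynomial.C (B.repr a j) + Polynomial.X * Polynomial.C (w j)
      let Q : Polynomial k := MvPolynomial.aeval y (P i)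
      obtain ⟨rp, hrp⟩ := polyFun_curve (hr (B.coord i))
      have hev : ∀ (t : k) (p : MvPolynomial ι k),
          (MvPolynomial.aeval y p).eval t = MvPolynomial.eval (fun j => B.repr a j + t * w j) p := by
        intro t p
        induction p using MvPolynomial.induction_on with
        | C a => simp
        | add p q hp hq => rw [map_add, map_add, Polynomial.eval_add, hp, hq]
        | mul_X p i hp =>
          rw [map_mul, map_mul, Polynomial.eval_mul, hp]
          congr 1
          simp only [y, MvPolynomial.aeval_X, MvPolynomial.eval_X, Polynomial.eval_add,
            Polynomial.eval_mul, Polynomial.eval_C, Polynomial.eval_X]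
      have hQ : Q = Polynomial.C (B.repr (φ a) i) + Polynomial.X * Polynomial.C (B.repr (L v) i)
          + Polynomial.X ^ 2 * rp := by
        apply Polynomial.funext
        intro t
        have h2 : (fun j => B.repr a j + t * w j) = fun j => B.repr (a + t • v) j := by
          ext j; simp [hvw]
        change (MvPolynomial.aeval y (P i)).eval t = _
        rw [hev, h2, hP, hrt]
        have := hrp t
        simp only [Basis.coord_apply] at this
        simp only [map_add, map_smul, Finsupp.add_apply, Finsupp.smul_apply, smul_eq_mul, this,
          Polynomial.eval_add, Polynomial.eval_mul, Polynomial.eval_C, Polynomial.eval_X,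
          Polynomial.eval_pow]
      have hd1 : (Polynomial.derivative Q).eval 0 = B.repr (L v) i := by
        rw [hQ]; simp
      have hd2 : Polynomial.derivative Q = ∑ j, MvPolynomial.aeval y (MvPolynomial.pderiv j (P i)) *
          Polynomial.C (w j) := by
        have := chain_rule (Polynomial.derivative' (R := k)) y (P i)
        change Polynomial.derivative Q = _ at this
        rw [this]
        refine Finset.sum_congr rfl fun j _ => ?_
        congr 1
        change Polynomial.derivative (y j) = _
        simp [y]
      rw [← hd1, hd2, Polynomial.eval_finsetSum]
      have := congrFun hw i
      simp only [Matrix.mulVec, dotProduct, Matrix.map_apply, Matrix.of_apply, Pi.zero_apply] at this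
      refine Eq.trans ?_ this
      refine Finset.sum_congr rfl fun j _ => ?_
      rw [Polynomial.eval_mul, hev, Polynomial.eval_C]
      simp only [zero_mul, add_zero]
    have hv0 : v = 0 := hLinj (by rw [hLv, map_zero])
    ext i
    rw [← hvw i, hv0]; simp
  have hcomm : ∀ p, e (MvPolynomial.aeval P p) = pbk φ hφ (e p) := by
    intro p
    induction p using MvPolynomial.induction_on with
    | C a => 
      rw [MvPolynomial.aeval_C, AlgEquiv.commutes, ← MvPolynomial.algebraMap_eq, AlgEquiv.commutes,
        AlgHom.commutes]
    | add p q hp hq => rw [map_add, map_add, map_add, map_add, hp, hq]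
    | mul_X p i hp =>
      rw [map_mul, map_mul, map_mul, map_mul, hp]
      congr 1
      rw [MvPolynomial.aeval_X]
      apply Subtype.ext
      ext v
      rw [pbk_apply, evp_ePF, evp_ePF, hP]
      simp
  obtain ⟨b, hb, H⟩ := dom_ext P hind
  refine ⟨e b, by simpa using hb, fun z hz => ?_⟩
  have hz' : (MvPolynomial.aeval P : _ →ₐ[k] MvPolynomial ι k).toRingHom.IsIntegralElem
      (e.symm z) := by
    obtain ⟨q, hq, hq0⟩ := hz
    refine ⟨q.map e.symm.toRingEquiv.toRingHom, hq.map _, ?_⟩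
    rw [Polynomial.eval₂_map]
    have h5 := congrArg e.symm hq0
    rw [map_zero] at h5
    rw [← h5]
    have h6 := Polynomial.hom_eval₂ q (pbk φ hφ).toRingHom e.symm.toRingEquiv.toRingHom z
    refine Eq.trans ?_ h6.symm
    congr 1
    ext1 F
    change MvPolynomial.aeval P (e.symm F) = e.symm (pbk φ hφ F)
    apply e.injective
    rw [hcomm]; simp
  obtain ⟨m, hm, hm0, hx⟩ := H _ hz'
  have hevx : ∀ x : V, ((evp x).toRingHom.comp e.toRingEquiv.toRingHom) =
      MvPolynomial.eval (fun i => B.repr x i) := by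
    intro x
    refine RingHom.ext fun p => ?_
    exact evp_ePF B _ x
  refine ⟨m.map e.toRingEquiv.toRingHom, hm.map _, fun v => ?_, fun x hxb r hr => ?_⟩
  · rw [Polynomial.map_map, hevx, Polynomial.IsRoot, Polynomial.eval_map]
    have h6 := Polynomial.hom_eval₂ m
      (MvPolynomial.aeval P : _ →ₐ[k] MvPolynomial ι k).toRingHom
      (MvPolynomial.eval (fun i => B.repr v i)) (e.symm z)
    rw [hm0, map_zero] at h6
    rw [h6, ← evp_ePF B, show (ePF B) (e.symm z) = z from e.apply_symm_apply z]
    congr 1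
    apply MvPolynomial.ringHom_ext
    · intro c; simp
    · intro i
      simp [hP]
  · rw [Polynomial.map_map, hevx] at hr
    obtain ⟨v, hv1, hv2⟩ := hx (fun i => B.repr x i) (by rw [← evp_ePF B]; exact hxb) r hr
    refine ⟨B.equivFun.symm v, ?_, ?_⟩
    · apply B.repr.injective
      ext i
      rw [← hP, hR, hv1]
    · rw [← hv2]
      have := evp_ePF B (e.symm z) (B.equivFun.symm v)
      rw [hR] at this
      rw [← this, show (ePF B) (e.symm z) = z from e.apply_symm_apply z]

theorem dom_ext_V [IsAlgClosed k] [CharZero k] [FiniteDimensional k V] (φ : V → V)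
    (hφ : IsPolyMap k φ) (a : V) (L : V →ₗ[k] V) (hLinj : Function.Injective L)
    (hL : ∀ v, ∃ r : k → V, IsPolyMap k r ∧ ∀ t : k, φ (a + t • v) = φ a + t • L v + t ^ 2 • r t) :
    ∃ b : polyFun k V, b ≠ 0 ∧ ∀ z : polyFun k V, (pbk φ hφ).toRingHom.IsIntegralElem z →
      ∃ m : Polynomial (polyFun k V), m.Monic ∧
        (∀ v, (m.map (evp (φ v)).toRingHom).IsRoot (z.1 v)) ∧
        ∀ x, b.1 x ≠ 0 → ∀ r, (m.map (evp x).toRingHom).IsRoot r → ∃ v, φ v = x ∧ z.1 v = r :=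
  dom_ext_V_aux (Module.finBasis k V) φ hφ a L hLinj hL

end PolyFun

section LieBasics

variable {k : Type*} [Field k] [IsAlgClosed k] [CharZero k]
variable {g : Type*} [LieRing g] [LieAlgebra k g] [FiniteDimensional k g]
  [LieAlgebra.IsSemisimple k g]

theorem pow_finrank_of_nilp {N : Module.End k g} (hN : IsNilpotent N) :
    N ^ (finrank k g + 1) = 0 := by
  have h := LinearMap.aeval_self_charpoly N
  rw [hN.charpoly_eq_X_pow_finrank] at h
  rw [pow_succ]
  simp only [map_pow, Polynomial.aeval_X] at h
  rw [h, zero_mul]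

theorem expEnd_spec (n : g) (hn : IsNilpotent (ad k g n)) :
    ∃ e : g ≃ₗ⁅k⁆ g, (e.toLinearEquiv : g →ₗ[k] g) = expEnd k g (ad k g n) := by
  let _ : Module ℚ g := Module.compHom g (algebraMap ℚ k)
  have hq : ∀ (q : ℚ) (x : g), q • x = (q : k) • x := fun _ _ => rfl
  let _ : LieAlgebra ℚ g := { lie_smul := fun t x m => by rw [hq, hq, lie_smul] }
  let D : LieDerivation k g g := LieDerivation.ad k g n
  have hD : D.toLinearMap = ad k g n := by
    ext x; simp [D]
  refine ⟨D.exp (by rw [hD]; exact hn), ?_⟩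
  ext x
  change IsNilpotent.exp D.toLinearMap x = _
  rw [hD, IsNilpotent.exp_eq_sum (pow_finrank_of_nilp hn), expEnd]
  simp only [LinearMap.sum_apply, LinearMap.smul_apply]
  refine Finset.sum_congr rfl fun i _ => ?_
  rw [hq]; simp

/-- The exponential of an ad-nilpotent element (identity for other elements). -/
noncomputable def expG (k : Type*) [Field k] [IsAlgClosed k] [CharZero k]
    {g : Type*} [LieRing g] [LieAlgebra k g] [FiniteDimensional k g]
    [LieAlgebra.IsSemisimple k g] (n : g) : g ≃ₗ[k] g :=
  open Classical in
  if hn : IsNilpotent (ad k g n) then (expEnd_spec n hn).choose.toLinearEquiv else 1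

theorem expG_coe {n : g} (hn : IsNilpotent (ad k g n)) (x : g) :
    expG k n x = expEnd k g (ad k g n) x := by
  rw [expG, dif_pos hn]
  exact LinearMap.congr_fun (expEnd_spec n hn).choose_spec x

theorem expG_apply {n : g} (hn : IsNilpotent (ad k g n)) (x : g) :
    expG k n x = ∑ i ∈ Finset.range (finrank k g + 1), ((i.factorial : k))⁻¹ • ((ad k g n) ^ i) x := by
  rw [expG_coe hn, expEnd]; simp

theorem expG_mem {n : g} (hn : IsNilpotent (ad k g n)) : expG k n ∈ IntG k g :=
  Subgroup.subset_closure ⟨n, hn, LinearMap.ext (expG_coe hn)⟩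

theorem IntG_lie {τ : g ≃ₗ[k] g} (hτ : τ ∈ IntG k g) (x y : g) : τ ⁅x, y⁆ = ⁅τ x, τ y⁆ := by
  induction hτ using Subgroup.closure_induction generalizing x y with
  | mem τ h =>
    obtain ⟨n, hn, he⟩ := h
    obtain ⟨e, h2⟩ := expEnd_spec n hn
    have h3 : ∀ z, τ z = e z := fun z => LinearMap.congr_fun (he.trans h2.symm) z
    rw [h3, h3, h3, LieEquiv.map_lie]
  | one => rfl
  | mul a b _ _ ha hb => 
    change a (b _) = ⁅a (b x), a (b y)⁆
    rw [hb, ha]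
  | inv a _ ha =>
    apply a.injective
    rw [ha]
    have h1 : ∀ z, a (a⁻¹ z) = z := fun z => a.apply_symm_apply z
    rw [h1, h1, h1]

theorem ad_conj_s8 {σ : g ≃ₗ[k] g} (h : ∀ x y, σ ⁅x, y⁆ = ⁅σ x, σ y⁆) (n : g) :
    ad k g (σ n) = σ.conj (ad k g n) := by
  ext x
  simp [LinearEquiv.conj_apply, h]

theorem ad_nilp_map {σ : g ≃ₗ[k] g} (h : ∀ x y, σ ⁅x, y⁆ = ⁅σ x, σ y⁆) {n : g}
    (hn : IsNilpotent (ad k g n)) : IsNilpotent (ad k g (σ n)) := by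
  rw [ad_conj_s8 h]
  exact hn.map (LinearEquiv.conjRingEquiv σ)

theorem ad_nilp_smul {n : g} (hn : IsNilpotent (ad k g n)) (t : k) :
    IsNilpotent (ad k g (t • n)) := by
  rw [map_smul]; exact hn.smul t

theorem expG_conj {σ : g ≃ₗ[k] g} (h : ∀ x y, σ ⁅x, y⁆ = ⁅σ x, σ y⁆) {n : g}
    (hn : IsNilpotent (ad k g n)) : σ * expG k n * σ⁻¹ = expG k (σ n) := by
  ext x
  rw [expG_apply (ad_nilp_map h hn)]
  change σ (expG k n (σ⁻¹ x)) = _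
  rw [expG_apply hn, map_sum]
  refine Finset.sum_congr rfl fun i _ => ?_
  rw [map_smul]
  congr 1
  rw [ad_conj_s8 h]
  have : (σ.conj (ad k g n)) ^ i = σ.conj ((ad k g n) ^ i) :=
    (map_pow (LinearEquiv.conjRingEquiv σ) (ad k g n) i).symm
  rw [this]
  rfl

theorem IntG_conj {σ : g ≃ₗ[k] g} (h : ∀ x y, σ ⁅x, y⁆ = ⁅σ x, σ y⁆) {τ : g ≃ₗ[k] g}
    (hτ : τ ∈ IntG k g) : σ * τ * σ⁻¹ ∈ IntG k g := by
  induction hτ using Subgroup.closure_induction with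
  | mem τ ht =>
    obtain ⟨n, hn, he⟩ := ht
    have : τ = expG k n := by
      ext x; rw [expG_coe hn, ← he]; rfl
    rw [this, expG_conj h hn]
    exact expG_mem (ad_nilp_map h hn)
  | one => simp
  | mul a b _ _ ha hb =>
    have := mul_mem ha hb
    convert this using 1
    group
  | inv a _ ha =>
    have := inv_mem ha
    convert this using 1
    group

/-- Polynomial dependence of the exponential. -/
theorem expG_polyMap {W : Type*} [AddCommGroup W] [Module k W] {n : g}
    (hn : IsNilpotent (ad k g n)) {s : W → k} (hs : s ∈ polyFun k W) {f : W → g}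
    (hf : IsPolyMap k f) : IsPolyMap k (fun w => expG k (s w • n) (f w)) := by
  have : (fun w => expG k (s w • n) (f w)) = fun w =>
      ∑ i ∈ Finset.range (finrank k g + 1), (((i.factorial : k))⁻¹ * s w ^ i) •
        ((ad k g n) ^ i) (f w) := by
    ext w
    rw [expG_apply (ad_nilp_smul hn _)]
    refine Finset.sum_congr rfl fun i _ => ?_
    rw [map_smul, smul_pow, LinearMap.smul_apply, smul_smul]
  rw [this]
  refine IsPolyMap.sum _ fun i _ => IsPolyMap.smul ?_ (IsPolyMap.linear_comp _ hf)
  exact (polyFun k W).mul_mem (const_mem_polyFun _) ((polyFun k W).pow_mem hs i)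

/-- First order expansion of a polynomial curve. -/
def FirstOrder (c : k → g) (x y : g) : Prop :=
  ∃ r : k → g, IsPolyMap k r ∧ ∀ t, c t = x + t • y + t ^ 2 • r t

theorem FirstOrder.exp {c : k → g} {x y : g} (h : FirstOrder c x y) {n : g}
    (hn : IsNilpotent (ad k g n)) (s : k) :
    FirstOrder (fun t => expG k ((t * s) • n) (c t)) x (y + s • ⁅n, x⁆) := by
  obtain ⟨r, hr, hc⟩ := h
  obtain ⟨r', hr', hc'⟩ : ∃ r' : k → g, IsPolyMap k r' ∧ ∀ t, c t = x + t • r' t := by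
    refine ⟨fun t => y + t • r t, (IsPolyMap.const y).add (hr.smul id_mem_polyFun), fun t => ?_⟩
    rw [hc]; module
  refine ⟨fun t => r t + s • ⁅n, r' t⁆ + ∑ i ∈ Finset.range (finrank k g - 1),
    ((((i + 2).factorial : k))⁻¹ * s ^ (i + 2) * t ^ i) • ((ad k g n) ^ (i + 2)) (c t), ?_, ?_⟩
  · have hcp : IsPolyMap k c := by
      have : c = fun t => x + t • r' t := funext hc'
      rw [this]
      exact (IsPolyMap.const x).add (hr'.smul id_mem_polyFun)
    refine (hr.add ?_).add ?_
    · have := (IsPolyMap.linear_comp (ad k g n) hr').smul (const_mem_polyFun s)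
      simpa using this
    · refine IsPolyMap.sum _ fun i _ => IsPolyMap.smul ?_ (IsPolyMap.linear_comp _ hcp)
      exact (polyFun k k).mul_mem (const_mem_polyFun _) ((polyFun k k).pow_mem id_mem_polyFun i)
  · intro t
    dsimp only
    rw [expG_apply (ad_nilp_smul hn _)]
    have hz : ∀ i, finrank k g + 1 ≤ i → (ad k g ((t * s) • n)) ^ i = 0 := fun i hi =>
      pow_eq_zero_of_le hi (pow_finrank_of_nilp (ad_nilp_smul hn _))
    have h1 : ∑ i ∈ Finset.range (finrank k g + 1),
        ((i.factorial : k))⁻¹ • ((ad k g ((t * s) • n)) ^ i) (c t) =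
        ∑ i ∈ Finset.range (finrank k g - 1 + 2),
        ((i.factorial : k))⁻¹ • ((ad k g ((t * s) • n)) ^ i) (c t) := by
      apply Finset.sum_subset
      · apply Finset.range_mono; omega
      · intro i _ hi
        rw [hz i (by simpa using hi)]; simp
    rw [h1, Finset.sum_range_succ', Finset.sum_range_succ']
    have h2 : ∀ i, (((i + 1 + 1).factorial : k))⁻¹ • ((ad k g ((t * s) • n)) ^ (i + 1 + 1)) (c t) =
        t ^ 2 • ((((i + 2).factorial : k))⁻¹ * s ^ (i + 2) * t ^ i) •
          ((ad k g n) ^ (i + 2)) (c t) := by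
      intro i
      rw [map_smul, smul_pow, LinearMap.smul_apply, smul_smul, smul_smul]
      congr 1
      ring
    simp only [h2, ← Finset.smul_sum]
    simp only [zero_add, pow_zero, pow_one, Nat.factorial, Nat.cast_one, inv_one, one_smul,
      Module.End.one_apply, ad_apply, smul_lie, mul_one]
    conv_lhs => enter [1, 2]; rw [hc' t]
    conv_lhs => enter [2]; rw [hc t]
    simp only [lie_add, lie_smul]
    module

theorem isPolyFun_of_mem {F : g → k} (hF : F ∈ polyFun k g) : IsPolyFun k g F := by
  induction hF using Algebra.adjoin_induction with
  | mem x hx =>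
    obtain ⟨ψ, rfl⟩ := hx
    exact ⟨MvPolynomial.X ψ, fun x => by simp⟩
  | algebraMap r => exact ⟨MvPolynomial.C r, fun x => by simp⟩
  | add x y _ _ hx hy =>
    obtain ⟨p, hp⟩ := hx
    obtain ⟨q, hq⟩ := hy
    exact ⟨p + q, fun t => by simp [hp, hq]⟩
  | mul x y _ _ hx hy =>
    obtain ⟨p, hp⟩ := hx
    obtain ⟨q, hq⟩ := hy
    exact ⟨p * q, fun t => by simp [hp, hq]⟩

end LieBasics

section Decomp

variable {k : Type*} [Field k] [IsAlgClosed k] [CharZero k]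
variable {g : Type*} [LieRing g] [LieAlgebra k g] [FiniteDimensional k g]
  [LieAlgebra.IsSemisimple k g]
variable (H : LieSubalgebra k g) [H.IsCartanSubalgebra]

theorem exists_decomp : ∃ (e : H.root → g) (E : (H × (H.root → k)) ≃ₗ[k] g),
    (∀ i, e i ∈ rootSpace H i.1) ∧ (∀ i, e i ≠ 0) ∧
    ∀ h s, E (h, s) = (h : g) + ∑ i, s i • e i := by
  classical
  have hex : ∀ i : H.root, ∃ x ∈ rootSpace H i.1, x ≠ 0 := fun i => i.1.exists_ne_zero
  choose e he he0 using hex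
  let E0 : (H × (H.root → k)) →ₗ[k] g :=
    LinearMap.coprod H.toSubmodule.subtype (Fintype.linearCombination k e)
  have hE0 : ∀ h s, E0 (h, s) = (h : g) + ∑ i, s i • e i := fun h s => by
    simp [E0, Fintype.linearCombination_apply]
    rfl
  have hsurj : Function.Surjective E0 := by
    rw [← LinearMap.range_eq_top, eq_top_iff]
    have h1 := LieModule.iSup_genWeightSpace_eq_top' k H g
    have h2 := congrArg LieSubmodule.toSubmodule h1
    rw [LieSubmodule.iSup_toSubmodule, LieSubmodule.top_toSubmodule] at h2
    rw [← h2]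
    refine iSup_le fun χ => ?_
    intro x hx
    by_cases hχ : χ.IsZero
    · have h3 : x ∈ rootSpace H (0 : H → k) := by
        have : (χ : H → k) = 0 := hχ
        rw [← this]; exact hx
      rw [rootSpace_zero_eq] at h3
      refine ⟨(⟨x, by simpa using h3⟩, 0), ?_⟩
      rw [hE0]; simp
    · have hmem : χ ∈ H.root := by simpa using hχ
      have h4 := LieAlgebra.IsKilling.finrank_rootSpace_eq_one χ hχ
      let v : rootSpace H χ := ⟨e ⟨χ, hmem⟩, he ⟨χ, hmem⟩⟩
      have hv : v ≠ 0 := fun h => he0 ⟨χ, hmem⟩ (congrArg Subtype.val h)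
      obtain ⟨c, hc⟩ := (finrank_eq_one_iff_of_nonzero' v hv).1 h4 ⟨x, hx⟩
      refine ⟨(0, Pi.single ⟨χ, hmem⟩ c), ?_⟩
      rw [hE0]
      have := congrArg Subtype.val hc
      simp only [Pi.single_apply, ite_smul, zero_smul]
      simpa [v] using this
  have hinj : Function.Injective E0 := by
    rw [← LinearMap.ker_eq_bot, LinearMap.ker_eq_bot']
    rintro ⟨h, s⟩ hs
    rw [hE0] at hs
    have hind := LieModule.iSupIndep_genWeightSpace k H g
    let f : Option H.root → (H → k) := fun o => o.elim 0 (fun i => i.1)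
    have hf : Function.Injective f := by
      rintro (_ | i) (_ | j) hij
      · rfl
      · exact absurd hij.symm (LieSubalgebra.isNonZero_coe_root j)
      · exact absurd hij (LieSubalgebra.isNonZero_coe_root i)
      · have : i = j := Subtype.ext (DFunLike.coe_injective hij)
        rw [this]
    have h5 := LieSubmodule.iSupIndep_toSubmodule.2 (hind.comp hf)
    rw [iSupIndep_iff_finsetSum_eq_zero_imp_eq_zero] at h5
    have h6 := h5 Finset.univ (fun o => o.elim (h : g) (fun i => s i • e i)) (by
      rintro (_ | i) -
      · change (h : g) ∈ rootSpace H (0 : H → k)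
        rw [rootSpace_zero_eq]; simp
      · exact (rootSpace H i.1).smul_mem _ (he i)) (by
      rw [Fintype.sum_option]; exact hs)
    ext1
    · have := h6 none (Finset.mem_univ _)
      exact Subtype.ext this
    · funext i
      have := h6 (some i) (Finset.mem_univ _)
      exact (smul_eq_zero.1 this).resolve_right (he0 i)
  exact ⟨e, LinearEquiv.ofBijective E0 ⟨hinj, hsurj⟩, he, he0, hE0⟩

end Decomp

section Phi

variable {k : Type*} [Field k] [IsAlgClosed k] [CharZero k]
variable {g : Type*} [LieRing g] [LieAlgebra k g] [FiniteDimensional k g]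
  [LieAlgebra.IsSemisimple k g]

theorem foldr_phi {ι : Type*} {H : Submodule k g} (e : ι → g)
    (he : ∀ i, IsNilpotent (ad k g (e i)))
    (pr : g →ₗ[k] H) (co : ι → g →ₗ[k] k) (h0 : g) (hp : (pr h0 : g) = h0)
    (hc : ∀ i, co i h0 = 0) (l : List ι) : ∃ φ : g → g, IsPolyMap k φ ∧
      (∀ v, ∃ τ ∈ IntG k g, φ v = τ (pr v)) ∧
      ∀ v, FirstOrder (fun t : k => φ (h0 + t • v)) h0
        ((pr v : g) + (l.map fun i => co i v • ⁅e i, h0⁆).sum) := by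
  induction l with
  | nil =>
    refine ⟨fun v => pr v, IsPolyMap.linear (H.subtype ∘ₗ pr), fun v => ⟨1, one_mem _, rfl⟩,
      fun v => ⟨fun _ => 0, IsPolyMap.const 0, fun t => ?_⟩⟩
    simp [hp]
  | cons i l ih =>
    obtain ⟨φ, h1, h2, h3⟩ := ih
    refine ⟨fun v => expG k (co i v • e i) (φ v),
      expG_polyMap (he i) (dual_mem_polyFun (co i)) h1, fun v => ?_, fun v => ?_⟩
    · obtain ⟨τ, hτ, hv⟩ := h2 v
      exact ⟨expG k (co i v • e i) * τ, mul_mem (expG_mem (ad_nilp_smul (he i) _)) hτ, by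
        simp only [hv]; rfl⟩
    · have h4 := (h3 v).exp (he i) (co i v)
      have h5 : (fun t : k => expG k (co i (h0 + t • v) • e i) (φ (h0 + t • v))) =
          fun t => expG k ((t * co i v) • e i) (φ (h0 + t • v)) := by
        funext t; simp [hc]
      rw [h5]
      convert h4 using 1
      simp only [List.map_cons, List.sum_cons]
      abel

theorem exists_phi (H : LieSubalgebra k g) [H.IsCartanSubalgebra] :
    ∃ (pr : g →ₗ[k] H) (φ : g → g), IsPolyMap k φ ∧ Function.Surjective pr ∧
      (∀ v, ∃ τ ∈ IntG k g, φ v = τ (pr v)) ∧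
      ∃ (a : g) (L : g →ₗ[k] g), Function.Injective L ∧ ∀ v, ∃ r : k → g, IsPolyMap k r ∧
        ∀ t, φ (a + t • v) = φ a + t • L v + t ^ 2 • r t := by
  classical
  obtain ⟨e, E, he, he0, hE⟩ := exists_decomp H
  have hnil : ∀ i, IsNilpotent (ad k g (e i)) := fun i =>
    LieAlgebra.isNilpotent_ad_of_mem_rootSpace H
      (LieSubalgebra.isNonZero_coe_root i) (he i)
  obtain ⟨h0, hh0⟩ := Module.Dual.exists_forall_ne_zero_of_forall_exists
    (fun i : H.root => (i.1.toLinear : Dual k H)) (fun i => by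
      by_contra! hcon
      exact LieSubalgebra.isNonZero_coe_root i (funext hcon))
  let pr : g →ₗ[k] H := LinearMap.fst k H (H.root → k) ∘ₗ E.symm.toLinearMap
  let co : H.root → g →ₗ[k] k := fun i =>
    LinearMap.proj i ∘ₗ LinearMap.snd k H (H.root → k) ∘ₗ E.symm.toLinearMap
  have hEh : E.symm (h0 : g) = (h0, 0) := by
    rw [LinearEquiv.symm_apply_eq, hE]; simp
  have hEv : ∀ v : g, (pr v : g) + ∑ i, co i v • e i = v := fun v => by
    have := hE (E.symm v).1 (E.symm v).2
    rw [Prod.mk.eta, LinearEquiv.apply_symm_apply] at this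
    exact this.symm
  obtain ⟨φ, h1, h2, h3⟩ := foldr_phi (H := H.toSubmodule) e hnil pr co h0
    (by simp [pr, hEh]) (fun i => by simp [co, hEh]) Finset.univ.toList
  refine ⟨pr, φ, h1, Prod.fst_surjective.comp E.symm.surjective, h2, h0, E.toLinearMap ∘ₗ
    (LinearMap.prodMap LinearMap.id (LinearMap.pi fun i =>
      (- (i.1 h0)) • LinearMap.proj i)) ∘ₗ E.symm.toLinearMap, ?_, ?_⟩
  · simp only [LinearMap.coe_comp, LinearEquiv.coe_coe]
    refine E.injective.comp (Function.Injective.comp ?_ E.symm.injective)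
    rintro ⟨x, s⟩ ⟨y, t⟩ hxy
    simp only [LinearMap.prodMap_apply, LinearMap.id_apply, Prod.mk.injEq] at hxy
    ext1
    · exact hxy.1
    · funext i
      have := congrFun hxy.2 i
      simpa [show i.1 h0 ≠ 0 from hh0 i] using this
  · intro v
    obtain ⟨r, hr, hrt⟩ := h3 v
    refine ⟨r, hr, fun t => ?_⟩
    have e0 : φ h0 = h0 := by simpa using hrt 0
    rw [e0]
    have := hrt t
    simp only at this
    rw [this]
    congr 3
    simp only [LinearMap.coe_comp, LinearEquiv.coe_coe, Function.comp_apply,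
      LinearMap.prodMap_apply, LinearMap.id_apply]
    rw [hE]
    congr 1
    rw [Finset.sum_map_toList]
    refine Finset.sum_congr rfl fun i _ => ?_
    have h6 : ⁅e i, (h0 : g)⁆ = - (i.1 h0 • e i) := by
      rw [← lie_skew]
      congr 1
      exact LieAlgebra.IsKilling.lie_eq_smul_of_mem_rootSpace (he i) h0
    rw [h6]
    simp [co, smul_smul, mul_comm]

end Phi

section Sep

variable {k : Type*} [Field k] [IsAlgClosed k] [CharZero k]
variable {g : Type*} [LieRing g] [LieAlgebra k g] [FiniteDimensional k g]
  [LieAlgebra.IsSemisimple k g]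

variable (k g) in
theorem exists_charpoly : ∃ P : Polynomial (polyFun k g), P.Monic ∧
    ∀ x, P.map (evp x).toRingHom = (ad k g x).charpoly := by
  classical
  let b := Module.finBasis k g
  let A : g →ₗ[k] Module.End k g :=
    { toFun := fun x => ad k g x
      map_add' := fun x y => by ext; simp
      map_smul' := fun c x => by ext; simp }
  refine ⟨(LinearMap.polyCharpoly A b).map (toPF b).toRingHom,
    (LinearMap.polyCharpoly_monic _ b).map _, fun x => ?_⟩
  have h := LinearMap.polyCharpoly_map_eq_charpoly A b x
  rw [Polynomial.map_map]
  change _ = (ad k g x).charpoly at h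
  rw [← h]
  congr 1
  refine RingHom.ext fun p => ?_
  exact toPF_apply b p x

theorem root_isRoot (H : LieSubalgebra k g) [H.IsCartanSubalgebra] (α : H.root) (h : H)
    {τ : g ≃ₗ[k] g} (hτ : τ ∈ IntG k g) :
    ((ad k g (τ h)).charpoly).IsRoot (α.1 h) := by
  rw [ad_conj_s8 (IntG_lie hτ), LinearEquiv.charpoly_conj,
    ← Module.End.hasEigenvalue_iff_isRoot_charpoly]
  obtain ⟨x, hx, hx0⟩ := α.1.exists_ne_zero
  refine Module.End.hasEigenvalue_of_hasEigenvector (x := x) ⟨?_, hx0⟩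
  rw [Module.End.mem_eigenspace_iff]
  exact LieAlgebra.IsKilling.lie_eq_smul_of_mem_rootSpace hx h

/-- Elements of `H` conjugate to `y`. -/
def orbH (H : LieSubalgebra k g) (y : g) : Set H := {h | ∃ τ ∈ IntG k g, y = τ h}

theorem eq_of_roots (H : LieSubalgebra k g) [H.IsCartanSubalgebra] {x y : H}
    (h : ∀ α : H.root, α.1 x = α.1 y) : x = y := by
  rw [← sub_eq_zero]
  have h1 := LieAlgebra.IsKilling.span_weight_isNonZero_eq_top k g H
  rw [← Module.forall_dual_apply_eq_zero_iff k]
  intro ψ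
  have hψ : ψ ∈ (⊤ : Submodule k (Dual k H)) := trivial
  rw [← h1] at hψ
  induction hψ using Submodule.span_induction with
  | mem ψ hψ =>
    obtain ⟨α, hα, rfl⟩ := hψ
    rw [map_sub, sub_eq_zero]
    exact h ⟨α, by simpa using hα⟩
  | zero => simp
  | add a b _ _ ha hb => rw [LinearMap.add_apply, ha, hb, add_zero]
  | smul c a _ ha => rw [LinearMap.smul_apply, ha, smul_zero]

theorem orbH_finite (H : LieSubalgebra k g) [H.IsCartanSubalgebra] (y : g) :
    (orbH H y).Finite := by
  have h1 : (Set.pi Set.univ fun _ : H.root =>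
      ({r | (ad k g y).charpoly.IsRoot r} : Set k)).Finite :=
    Set.Finite.pi fun i => by
      have := Polynomial.finite_setOfPred_isRoot (LinearMap.charpoly_monic (ad k g y)).ne_zero
      exact this
  refine Set.Finite.of_finite_image (f := fun h : H => fun i : H.root => i.1 h) ?_ ?_
  · refine h1.subset ?_
    rintro _ ⟨h, ⟨τ, hτ, rfl⟩, rfl⟩
    intro i _
    exact root_isRoot H i h hτ
  · intro x _ z _ hxz
    exact eq_of_roots H fun α => congrFun hxz α

theorem integral_z (H : LieSubalgebra k g) [H.IsCartanSubalgebra] (pr : g →ₗ[k] H)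
    (φ : g → g) (hφ : IsPolyMap k φ) (h : ∀ v, ∃ τ ∈ IntG k g, φ v = τ (pr v))
    (ℓ : Dual k H) : (pbk φ hφ).toRingHom.IsIntegralElem
      ⟨fun v => ℓ (pr v), dual_mem_polyFun (ℓ ∘ₗ pr)⟩ := by
  have h1 := LieAlgebra.IsKilling.span_weight_isNonZero_eq_top k g H
  have hψ : ℓ ∈ (⊤ : Submodule k (Dual k H)) := trivial
  rw [← h1] at hψ
  induction hψ using Submodule.span_induction with
  | mem ψ hψ =>
    obtain ⟨α, hα, rfl⟩ := hψ
    obtain ⟨P, hP, hPx⟩ := exists_charpoly k g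
    refine ⟨P, hP, ?_⟩
    apply Subtype.ext
    funext v
    obtain ⟨τ, hτ, hv⟩ := h v
    have h2 := root_isRoot H ⟨α, by simpa using hα⟩ (pr v) hτ
    rw [← hv, ← hPx, Polynomial.IsRoot.def, Polynomial.eval_map] at h2
    have h3 := Polynomial.hom_eval₂ P (pbk φ hφ).toRingHom (evp v).toRingHom
      (⟨fun v => (LieModule.Weight.toLinear k H g α) (pr v), dual_mem_polyFun ((LieModule.Weight.toLinear k H g α) ∘ₗ pr)⟩ : polyFun k g)
    exact h3.trans h2
  | zero => 
    have := RingHom.isIntegralElem_map (f := (pbk φ hφ).toRingHom) (x := 0)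
    rw [map_zero] at this
    exact this
  | add a b _ _ ha hb => exact ha.add _ hb
  | smul c a _ ha =>
    have := (RingHom.isIntegralElem_map (f := (pbk φ hφ).toRingHom) (x := algebraMap k _ c)).mul _ ha
    exact this

theorem finite_polys (T : Finset k) (d : ℕ) :
    {P : Polynomial k | P.Monic ∧ P.natDegree = d ∧ ∀ r, P.IsRoot r → r ∈ T}.Finite := by
  classical
  refine ((Multiset.powerset (d • T.val)).toFinset.image
    fun s => (s.map fun a => Polynomial.X - Polynomial.C a).prod).finite_toSet.subset ?_
  rintro P ⟨hP, hd, hr⟩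
  rw [Finset.mem_coe, Finset.mem_image]
  refine ⟨P.roots, ?_, ?_⟩
  · rw [Multiset.mem_toFinset, Multiset.mem_powerset, Multiset.le_iff_count]
    intro a
    rw [Multiset.count_nsmul]
    by_cases ha : a ∈ P.roots
    · have h1 := hr a (Polynomial.isRoot_of_mem_roots ha)
      rw [Multiset.count_eq_one_of_mem T.nodup h1, mul_one]
      exact (Multiset.count_le_card _ _).trans (hd ▸ P.card_roots')
    · rw [Multiset.count_eq_zero_of_notMem ha]; exact Nat.zero_le _
  · exact ((IsAlgClosed.splits P).eq_prod_roots_of_monic hP).symm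

theorem orbH_map (H : LieSubalgebra k g) (y : g) {τ : g ≃ₗ[k] g} (hτ : τ ∈ IntG k g) :
    orbH H (τ y) ⊆ orbH H y := by
  rintro h ⟨σ, hσ, e⟩
  refine ⟨τ⁻¹ * σ, mul_mem (inv_mem hτ) hσ, ?_⟩
  change y = τ.symm (σ h)
  rw [← e, LinearEquiv.symm_apply_apply]

theorem poly_const (p q : Polynomial k) (hq : q ≠ 0) (A : Finset k)
    (h : ∀ t, q.eval t ≠ 0 → p.eval t ∈ A) (s t : k) : p.eval s = p.eval t := by
  have h1 : q * ∏ a ∈ A, (p - Polynomial.C a) = 0 := by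
    apply Polynomial.funext
    intro t
    rw [Polynomial.eval_mul, Polynomial.eval_prod, Polynomial.eval_zero]
    by_cases ht : q.eval t = 0
    · rw [ht, zero_mul]
    · rw [Finset.prod_eq_zero (h t ht) (by simp), mul_zero]
  rcases mul_eq_zero.1 h1 with h2 | h2
  · exact absurd h2 hq
  · obtain ⟨a, _, ha⟩ := Finset.prod_eq_zero_iff.1 h2
    rw [sub_eq_zero.1 ha]; simp

theorem coeff_inv (H : LieSubalgebra k g) [H.IsCartanSubalgebra] (ℓ : Dual k H)
    (b : polyFun k g) (hb : b ≠ 0) (m : Polynomial (polyFun k g)) (hm : m.Monic)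
    (hr : ∀ x, b.1 x ≠ 0 → ∀ r, (m.map (evp x).toRingHom).IsRoot r →
      ∃ h ∈ orbH H x, ℓ h = r) (j : ℕ) {τ : g ≃ₗ[k] g} (hτ : τ ∈ IntG k g) (x : g) :
    (m.coeff j).1 (τ x) = (m.coeff j).1 x := by
  classical
  have key : ∀ n : g, IsNilpotent (ad k g n) → ∀ x, (m.coeff j).1 (expG k n x) = (m.coeff j).1 x := by
    intro n hn
    have key1 : ∀ x, b.1 x ≠ 0 → (m.coeff j).1 (expG k n x) = (m.coeff j).1 x := by
      intro x hx
      have hc : IsPolyMap k (fun t : k => expG k (t • n) x) :=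
        expG_polyMap hn id_mem_polyFun (IsPolyMap.const x)
      obtain ⟨p, hp⟩ := polyFun_curve (polyFun_comp (m.coeff j).2 hc)
      obtain ⟨q, hq⟩ := polyFun_curve (polyFun_comp b.2 hc)
      have e0 : expG k ((0 : k) • n) x = x := by
        rw [expG_apply (ad_nilp_smul hn 0), Finset.sum_range_succ']
        simp
      have hq0 : q ≠ 0 := by
        rintro rfl
        have := hq 0
        simp only [e0, Polynomial.eval_zero] at this
        exact hx this
      have hfin := (finite_polys (((orbH_finite H x).image ℓ).toFinset) m.natDegree).image
        (fun P => P.coeff j)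
      have := poly_const p q hq0 hfin.toFinset (fun t ht => by
        rw [← hq t] at ht
        rw [← hp t, Set.Finite.mem_toFinset]
        refine ⟨m.map (evp (expG k (t • n) x)).toRingHom, ⟨hm.map _, hm.natDegree_map _, ?_⟩, ?_⟩
        · intro r hrr
          obtain ⟨h, hh, e⟩ := hr _ ht r hrr
          rw [Set.Finite.mem_toFinset]
          exact ⟨h, orbH_map H x (expG_mem (ad_nilp_smul hn t)) hh, e⟩
        · simp only [Polynomial.coeff_map]; rfl) 1 0
      rw [← hp, ← hp] at this
      simpa only [e0, one_smul] using this
    by_contra! hcon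
    obtain ⟨x, hx⟩ := hcon
    have hG : (fun y => (m.coeff j).1 (expG k n y) - (m.coeff j).1 y) ∈ polyFun k g :=
      (polyFun k g).sub_mem (polyFun_comp (m.coeff j).2 (IsPolyMap.linear (expG k n).toLinearMap))
        (m.coeff j).2
    refine polyFun_dom b.2 hG (fun h => hb (Subtype.ext h))
      (fun h => hx (sub_eq_zero.1 (congrFun h x))) ?_
    funext y
    by_cases hy : b.1 y = 0
    · simp [hy]
    · simp [key1 y hy]
  induction hτ using Subgroup.closure_induction generalizing x with
  | mem τ h =>
    obtain ⟨n, hn, e⟩ := h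
    have : τ = expG k n := by
      ext y
      rw [expG_coe hn, ← e]; rfl
    rw [this]; exact key n hn x
  | one => rfl
  | mul a c _ _ ha hc => 
    change (m.coeff j).1 (a (c x)) = _
    rw [ha, hc]
  | inv a _ ha =>
    rw [← ha (a⁻¹ x)]
    exact congrArg (m.coeff j).1 (a.apply_symm_apply x)

theorem separation (H : LieSubalgebra k g) [H.IsCartanSubalgebra] :
    ∃ (pr : g →ₗ[k] H) (φ : g → g) (b : polyFun k g), b ≠ 0 ∧ IsPolyMap k φ ∧
      Function.Surjective pr ∧ (∀ v, ∃ τ ∈ IntG k g, φ v = τ (pr v)) ∧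
      ∀ x, b.1 x ≠ 0 → (∃ v, φ v = x) ∧
      ∀ y, b.1 y ≠ 0 → (∀ F ∈ polyFun k g, (∀ τ ∈ IntG k g, ∀ x, F (τ x) = F x) → F y = F x) →
        ∃ τ ∈ IntG k g, y = τ x := by
  obtain ⟨pr, φ, hφ, hpr, hτ, a, L, hL1, hL2⟩ := exists_phi H
  obtain ⟨b, hb, hz⟩ := dom_ext_V φ hφ a L hL1 hL2
  have hz' := fun ℓ => hz _ (integral_z H pr φ hφ hτ ℓ)
  have hsurj : ∀ x, b.1 x ≠ 0 → ∃ v, φ v = x := by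
    intro x hx
    obtain ⟨m, hm, h1, h2⟩ := hz' 0
    have hdeg : (m.map (evp x).toRingHom).degree ≠ 0 := by
      rw [hm.degree_map]
      intro h0
      have := hm.natDegree_eq_zero.1 (Polynomial.natDegree_eq_of_degree_eq_some h0)
      subst this
      simpa using h1 0
    obtain ⟨r, hr⟩ := IsAlgClosed.exists_root _ hdeg
    obtain ⟨v, hv, -⟩ := h2 x hx r hr
    exact ⟨v, hv⟩
  have horb : ∀ v, pr v ∈ orbH H (φ v) := hτ
  refine ⟨pr, φ, b, hb, hφ, hpr, hτ, fun x hx => ⟨hsurj x hx, fun y hy hF => ?_⟩⟩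
  · obtain ⟨w, rfl⟩ := hsurj y hy
    have := (orbH_finite H x).to_subtype
    let ι := {i : orbH H x // i.1 ≠ pr w}
    obtain ⟨ℓ, hℓ⟩ := Module.exists_dual_forall_apply_ne_zero (K := k)
      (fun i : ι => i.1.1 - pr w) (fun i => sub_ne_zero.2 i.2)
    obtain ⟨m, hm, h1, h2⟩ := hz' ℓ
    have hinv := coeff_inv H ℓ b hb m hm (fun x hx r hr => by
      obtain ⟨v, rfl, e⟩ := h2 x hx r hr
      exact ⟨pr v, horb v, e⟩)
    have heq : m.map (evp (φ w)).toRingHom = m.map (evp x).toRingHom := by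
      ext j
      rw [Polynomial.coeff_map, Polynomial.coeff_map]
      exact hF _ (m.coeff j).2 (fun τ hτ x => hinv j hτ x)
    have h3 := h1 w
    rw [heq] at h3
    obtain ⟨v, rfl, e⟩ := h2 x hx _ h3
    have h4 : pr v = pr w := by
      by_contra hne
      apply hℓ ⟨⟨pr v, horb v⟩, hne⟩
      rw [map_sub, sub_eq_zero]
      exact e
    obtain ⟨τ, h5, h6⟩ := hτ v
    obtain ⟨σ, h7, h8⟩ := hτ w
    refine ⟨σ * τ⁻¹, mul_mem h7 (inv_mem h5), ?_⟩
    rw [h8, h6, h4]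
    change _ = σ (τ.symm (τ _))
    rw [LinearEquiv.symm_apply_apply]

end Sep

section Torus

variable {k : Type*} [Field k] [IsAlgClosed k] [CharZero k]
variable {g : Type*} [LieRing g] [LieAlgebra k g] [FiniteDimensional k g]
  [LieAlgebra.IsSemisimple k g]

theorem expG_apply3 {n : g} (hn : IsNilpotent (ad k g n)) {x : g} (hx : ⁅n, ⁅n, ⁅n, x⁆⁆⁆ = 0) :
    expG k n x = x + ⁅n, x⁆ + (2 : k)⁻¹ • ⁅n, ⁅n, x⁆⁆ := by
  rw [expG_apply hn]
  have h3 : ∀ i, 3 ≤ i → ((ad k g n) ^ i) x = 0 := by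
    intro i hi
    obtain ⟨j, rfl⟩ := Nat.exists_eq_add_of_le' hi
    rw [pow_add, Module.End.mul_apply]
    have : ((ad k g n) ^ 3) x = 0 := by
      simpa [pow_succ, Module.End.mul_apply] using hx
    rw [this, map_zero]
  have hN : ∀ i, finrank k g + 1 ≤ i → ((ad k g n) ^ i) x = 0 := by
    intro i hi
    obtain ⟨j, rfl⟩ := Nat.exists_eq_add_of_le' hi
    rw [pow_add, pow_finrank_of_nilp hn, mul_zero, LinearMap.zero_apply]
  have e1 : ∀ M, (∀ i, M ≤ i → ((ad k g n) ^ i) x = 0) →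
      ∑ i ∈ Finset.range M, ((i.factorial : k))⁻¹ • ((ad k g n) ^ i) x =
      ∑ i ∈ Finset.range (finrank k g + 1 + 3), ((i.factorial : k))⁻¹ • ((ad k g n) ^ i) x ∨
      finrank k g + 1 + 3 < M := by
    intro M hM
    by_cases h : M ≤ finrank k g + 1 + 3
    · left
      refine Finset.sum_subset (Finset.range_mono h) fun i _ hi => ?_
      rw [hM i (by simpa using hi), smul_zero]
    · right; omega
  rw [(e1 _ hN).resolve_right (by omega), ← (e1 3 h3).resolve_right (by omega)]
  simp [Finset.sum_range_succ, pow_succ, Module.End.mul_apply, Nat.factorial]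

theorem w_apply (H : LieSubalgebra k g) [H.IsCartanSubalgebra] (α : H.root) {e f : g}
    (he : e ∈ rootSpace H α.1) (hf : f ∈ rootSpace H (-(α.1 : H → k)))
    (ht : IsSl2Triple (LieAlgebra.IsKilling.coroot α.1 : g) e f)
    (hne : IsNilpotent (ad k g e)) (hnf : IsNilpotent (ad k g (-f))) (x : H) :
    (expG k e * expG k (-f) * expG k e) (x : g) =
      ((x - α.1 x • LieAlgebra.IsKilling.coroot α.1 : H) : g) := by
  set h : g := (LieAlgebra.IsKilling.coroot α.1 : g) with hh
  set c := α.1 x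
  have xe : ⁅(x : g), e⁆ = c • e := LieAlgebra.IsKilling.lie_eq_smul_of_mem_rootSpace he x
  have xf : ⁅(x : g), f⁆ = -(c • f) := by
    have := LieAlgebra.IsKilling.lie_eq_smul_of_mem_rootSpace hf x
    rw [Pi.neg_apply, neg_smul] at this
    exact this
  have ex : ⁅e, (x : g)⁆ = -(c • e) := by rw [← lie_skew, xe]
  have fx : ⁅f, (x : g)⁆ = c • f := by rw [← lie_skew, xf, neg_neg]
  have ef : ⁅e, f⁆ = h := ht.lie_e_f
  have fe : ⁅f, e⁆ = -h := by rw [← lie_skew, ef]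
  have he2 : ⁅e, h⁆ = -((2 : k) • e) := by rw [← lie_skew, ht.lie_h_e_smul k]
  have hf2 : ⁅f, h⁆ = (2 : k) • f := by rw [← lie_skew, ht.lie_lie_smul_f k, neg_neg]
  have a1 : expG k e (x : g) = x - c • e := by
    rw [expG_apply3 hne (by simp [ex])]
    simp [ex]; abel
  have a2 : expG k e h = h - (2 : k) • e := by
    rw [expG_apply3 hne (by simp [he2])]
    simp [he2]; abel
  have a3 : expG k e e = e := by
    rw [expG_apply3 hne (by simp)]
    simp
  have b1 : expG k (-f) (x : g) = x - c • f := by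
    rw [expG_apply3 hnf (by simp [fx])]
    simp [fx]; abel
  have b2 : expG k (-f) e = e + h - f := by
    rw [expG_apply3 hnf (by simp [fe, hf2])]
    simp [fe, hf2, smul_smul]; abel
  change expG k e (expG k (-f) (expG k e (x : g))) = _
  rw [a1, map_sub, map_smul, b1, b2]
  have : (x : g) - c • f - c • (e + h - f) = x - c • e - c • h := by module
  rw [this, map_sub, map_sub, map_smul, map_smul, a1, a2, a3]
  have h2 : ((x - c • LieAlgebra.IsKilling.coroot α.1 : H) : g) = x - c • h := by
    simp [hh]
  rw [h2]
  module

theorem g_ind (H : LieSubalgebra k g) [H.IsCartanSubalgebra] {P : g → Prop} (hz : P 0)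
    (hadd : ∀ x y, P x → P y → P (x + y))
    (hw : ∀ χ : LieModule.Weight k H g, ∀ x ∈ rootSpace H χ, P x) (x : g) : P x := by
  have h1 := LieModule.iSup_genWeightSpace_eq_top' k H g
  have h2 := congrArg LieSubmodule.toSubmodule h1
  rw [LieSubmodule.iSup_toSubmodule, LieSubmodule.top_toSubmodule] at h2
  have hx : x ∈ (⊤ : Submodule k g) := trivial
  rw [← h2] at hx
  exact Submodule.iSup_induction _ (motive := P) hx (fun χ x hx => hw χ x hx) hz hadd

theorem mem_rootSpace_of (H : LieSubalgebra k g) [H.IsCartanSubalgebra] {χ : H → k} {x : g}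
    (h : ∀ y : H, ⁅(y : g), x⁆ = χ y • x) : x ∈ rootSpace H χ :=
  LieModule.weightSpace_le_genWeightSpace g χ ((LieModule.mem_weightSpace _ _).2 h)

theorem span_rootSpace (H : LieSubalgebra k g) [H.IsCartanSubalgebra] (α : H.root) {e x : g}
    (he : e ∈ rootSpace H α.1) (he0 : e ≠ 0) (hx : x ∈ rootSpace H α.1) : ∃ c : k, x = c • e := by
  have h4 := LieAlgebra.IsKilling.finrank_rootSpace_eq_one α.1 (LieSubalgebra.isNonZero_coe_root α)
  let v : rootSpace H α.1 := ⟨e, he⟩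
  have hv : v ≠ 0 := fun h => he0 (congrArg Subtype.val h)
  obtain ⟨c, hc⟩ := (finrank_eq_one_iff_of_nonzero' v hv).1 h4 ⟨x, hx⟩
  exact ⟨c, (congrArg Subtype.val hc).symm⟩

theorem exists_D (H : LieSubalgebra k g) [H.IsCartanSubalgebra] (α : H.root) {t : k} (ht : t ≠ 0) :
    ∃ D : g ≃ₗ[k] g, (∀ x y, D ⁅x, y⁆ = ⁅D x, D y⁆) ∧
      ∀ (χ : H → k) (n : ℤ), χ (LieAlgebra.IsKilling.coroot α.1) = n →
        ∀ x ∈ rootSpace H χ, D x = t ^ n • x := by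
  classical
  obtain ⟨e, E, he, he0, hE⟩ := exists_decomp H
  have hNint : ∀ i : LieModule.Weight k H g, ∃ n : ℤ, i (LieAlgebra.IsKilling.coroot α.1) = n :=
    fun i => ⟨_, LieAlgebra.IsKilling.apply_coroot_eq_cast α.1 i⟩
  choose N hN using hNint
  let D : g ≃ₗ[k] g := E.symm ≪≫ₗ (LinearEquiv.prodCongr (LinearEquiv.refl k H)
    (LinearEquiv.piCongrRight fun i : H.root =>
      LinearEquiv.smulOfNeZero k k (t ^ N i.1) (zpow_ne_zero _ ht))) ≪≫ₗ E
  have hDH : ∀ h : H, D h = h := by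
    intro h
    have : E.symm (h : g) = (h, 0) := by rw [LinearEquiv.symm_apply_eq, hE]; simp
    simp [D, this, hE]
  have hDe : ∀ i, D (e i) = t ^ N i.1 • e i := by
    intro i
    have : E.symm (e i) = (0, Pi.single i 1) := by
      rw [LinearEquiv.symm_apply_eq, hE]; simp [Pi.single_apply]
    simp only [D, LinearEquiv.trans_apply, this, LinearEquiv.prodCongr_apply, hE]
    rw [Finset.sum_eq_single i]
    · simp
    · intro j _ hj; simp [hj]
    · simp
  have spec : ∀ (χ : H → k) (n : ℤ), χ (LieAlgebra.IsKilling.coroot α.1) = n →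
        ∀ x ∈ rootSpace H χ, D x = t ^ n • x := by
    intro χ n hn x hx
    by_cases hx0 : x = 0
    · rw [hx0, map_zero, smul_zero]
    by_cases hχ : χ = 0
    · subst hχ
      have : n = 0 := by simpa using hn.symm
      subst this
      rw [rootSpace_zero_eq] at hx
      rw [zpow_zero, one_smul]
      exact hDH ⟨x, by simpa using hx⟩
    · let w : LieModule.Weight k H g := ⟨χ, fun hbot => hx0 (by
        have h7 : x ∈ rootSpace H χ := hx
        rw [show rootSpace H χ = ⊥ from hbot] at h7
        simpa using h7)⟩
      have hw : w ∈ H.root := by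
        rw [LieSubalgebra.root, Finset.mem_filter]
        exact ⟨Finset.mem_univ _, hχ⟩
      obtain ⟨c, hc⟩ := span_rootSpace H ⟨w, hw⟩ (he ⟨w, hw⟩) (he0 ⟨w, hw⟩) hx
      have hnn : N w = n := by
        have := hN w
        rw [show w (LieAlgebra.IsKilling.coroot α.1) = n from hn] at this
        exact_mod_cast this.symm
      rw [hc, map_smul, hDe, smul_comm]
      simp only [hnn]
  refine ⟨D, ?_, spec⟩
  intro x y
  refine g_ind H (P := fun x => D ⁅x, y⁆ = ⁅D x, D y⁆) (by simp)
    (fun a b ha hb => by rw [add_lie, map_add, map_add, add_lie, ha, hb]) (fun χ x hx => ?_) x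
  refine g_ind H (P := fun y => D ⁅x, y⁆ = ⁅D x, D y⁆) (by simp)
    (fun a b ha hb => by rw [lie_add, map_add, map_add, lie_add, ha, hb]) (fun ψ y hy => ?_) y
  have hxy : ⁅x, y⁆ ∈ rootSpace H ((χ : H → k) + ψ) :=
    LieAlgebra.lie_mem_genWeightSpace_of_mem_genWeightSpace hx hy
  rw [spec _ (N χ + N ψ) (by rw [Pi.add_apply, hN, hN]; push_cast; rfl) _ hxy,
    spec _ _ (hN χ) _ hx, spec _ _ (hN ψ) _ hy, smul_lie, lie_smul, smul_smul, zpow_add₀ ht]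

theorem exists_w (H : LieSubalgebra k g) [H.IsCartanSubalgebra] (α : H.root) :
    ∃ e f : g, e ∈ rootSpace H α.1 ∧ f ∈ rootSpace H (-(α.1 : H → k)) ∧ e ≠ 0 ∧
      ⁅e, f⁆ = (LieAlgebra.IsKilling.coroot α.1 : g) ∧ ⁅e, f⁆ ≠ 0 ∧
      IsNilpotent (ad k g e) ∧ IsNilpotent (ad k g (-f)) ∧
      ∀ x : H, (expG k e * expG k (-f) * expG k e) (x : g) =
        ((x - α.1 x • LieAlgebra.IsKilling.coroot α.1 : H) : g) := by
  have h0 := LieSubalgebra.isNonZero_coe_root α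
  obtain ⟨h, e, f, ht, he, hf⟩ := LieAlgebra.IsKilling.exists_isSl2Triple_of_weight_isNonZero h0
  have hh := ht.h_eq_coroot h0 he hf
  subst hh
  have hne : IsNilpotent (ad k g e) := LieAlgebra.isNilpotent_ad_of_mem_rootSpace H h0 he
  have hnf : IsNilpotent (ad k g (-f)) :=
    LieAlgebra.isNilpotent_ad_of_mem_rootSpace H (neg_ne_zero.2 h0) (neg_mem hf)
  exact ⟨e, f, he, hf, ht.e_ne_zero, ht.lie_e_f, ht.lie_e_f ▸ ht.h_ne_zero, hne, hnf,
    w_apply H α he hf ht hne hnf⟩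

theorem inv_rootSpace (H : LieSubalgebra k g) [H.IsCartanSubalgebra] {w : g ≃ₗ[k] g}
    (hw : ∀ x y, w ⁅x, y⁆ = ⁅w x, w y⁆) (s : H → H) (hs : ∀ x : H, w x = (s x : g)) (χ : H → k)
    {x : g} (hx : x ∈ rootSpace H χ) : w.symm x ∈ rootSpace H (χ ∘ s) := by
  refine mem_rootSpace_of H fun y => ?_
  apply w.injective
  rw [hw, LinearEquiv.apply_symm_apply, map_smul, LinearEquiv.apply_symm_apply, hs]
  exact LieAlgebra.IsKilling.lie_eq_smul_of_mem_rootSpace hx (s y)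

theorem D_mem (H : LieSubalgebra k g) [H.IsCartanSubalgebra] (α : H.root) {t : k} (ht : t ≠ 0) :
    ∃ T ∈ IntG k g, ∀ (χ : Dual k H) (n : ℤ), χ (LieAlgebra.IsKilling.coroot α.1) = n →
        ∀ x ∈ rootSpace H χ, T x = t ^ n • x := by
  obtain ⟨s, hs⟩ := IsAlgClosed.exists_pow_nat_eq t (n := 2) (by norm_num)
  have hs0 : s ≠ 0 := by rintro rfl; apply ht; rw [← hs]; simp
  obtain ⟨D, hD, hDs⟩ := exists_D H α hs0
  obtain ⟨e, f, he, hf, he0, hef, hef0, hne, hnf, hwH⟩ := exists_w H α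
  set w := expG k e * expG k (-f) * expG k e with hw
  have hwG : w ∈ IntG k g := mul_mem (mul_mem (expG_mem hne) (expG_mem hnf)) (expG_mem hne)
  refine ⟨(D * w * D⁻¹) * w⁻¹, mul_mem (IntG_conj hD hwG) (inv_mem hwG), ?_⟩
  intro χ n hn x hx
  have h1 := inv_rootSpace H (IntG_lie hwG) _ hwH χ hx
  have h2 := hDs _ (-n) (by
    have h3 : α.1 (LieAlgebra.IsKilling.coroot α.1) = 2 :=
      LieAlgebra.IsKilling.root_apply_coroot (LieSubalgebra.isNonZero_coe_root α)
    simp only [Function.comp_apply, h3, map_sub, map_smul, hn, smul_eq_mul]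
    push_cast; ring) _ h1
  have h3 : D.symm (w.symm x) = s ^ n • w.symm x := by
    rw [LinearEquiv.symm_apply_eq, map_smul, h2, smul_smul, ← zpow_add₀ hs0]
    simp
  change D (w (D.symm (w.symm x))) = _
  rw [h3, map_smul, map_smul, LinearEquiv.apply_symm_apply, hDs _ n hn _ hx, smul_smul,
    ← mul_zpow, ← hs, sq]

theorem sum_gen {ι M : Type*} [Fintype ι] [DecidableEq ι] [AddCommGroup M] (v : ι → M) (j : ι)
    (a : ι → ℤ) (b : ι → ι → ℤ) (d : ℤ) (hab : ∀ l, ∑ i, a i * b i l = if j = l then d else 0) :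
    ∑ i, a i • ∑ l, b i l • v l = d • v j := by
  simp only [Finset.smul_sum, smul_smul]
  rw [Finset.sum_comm]
  simp only [← Finset.sum_smul]
  simp [hab]

theorem solve_torus {ι : Type*} [Fintype ι] [DecidableEq ι] (A : Matrix ι ι ℤ) (hA : A.det ≠ 0)
    (c : ι → kˣ) : ∃ t : ι → kˣ, ∀ j, ∏ i, t i ^ A j i = c j := by
  have hroot : ∀ a : kˣ, ∃ u : kˣ, u ^ A.det = a := by
    intro a
    obtain ⟨z, hz⟩ := IsAlgClosed.exists_pow_nat_eq (a : k) (n := A.det.natAbs)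
      (Int.natAbs_pos.2 hA)
    have hz0 : z ≠ 0 := by
      rintro rfl
      rw [zero_pow (Int.natAbs_ne_zero.2 hA)] at hz
      exact a.ne_zero hz.symm
    have hz' : (Units.mk0 z hz0) ^ A.det.natAbs = a := by
      ext; simpa using hz
    rcases Int.natAbs_eq A.det with h | h
    · refine ⟨Units.mk0 z hz0, ?_⟩
      rw [h, zpow_natCast]; simpa using hz'
    · refine ⟨(Units.mk0 z hz0)⁻¹, ?_⟩
      rw [h, zpow_neg, inv_zpow, inv_inv, zpow_natCast]; simpa using hz'
  choose u hu using hroot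
  let v : ι → Additive kˣ := fun l => Additive.ofMul (u (c l))
  refine ⟨fun i => (∑ l, A.adjugate i l • v l).toMul, fun j => ?_⟩
  have hadj : ∀ l, ∑ i, A j i * A.adjugate i l = if j = l then A.det else 0 := by
    intro l
    have := congrFun (congrFun (Matrix.mul_adjugate A) j) l
    rw [Matrix.mul_apply] at this
    rw [this]
    simp [Matrix.one_apply]
  have key := sum_gen v j (fun i => A j i) (fun i l => A.adjugate i l) A.det hadj
  have := congrArg Additive.toMul key
  rw [toMul_sum] at this
  simp only [toMul_zsmul] at this
  rw [this]
  exact hu (c j)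

end Torus

section Final

variable {k : Type*} [Field k] [IsAlgClosed k] [CharZero k]
variable {g : Type*} [LieRing g] [LieAlgebra k g] [FiniteDimensional k g]
  [LieAlgebra.IsSemisimple k g]

theorem prod_D (H : LieSubalgebra k g) [H.IsCartanSubalgebra] {ι : Type*} (α : ι → H.root)
    (t : ι → kˣ) (l : List ι) :
    ∃ T ∈ IntG k g, ∀ (χ : Dual k H) (n : ι → ℤ),
      (∀ i, χ (LieAlgebra.IsKilling.coroot (α i).1) = n i) →
        ∀ x ∈ rootSpace H χ, T x = (((l.map fun i => t i ^ n i).prod : kˣ) : k) • x := by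
  induction l with
  | nil => exact ⟨1, one_mem _, fun χ n _ x _ => by simp⟩
  | cons i l ih =>
    obtain ⟨T, hT, h⟩ := ih
    obtain ⟨T', hT', h'⟩ := D_mem H (α i) (t i).ne_zero
    refine ⟨T' * T, mul_mem hT' hT, fun χ n hn x hx => ?_⟩
    change T' (T x) = _
    rw [h χ n hn x hx, map_smul, h' χ _ (hn i) x hx, smul_smul, List.map_cons, List.prod_cons]
    push_cast
    rw [mul_comm]

theorem fix_step (H : LieSubalgebra k g) [H.IsCartanSubalgebra] {ν : g ≃ₗ[k] g}
    (hν : ∀ x y, ν ⁅x, y⁆ = ⁅ν x, ν y⁆) (hH : ∀ h : H, ν h = h) (α : H.root)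
    (hα : ∀ x ∈ rootSpace H α.1, ν x = x) (χ : H → k) (hχ : ∀ x ∈ rootSpace H χ, ν x = x)
    (x : g) (hx : x ∈ rootSpace H (χ ∘ fun y => y - α.1 y • LieAlgebra.IsKilling.coroot α.1)) :
    ν x = x := by
  obtain ⟨e, f, he, hf, he0, hef, hef0, hne, hnf, hwH⟩ := exists_w H α
  have hνe := hα e he
  have hνf : ν f = f := by
    have h1 : ν f ∈ rootSpace H (-(α.1 : H → k)) := by
      refine mem_rootSpace_of H fun y => ?_
      rw [← hH y, ← hν]
      have := LieAlgebra.IsKilling.lie_eq_smul_of_mem_rootSpace hf y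
      rw [← map_smul]
      exact congrArg ν this
    have hα' : (-α.1 : LieModule.Weight k H g) ∈ H.root := by
      simpa using LieSubalgebra.isNonZero_coe_root α
    have hf0 : f ≠ 0 := by rintro rfl; simp at hef0
    obtain ⟨d, hd⟩ := span_rootSpace H ⟨-α.1, hα'⟩ (e := f) (x := ν f) hf hf0 h1
    have h2 : ν ⁅e, f⁆ = ⁅e, f⁆ := by rw [hef]; exact hH _
    rw [hν, hνe, hd, lie_smul] at h2
    have h3 : (d - 1) • ⁅e, f⁆ = 0 := by rw [sub_smul, h2, one_smul, sub_self]
    have h4 : d = 1 := sub_eq_zero.1 ((smul_eq_zero.1 h3).resolve_right hef0)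
    rw [hd, h4, one_smul]
  set w := expG k e * expG k (-f) * expG k e with hw
  have hwG : w ∈ IntG k g := mul_mem (mul_mem (expG_mem hne) (expG_mem hnf)) (expG_mem hne)
  have c1 : ν * expG k e = expG k e * ν := by
    have := expG_conj hν hne
    rw [hνe] at this
    exact mul_inv_eq_iff_eq_mul.1 this
  have c2 : ν * expG k (-f) = expG k (-f) * ν := by
    have := expG_conj hν hnf
    rw [map_neg, hνf] at this
    exact mul_inv_eq_iff_eq_mul.1 this
  have c3 : ν * w = w * ν := by
    rw [hw, ← mul_assoc, ← mul_assoc, c1, mul_assoc (expG k e) ν, c2, mul_assoc, mul_assoc,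
      mul_assoc, c1]
    simp only [mul_assoc]
  have hwx : w x ∈ rootSpace H χ := by
    refine mem_rootSpace_of H fun y => ?_
    have hαα : α.1 (LieAlgebra.IsKilling.coroot α.1) = 2 :=
      LieAlgebra.IsKilling.root_apply_coroot (LieSubalgebra.isNonZero_coe_root α)
    set s : H → H := fun y => y - α.1 y • LieAlgebra.IsKilling.coroot α.1 with hs
    have hss : s (s y) = y := by
      have h1 : α.1 (s y) = - α.1 y := by
        change LieModule.Weight.toLinear k H g α.1 (y - α.1 y • LieAlgebra.IsKilling.coroot α.1) = _
        rw [map_sub, map_smul]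
        change α.1 y - α.1 y * α.1 (LieAlgebra.IsKilling.coroot α.1) = _
        rw [hαα]; ring
      change s y - α.1 (s y) • _ = y
      rw [h1, hs]
      module
    have h1 : (y : g) = w (s y) := by
      rw [hwH]
      change (y : g) = ((s (s y) : H) : g)
      rw [hss]
    rw [h1, ← IntG_lie hwG]
    have := LieAlgebra.IsKilling.lie_eq_smul_of_mem_rootSpace hx (s y)
    change ⁅((s y : H) : g), x⁆ = χ (s (s y)) • x at this
    rw [this, hss, map_smul]
  have h5 := hχ _ hwx
  have h6 : w (ν x) = w x := by
    have := congrArg (fun F : g ≃ₗ[k] g => F x) c3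
    change ν (w x) = w (ν x) at this
    rw [← this, h5]
  exact w.injective h6

theorem torus_inner (H : LieSubalgebra k g) [H.IsCartanSubalgebra] {ν : g ≃ₗ[k] g}
    (hν : ∀ x y, ν ⁅x, y⁆ = ⁅ν x, ν y⁆) (hH : ∀ h : H, ν h = h) : ν ∈ IntG k g := by
  classical
  obtain ⟨b⟩ := RootPairing.nonempty_base (P := LieAlgebra.IsKilling.rootSystem H)
  have hpres : ∀ (χ : H → k) (x : g), x ∈ rootSpace H χ → ν x ∈ rootSpace H χ := by
    intro χ x hx
    refine mem_rootSpace_of H fun y => ?_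
    rw [← hH y, ← hν, ← map_smul]
    exact congrArg ν (LieAlgebra.IsKilling.lie_eq_smul_of_mem_rootSpace hx y)
  have hc : ∀ j : b.support, ∃ c : kˣ, ∀ x ∈ rootSpace H (j : H.root).1, ν x = (c : k) • x := by
    intro j
    obtain ⟨e, he, he0⟩ := (j : H.root).1.exists_ne_zero
    obtain ⟨c, hc⟩ := span_rootSpace H (j : H.root) he he0 (hpres _ _ he)
    have hc0 : c ≠ 0 := by
      rintro rfl
      rw [zero_smul] at hc
      exact he0 (ν.injective (by rw [hc, map_zero]))
    refine ⟨Units.mk0 c hc0, fun x hx => ?_⟩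
    obtain ⟨a, rfl⟩ := span_rootSpace H (j : H.root) he he0 hx
    rw [map_smul, hc, smul_comm]; rfl
  choose c hc using hc
  have hdet : b.cartanMatrix.det ≠ 0 :=
    Matrix.nondegenerate_iff_det_ne_zero.1 b.cartanMatrix_nondegenerate
  obtain ⟨t, ht⟩ := solve_torus b.cartanMatrix hdet c
  obtain ⟨T, hT, hTs⟩ := prod_D H (fun i : b.support => (i : H.root)) t Finset.univ.toList
  have hTl := IntG_lie hT
  set ν' := T⁻¹ * ν with hν'
  have hν'l : ∀ x y, ν' ⁅x, y⁆ = ⁅ν' x, ν' y⁆ := by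
    intro x y
    change T⁻¹ (ν ⁅x, y⁆) = ⁅T⁻¹ (ν x), T⁻¹ (ν y)⁆
    rw [hν, IntG_lie (inv_mem hT)]
  have hsymm : ∀ x, T x = ν x → ν' x = x := fun x hx => by
    change T.symm (ν x) = x
    rw [LinearEquiv.symm_apply_eq, hx]
  have hν'H : ∀ h : H, ν' h = h := by
    intro h
    apply hsymm
    rw [hH, hTs 0 0 (by simp) _ (by
      change (h : g) ∈ rootSpace H (0 : H → k)
      rw [rootSpace_zero_eq]; simp)]
    simp
  have hsimple : ∀ j ∈ b.support, ∀ x ∈ rootSpace H (j : H.root).1, ν' x = x := by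
    intro j hj x hx
    apply hsymm
    rw [hc ⟨j, hj⟩ x hx, hTs (LieModule.Weight.toLinear k H g j.1) (fun i => b.cartanMatrix ⟨j, hj⟩ i) (fun i => ?_) x hx,
      Finset.prod_map_toList, ht]
    have := (LieAlgebra.IsKilling.rootSystem H).algebraMap_pairingIn ℤ j (i : H.root)
    rw [LieAlgebra.IsKilling.rootSystem_pairing_apply] at this
    exact this.symm
  have hstep : ∀ i j : H.root, (∀ x ∈ rootSpace H i.1, ν' x = x) →
      (∀ x ∈ rootSpace H j.1, ν' x = x) → ∀ x ∈ rootSpace H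
        ((LieAlgebra.IsKilling.rootSystem H).reflectionPerm i j).1, ν' x = x := by
    intro i j hi hj x hx
    refine fix_step H hν'l hν'H i hi j.1 hj x ?_
    convert hx using 2
    funext y
    have h1 := (LieAlgebra.IsKilling.rootSystem H).root_reflectionPerm i j
    have h2 := congrArg (fun F : Dual k H => F y) h1
    rw [RootPairing.reflection_apply] at h2
    simp only [LieAlgebra.IsKilling.rootSystem_root_apply, LinearMap.sub_apply,
      LinearMap.smul_apply] at h2
    refine Eq.trans ?_ h2.symm
    change LieModule.Weight.toLinear k H g j.1 (y - i.1 y • LieAlgebra.IsKilling.coroot i.1) = _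
    rw [map_sub, map_smul]
    simp [mul_comm]
  have hall : ∀ i : H.root, ∀ x ∈ rootSpace H i.1, ν' x = x := fun i =>
    b.induction_reflect i (p := fun i => ∀ x ∈ rootSpace H i.1, ν' x = x)
      (fun i hi => hstep i i hi hi) hsimple (fun i j hi hj => hstep j i (hsimple j hj) hi)
  have h1 : ν' = 1 := by
    ext x
    refine g_ind H (P := fun x => ν' x = x) (map_zero _)
      (fun x y hx hy => by rw [map_add, hx, hy]) (fun χ x hx => ?_) x
    by_cases hχ : χ.IsZero
    · have h3 : x ∈ rootSpace H (0 : H → k) := by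
        have : (χ : H → k) = 0 := hχ
        rw [← this]; exact hx
      rw [rootSpace_zero_eq] at h3
      exact hν'H ⟨x, by simpa using h3⟩
    · exact hall ⟨χ, by simpa using hχ⟩ x hx
  have h2 : ν = T := by
    rw [hν', inv_mul_eq_one] at h1
    exact h1.symm
  rw [h2]; exact hT

theorem fix_regular (H : LieSubalgebra k g) [H.IsCartanSubalgebra] {ν : g ≃ₗ[k] g}
    (hν : ∀ x y, ν ⁅x, y⁆ = ⁅ν x, ν y⁆) (h : H) (hh : ν h = h)
    (h0 : ∀ i : H.root, i.1 h ≠ 0) (hne : ∀ i j : H.root, i ≠ j → i.1 h ≠ j.1 h) (x : H) :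
    ν x = x := by
  classical
  obtain ⟨e, E, he, he0, hE⟩ := exists_decomp H
  have hab : ∀ x y : H, ⁅(x : g), (y : g)⁆ = 0 := fun x y => by
    have := LieModule.IsTrivial.trivial (L := H) (M := H) x y
    exact congrArg Subtype.val this
  have eig : ∀ (c : k) (x : H) (s : H.root → k), ⁅(h : g), E (x, s)⁆ = c • E (x, s) →
      c • x = 0 ∧ ∀ i, s i * (i.1 h - c) = 0 := by
    intro c x s hcx
    have h1 : ⁅(h : g), E (x, s)⁆ = E (0, fun i => i.1 h * s i) := by
      rw [hE, hE, lie_add, hab, lie_sum]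
      congr 1
      refine Finset.sum_congr rfl fun i _ => ?_
      rw [lie_smul, mul_comm, mul_smul]
      congr 1
      exact LieAlgebra.IsKilling.lie_eq_smul_of_mem_rootSpace (he i) h
    rw [h1, ← map_smul] at hcx
    have h2 := E.injective hcx
    rw [Prod.smul_mk, Prod.mk.injEq] at h2
    refine ⟨h2.1.symm, fun i => ?_⟩
    have := congrFun h2.2 i
    simp only [Pi.smul_apply, smul_eq_mul] at this
    linear_combination this
  have hEs : ∀ y, E ((E.symm y).1, (E.symm y).2) = y := fun y => by simp
  have hmem : ∃ y : H, ν x = y := by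
    have h1 := eig 0 (E.symm (ν x)).1 (E.symm (ν x)).2 (by
      rw [hEs, zero_smul, ← hh, ← hν, hab, map_zero])
    refine ⟨(E.symm (ν x)).1, ?_⟩
    have h2 : (E.symm (ν x)).2 = 0 := by
      funext i
      have := h1.2 i
      rw [sub_zero] at this
      exact (mul_eq_zero.1 this).resolve_right (h0 i)
    have h3 := hEs (ν x)
    rw [h2, hE] at h3
    simpa using h3.symm
  obtain ⟨y, hy⟩ := hmem
  rw [hy]
  congr 1
  refine eq_of_roots H fun j => ?_
  have h1 := eig (j.1 h) (E.symm (ν (e j))).1 (E.symm (ν (e j))).2 (by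
    rw [hEs]
    nth_rewrite 1 [← hh]
    rw [← hν, ← map_smul]
    exact congrArg ν (LieAlgebra.IsKilling.lie_eq_smul_of_mem_rootSpace (he j) h))
  have h2 : ν (e j) = (E.symm (ν (e j))).2 j • e j := by
    have h3 := hEs (ν (e j))
    rw [hE, (smul_eq_zero.1 h1.1).resolve_left (h0 j), Finset.sum_eq_single j] at h3
    · simpa using h3.symm
    · intro i _ hij
      rw [(mul_eq_zero.1 (h1.2 i)).resolve_right (sub_ne_zero.2 (hne i j hij)), zero_smul]
    · simp
  have hνe0 : ν (e j) ≠ 0 := fun h => he0 j (ν.injective (by rw [h, map_zero]))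
  have h4 : ν (e j) ∈ rootSpace H j.1 := by
    rw [h2]; exact (rootSpace H j.1).smul_mem _ (he j)
  have h5 : ⁅(y : g), ν (e j)⁆ = j.1 y • ν (e j) :=
    LieAlgebra.IsKilling.lie_eq_smul_of_mem_rootSpace h4 y
  have h6 : ⁅(y : g), ν (e j)⁆ = j.1 x • ν (e j) := by
    rw [← hy, ← hν, ← map_smul]
    exact congrArg ν (LieAlgebra.IsKilling.lie_eq_smul_of_mem_rootSpace (he j) x)
  exact smul_left_injective k hνe0 (h5.symm.trans h6)

theorem inner_main (μ : g ≃ₗ[k] g) (hb : ∀ x y : g, μ ⁅x, y⁆ = ⁅μ x, μ y⁆)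
    (hinv : ∀ F : g → k, IsPolyFun k g F →
      (∀ τ ∈ IntG k g, ∀ x : g, F (τ x) = F x) → ∀ x : g, F (μ x) = F x) :
    μ ∈ IntG k g := by
  classical
  obtain ⟨H, hH⟩ : ∃ H : LieSubalgebra k g, H.IsCartanSubalgebra := by
    obtain ⟨x, hx⟩ := LieAlgebra.exists_isCartanSubalgebra_engel k g
    exact ⟨_, hx⟩
  obtain ⟨pr, φ, b, hb0, hφ, hpr, hτ, hsep⟩ := separation H
  -- the composite with `μ`
  let bμ : polyFun k g := ⟨fun x => b.1 (μ x), polyFun_comp b.2 (IsPolyMap.linear μ.toLinearMap)⟩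
  have hbμ : bμ ≠ 0 := by
    intro h
    apply hb0
    apply Subtype.ext
    funext x
    have := congrFun (congrArg Subtype.val h) (μ.symm x)
    change b.1 (μ (μ.symm x)) = 0 at this
    rw [LinearEquiv.apply_symm_apply] at this
    exact this
  have hne_of : ∀ F : polyFun k g, F ≠ 0 → ∃ x, F.1 x ≠ 0 := by
    intro F hF
    by_contra! hcon
    exact hF (Subtype.ext (funext hcon))
  obtain ⟨x0, hx0⟩ := hne_of _ (mul_ne_zero hb0 hbμ)
  have hx0b : b.1 x0 ≠ 0 := fun h => hx0 (by
    change b.1 x0 * bμ.1 x0 = 0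
    rw [h, zero_mul])
  obtain ⟨v0, hv0⟩ := (hsep x0 hx0b).1
  let B : polyFun k g := pbk φ hφ (b * bμ)
  have hB : B ≠ 0 := by
    intro h
    apply hx0
    have := congrFun (congrArg Subtype.val h) v0
    change (b * bμ).1 (φ v0) = 0 at this
    rwa [hv0] at this
  let R0 : H.root → polyFun k g := fun i =>
    ⟨fun v => LieModule.Weight.toLinear k H g i.1 (pr v),
      dual_mem_polyFun (LieModule.Weight.toLinear k H g i.1 ∘ₗ pr)⟩
  have hR0 : ∀ i, R0 i ≠ 0 := by
    intro i h
    apply LieSubalgebra.isNonZero_coe_root i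
    funext y
    obtain ⟨v, rfl⟩ := hpr y
    exact congrFun (congrArg Subtype.val h) v
  have hR1 : ∀ p : H.root × H.root, p.1 ≠ p.2 → R0 p.1 - R0 p.2 ≠ 0 := by
    intro p hp h
    apply hp
    apply Subtype.ext
    apply DFunLike.coe_injective
    funext y
    obtain ⟨v, rfl⟩ := hpr y
    have := congrFun (congrArg Subtype.val (sub_eq_zero.1 h)) v
    exact this
  have hprod : B * ((∏ i, R0 i) * ∏ p ∈ Finset.univ.filter (fun p : H.root × H.root => p.1 ≠ p.2),
      (R0 p.1 - R0 p.2)) ≠ 0 := by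
    refine mul_ne_zero hB (mul_ne_zero (Finset.prod_ne_zero_iff.2 fun i _ => hR0 i)
      (Finset.prod_ne_zero_iff.2 fun p hp => hR1 p ?_))
    exact (Finset.mem_filter.1 hp).2
  obtain ⟨v, hv⟩ := hne_of _ hprod
  rw [← evp_apply, map_mul, map_mul, map_prod, map_prod] at hv
  have hvB : evp v B ≠ 0 := left_ne_zero_of_mul hv
  have hvR := right_ne_zero_of_mul hv
  have hv0 := Finset.prod_ne_zero_iff.1 (left_ne_zero_of_mul hvR)
  have hv1 := Finset.prod_ne_zero_iff.1 (right_ne_zero_of_mul hvR)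
  have hBb : b.1 (φ v) * b.1 (μ (φ v)) ≠ 0 := hvB
  obtain ⟨τ, hτG, hτv⟩ := hτ v
  obtain ⟨τ1, hτ1, hμ⟩ := (hsep (φ v) (left_ne_zero_of_mul hBb)).2 (μ (φ v))
    (right_ne_zero_of_mul hBb) (fun F hF hFi => hinv F (isPolyFun_of_mem hF) hFi (φ v))
  set ν := τ⁻¹ * τ1⁻¹ * μ * τ with hνdef
  have hνl : ∀ x y, ν ⁅x, y⁆ = ⁅ν x, ν y⁆ := by
    intro x y
    change τ⁻¹ (τ1⁻¹ (μ (τ ⁅x, y⁆))) = ⁅τ⁻¹ (τ1⁻¹ (μ (τ x))), τ⁻¹ (τ1⁻¹ (μ (τ y)))⁆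
    rw [IntG_lie hτG, hb, IntG_lie (inv_mem hτ1), IntG_lie (inv_mem hτG)]
  have hνh : ν (pr v : g) = pr v := by
    change τ.symm (τ1.symm (μ (τ (pr v)))) = _
    rw [LinearEquiv.symm_apply_eq, LinearEquiv.symm_apply_eq, ← hτv, hμ]
  have hνG : ν ∈ IntG k g := by
    refine torus_inner H hνl (fix_regular H hνl (pr v) hνh (fun i => hv0 i (Finset.mem_univ _))
      (fun i j hij => ?_))
    have := hv1 (i, j) (by simp [hij])
    rw [map_sub] at this
    exact sub_ne_zero.1 this
  have : μ = τ1 * τ * ν * τ⁻¹ := by rw [hνdef]; group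
  rw [this]
  exact mul_mem (mul_mem (mul_mem hτ1 hτG) hνG) (inv_mem hτG)

end Final

theorem inner_of_trivial_on_invariants
    (μ : g ≃ₗ[k] g) (hb : ∀ x y : g, μ ⁅x, y⁆ = ⁅μ x, μ y⁆)
    (hfin : IsOfFinOrder μ)
    (hinv : ∀ F : g → k, IsPolyFun k g F →
      (∀ τ ∈ IntG k g, ∀ x : g, F (τ x) = F x) → ∀ x : g, F (μ x) = F x) :
    μ ∈ IntG k g := by
  exact inner_main μ hb hinv
end

section
/- Assume g ≠ 0. For every integer m ≥ 1 and every primitive m-th root of unity ζ ∈ k, there exists an inner automorphism θ ∈ Int g of order exactly m such that the ζ-eigenspace g_1 = {x ∈ g : θ(x) = ζx} contains a regular nilpotent element of g. (This is the inner case of Antonyan's theorem: every connected component of Aut g containing elements of order m contains an N-regular automorphism of order m.) -/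
open LieAlgebra Module

variable (k : Type*) [Field k] [IsAlgClosed k] [CharZero k]
variable (g : Type*) [LieRing g] [LieAlgebra k g] [FiniteDimensional k g]
  [LieAlgebra.IsSemisimple k g]

set_option linter.unusedSectionVars false

section helpers

variable {k g}

/-- Functional calculus for an endomorphism with integral eigenvalues. -/
lemma aux_exists_calc {V : Type*} [AddCommGroup V] [Module k V] [FiniteDimensional k V]
    (T : Module.End k V) :
    ∃ Φ : (ℤ → k) → Module.End k V, ∀ φ (j : ℤ) x, x ∈ T.eigenspace (j : k) →
      Φ φ x = φ j • x := by
  classical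
  have hfin : {j : ℤ | T.HasEigenvalue (j : k)}.Finite := by
    have := T.finite_hasEigenvalue
    exact this.preimage (Int.cast_injective.injOn)
  refine ⟨fun φ => Polynomial.aeval T (Lagrange.interpolate hfin.toFinset (fun j : ℤ => (j : k)) φ),
    fun φ j x hx => ?_⟩
  by_cases h0 : x = 0
  · simp [h0]
  have hv : T.HasEigenvector (j : k) x := ⟨hx, h0⟩
  rw [Module.End.aeval_apply_of_hasEigenvector hv,
    Lagrange.eval_interpolate_at_node _ (Int.cast_injective.injOn)]
  simpa using Module.End.hasEigenvalue_of_hasEigenvector hv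

lemma aux_ext {V W : Type*} [AddCommGroup V] [Module k V] [AddCommGroup W] [Module k W]
    {T : Module.End k V} (hT : ⨆ j : ℤ, T.eigenspace (j : k) = ⊤)
    {A B : V →ₗ[k] W} (h : ∀ (j : ℤ) x, x ∈ T.eigenspace (j : k) → A x = B x) : A = B := by
  ext x
  have hx : x ∈ ⨆ j : ℤ, T.eigenspace (j : k) := hT ▸ Submodule.mem_top
  induction hx using Submodule.iSup_induction' with
  | mem j x hx => exact h j x hx
  | zero => simp
  | add x y _ _ hx hy => simp [hx, hy]

lemma aux_pow_finrank {V : Type*} [AddCommGroup V] [Module k V] [FiniteDimensional k V]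
    {T : Module.End k V} (hT : IsNilpotent T) : T ^ finrank k V = 0 := by
  have := T.aeval_self_charpoly
  rwa [IsNilpotent.charpoly_eq_X_pow_finrank hT, map_pow, Polynomial.aeval_X] at this

lemma aux_exp_apply {n x : g} (hn : IsNilpotent (LieAlgebra.ad k g n))
    (hx : ⁅n, ⁅n, ⁅n, x⁆⁆⁆ = 0) :
    expEnd k g (LieAlgebra.ad k g n) x = x + ⁅n, x⁆ + (2 : k)⁻¹ • ⁅n, ⁅n, x⁆⁆ := by
  have h0 : (LieAlgebra.ad k g n) ^ (finrank k g) = 0 :=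
    aux_pow_finrank hn
  have e1 : expEnd k g (LieAlgebra.ad k g n) =
      ∑ i ∈ Finset.range (finrank k g + 3), ((i.factorial : k))⁻¹ • (LieAlgebra.ad k g n) ^ i := by
    unfold expEnd
    refine Finset.sum_subset (by intro i; simp; omega) fun i _ hi => ?_
    rw [pow_eq_zero_of_le (by simp at hi; omega) h0, smul_zero]
  have h3 : ((LieAlgebra.ad k g n) ^ 3) x = 0 := by simpa [pow_succ'] using hx
  rw [e1, LinearMap.sum_apply, ← Finset.sum_subset (s₁ := Finset.range 3)]
  · simp [Finset.sum_range_succ, pow_succ']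
  · intro i; simp; omega
  · intro i _ hi
    obtain ⟨j, rfl⟩ : ∃ j, i = j + 3 := ⟨i - 3, by simp at hi; omega⟩
    simp [pow_add, h3]

lemma aux_exp_equiv {n : g} (hn : IsNilpotent (LieAlgebra.ad k g n)) :
    ∃ τ : g ≃ₗ[k] g, τ ∈ IntG k g ∧ (τ : g →ₗ[k] g) = expEnd k g (LieAlgebra.ad k g n) ∧
      ∀ x y, τ ⁅x, y⁆ = ⁅τ x, τ y⁆ := by
  let _ : Module ℚ g := Module.compHom g (algebraMap ℚ k)
  have _ : IsScalarTower ℚ k g := IsScalarTower.of_algebraMap_smul fun r x => rfl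
  let _ : LieAlgebra ℚ g := { lie_smul := fun t x y => lie_smul (algebraMap ℚ k t) x y }
  have hA : (LieDerivation.ad k g n).toLinearMap = LieAlgebra.ad k g n := by
    ext x; simp
  have hD : IsNilpotent (LieDerivation.ad k g n).toLinearMap := hA ▸ hn
  let τ := LieDerivation.exp (LieDerivation.ad k g n) hD
  have h0 : (LieAlgebra.ad k g n) ^ (finrank k g + 1) = 0 :=
    pow_eq_zero_of_le (Nat.le_succ _) (aux_pow_finrank hn)
  have hτ : (τ.toLinearEquiv : g →ₗ[k] g) = expEnd k g (LieAlgebra.ad k g n) := by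
    ext x
    have : τ x = IsNilpotent.exp (LieDerivation.ad k g n).toLinearMap x :=
      LieDerivation.exp_map_apply _ hD x
    change τ x = _
    rw [this, hA, IsNilpotent.exp_eq_sum h0]
    unfold expEnd
    simp only [LinearMap.sum_apply, LinearMap.smul_apply]
    exact Finset.sum_congr rfl fun i _ => inv_natCast_smul_eq ℚ k _ _
  exact ⟨τ.toLinearEquiv, Subgroup.subset_closure ⟨n, hn, hτ⟩, hτ, fun x y => τ.map_lie x y⟩


lemma aux_nil {V : Type*} [AddCommGroup V] [Module k V] [FiniteDimensional k V]
    {T A : Module.End k V} (hT : ⨆ j : ℤ, T.eigenspace (j : k) = ⊤) (c : ℤ) (hc : c ≠ 0)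
    (hA : ∀ (j : ℤ) x, x ∈ T.eigenspace (j : k) → A x ∈ T.eigenspace ((j + c : ℤ) : k)) :
    IsNilpotent A := by
  have hfin : {j : ℤ | T.HasEigenvalue (j : k)}.Finite :=
    T.finite_hasEigenvalue.preimage (Int.cast_injective.injOn)
  obtain ⟨M, hM⟩ : ∃ M : ℕ, ∀ j : ℤ, T.HasEigenvalue (j : k) → |j| ≤ M := by
    obtain ⟨M, hM⟩ := (hfin.image (fun j => j.natAbs)).bddAbove
    refine ⟨M, fun j hj => ?_⟩
    have := hM ⟨j, hj, rfl⟩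
    simp only at this
    rw [Int.abs_eq_natAbs]
    exact_mod_cast this
  have hpow : ∀ (n : ℕ) (j : ℤ) x, x ∈ T.eigenspace (j : k) →
      (A ^ n) x ∈ T.eigenspace ((j + n * c : ℤ) : k) := by
    intro n
    induction n with
    | zero => intro j x hx; simpa using hx
    | succ n ih =>
      intro j x hx
      have := hA _ _ (ih j x hx)
      rw [pow_succ', Module.End.mul_apply]
      convert this using 3
      push_cast; ring
  refine ⟨2 * M + 1, aux_ext hT fun j x hx => ?_⟩
  by_contra hne
  have hx0 : x ≠ 0 := by rintro rfl; simp at hne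
  have h1 := hM j (Module.End.hasEigenvalue_of_hasEigenvector ⟨hx, hx0⟩)
  have h2 := hM _ (Module.End.hasEigenvalue_of_hasEigenvector
    ⟨hpow (2 * M + 1) j x hx, by simpa using hne⟩)
  have h3 : |((2 * M + 1 : ℕ) : ℤ) * c| ≤ 2 * M := by
    calc |((2 * M + 1 : ℕ) : ℤ) * c| = |(j + ((2 * M + 1 : ℕ) : ℤ) * c) - j| := by ring_nf
      _ ≤ _ := (abs_sub _ _).trans (by linarith)
  rw [abs_mul] at h3
  have h4 : 1 ≤ |c| := Int.one_le_abs hc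
  have h5 : |((2 * M + 1 : ℕ) : ℤ)| = 2 * M + 1 := by rw [abs_of_nonneg] <;> push_cast <;> omega
  rw [h5] at h3
  nlinarith

lemma aux_finrank {V : Type*} [AddCommGroup V] [Module k V] [FiniteDimensional k V]
    (f : Module.End k V) (B N : Submodule k V) (h1 : LinearMap.ker f ≤ B)
    (h2 : B.map f = N) : finrank k N + finrank k (LinearMap.ker f) = finrank k B := by
  have := (f.domRestrict B).finrank_range_add_finrank_ker
  rw [LinearMap.range_domRestrict, h2, LinearMap.ker_domRestrict] at this
  rw [← this, (Submodule.comapSubtypeEquivOfLe h1).finrank_eq]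

lemma aux_mem {h0 x : g} {c : k} :
    x ∈ (LieAlgebra.ad k g h0).eigenspace c ↔ ⁅h0, x⁆ = c • x := by
  simp

lemma aux_shift {h0 e : g} {c : ℤ} (he : ⁅h0, e⁆ = (c : k) • e) (j : ℤ) (x : g)
    (hx : x ∈ (LieAlgebra.ad k g h0).eigenspace (j : k)) :
    ⁅e, x⁆ ∈ (LieAlgebra.ad k g h0).eigenspace ((j + c : ℤ) : k) := by
  rw [aux_mem] at hx ⊢
  rw [leibniz_lie, he, hx, smul_lie, lie_smul, ← add_smul]
  push_cast
  rw [add_comm]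

lemma aux_dim {h0 e f : g} (he : ⁅h0, e⁆ = e) (hf : ⁅h0, f⁆ = -f) (hef : ⁅e, f⁆ = (2 : k) • h0)
    (hT : ⨆ j : ℤ, (LieAlgebra.ad k g h0).eigenspace (j : k) = ⊤) (h0ne : h0 ≠ 0) :
    finrank k (zc k g e) = finrank k ((LieAlgebra.ad k g h0).eigenspace 0) := by
  classical
  set T := LieAlgebra.ad k g h0 with hTdef
  set A := LieAlgebra.ad k g e with hAdef
  obtain ⟨Φ, hΦ⟩ := aux_exists_calc T
  have hA : ∀ (j : ℤ) x, x ∈ T.eigenspace (j : k) → A x ∈ T.eigenspace ((j + 1 : ℤ) : k) :=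
    fun j x hx => aux_shift (by simpa using he) j x hx
  have hΦA : ∀ φ : ℤ → k, Φ φ ∘ₗ A = A ∘ₗ Φ (fun j => φ (j + 1)) := fun φ =>
    aux_ext hT fun j x hx => by
      rw [LinearMap.comp_apply, LinearMap.comp_apply, hΦ _ _ _ (hA j x hx), hΦ _ _ _ hx, map_smul]
  have hΦmul : ∀ φ ψ : ℤ → k, Φ φ ∘ₗ Φ ψ = Φ (φ * ψ) := fun φ ψ =>
    aux_ext hT fun j x hx => by
      rw [LinearMap.comp_apply, hΦ _ _ _ hx, map_smul, hΦ _ _ _ hx, hΦ _ _ _ hx, smul_smul,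
        Pi.mul_apply, mul_comm]
  have hΦmem : ∀ (j : ℤ) x, Φ (Pi.single j 1) x ∈ T.eigenspace (j : k) := by
    intro j x
    rw [Module.End.mem_eigenspace_iff]
    refine LinearMap.congr_fun (f := T ∘ₗ Φ (Pi.single j 1)) (g := (j : k) • Φ (Pi.single j 1))
      (aux_ext hT fun i y hy => ?_) x
    rw [LinearMap.comp_apply, LinearMap.smul_apply, hΦ _ _ _ hy, map_smul,
      Module.End.mem_eigenspace_iff.mp hy]
    by_cases hij : i = j
    · subst hij; simp
    · simp [hij]
  have hΦall : ∀ y, (∀ j, Φ (Pi.single j 1) y = 0) → y = 0 := by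
    intro y hy
    have hfin : {j : ℤ | T.HasEigenvalue (j : k)}.Finite :=
      T.finite_hasEigenvalue.preimage (Int.cast_injective.injOn)
    have : (LinearMap.id : g →ₗ[k] g) = ∑ j ∈ hfin.toFinset, Φ (Pi.single j 1) :=
      aux_ext hT fun i x hx => by
        by_cases hx0 : x = 0
        · simp [hx0]
        have hi : T.HasEigenvalue (i : k) := Module.End.hasEigenvalue_of_hasEigenvector ⟨hx, hx0⟩
        rw [LinearMap.sum_apply, Finset.sum_eq_single i]
        · rw [hΦ _ _ _ hx]; simp
        · intro j _ hj; rw [hΦ _ _ _ hx]; simp [hj.symm]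
        · intro h; simp [hi] at h
    have := LinearMap.congr_fun this y
    simpa [LinearMap.sum_apply, hy] using this
  -- kernel of `A` has no negative part
  have ht : IsSl2Triple ((2 : k) • h0) e f :=
    { h_ne_zero := by simpa using h0ne
      lie_e_f := hef
      lie_h_e_nsmul := by rw [smul_lie, he, two_smul, two_nsmul]
      lie_h_f_nsmul := by rw [smul_lie, hf, two_smul, two_nsmul, neg_add] }
  have hneg : ∀ j : ℤ, j < 0 → ∀ x ∈ T.eigenspace (j : k), A x = 0 → x = 0 := by
    intro j hj x hx hAx
    by_contra hx0
    have P : ht.HasPrimitiveVectorWith x (2 * j : k) :=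
      { ne_zero := hx0
        lie_h := by rw [smul_lie, aux_mem.mp hx, smul_smul]
        lie_e := hAx }
    obtain ⟨n, hn⟩ := P.exists_nat
    have : (2 * j : ℤ) = n := by exact_mod_cast hn
    omega
  let χ : ℤ → k := fun j => if 1 ≤ j then 1 else 0
  let ψ : ℤ → k := fun j => if 0 ≤ j then 1 else 0
  have hψA : Φ χ ∘ₗ A = A ∘ₗ Φ ψ := by
    rw [hΦA]
    congr 2
    funext j
    simp only [χ, ψ]
    congr 1
    apply propext; constructor <;> intro <;> omega
  have hQ : ∀ x, Φ χ (A x) = A x → Φ ψ x = x := by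
    intro x hx
    have h1 : A (x - Φ ψ x) = 0 := by
      rw [map_sub, sub_eq_zero, ← LinearMap.comp_apply A, ← hψA, LinearMap.comp_apply, hx]
    refine (sub_eq_zero.mp (hΦall _ fun j => ?_)).symm
    by_cases hj : j < 0
    · refine hneg j hj _ (hΦmem _ _) ?_
      have h2 := LinearMap.congr_fun (hΦA (Pi.single (j + 1) 1)) (x - Φ ψ x)
      rw [LinearMap.comp_apply, LinearMap.comp_apply, h1, map_zero] at h2
      rw [h2]
      congr 3
      funext i
      simp [Pi.single_apply]
    · rw [map_sub, ← LinearMap.comp_apply (Φ _), hΦmul, sub_eq_zero]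
      congr 2
      funext i
      by_cases hij : i = j
      · subst hij; simp [ψ]; omega
      · simp [hij]
  have hker : LinearMap.ker A ≤ LinearMap.range (Φ ψ) := by
    intro x hx
    have hx' : A x = 0 := hx
    exact ⟨x, hQ x (by simp [hx'])⟩
  have hχψ : ∀ x, Φ ψ (Φ χ x) = Φ χ x := fun x => by
    rw [← LinearMap.comp_apply, hΦmul]
    congr 2; funext i; simp only [Pi.mul_apply, χ, ψ]; split_ifs <;> first | omega | simp
  have hχχ : ∀ x, Φ χ (Φ χ x) = Φ χ x := fun x => by
    rw [← LinearMap.comp_apply, hΦmul]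
    congr 2; funext i; simp only [Pi.mul_apply, χ]; split_ifs <;> simp
  have hψψ : ∀ x, Φ ψ (Φ ψ x) = Φ ψ x := fun x => by
    rw [← LinearMap.comp_apply, hΦmul]
    congr 2; funext i; simp only [Pi.mul_apply, ψ]; split_ifs <;> simp
  -- the range of `A` contains the positive part
  let κ := killingForm k g
  have hκT : ∀ (z x y : g), κ ⁅z, x⁆ y = - κ x ⁅z, y⁆ := fun z x y => by
    have := LieModule.traceForm_apply_lie_apply' k g g z x y
    exact this
  have hκ0 : ∀ (i j : ℤ) (x y : g), i + j ≠ 0 → x ∈ T.eigenspace (i : k) →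
      y ∈ T.eigenspace (j : k) → κ x y = 0 := by
    intro i j x y hij hx hy
    have := hκT h0 x y
    rw [aux_mem.mp hx, aux_mem.mp hy, map_smul, map_smul, LinearMap.smul_apply, smul_eq_mul,
      smul_eq_mul] at this
    have h2 : ((i + j : ℤ) : k) * κ x y = 0 := by push_cast; linear_combination this
    rcases mul_eq_zero.mp h2 with h3 | h3
    · exact absurd (by exact_mod_cast h3) hij
    · exact h3
  have hκ1 : ∀ x y, κ (Φ χ x) (Φ ψ y) = 0 := by
    intro x y
    have : (κ ∘ₗ Φ χ).compl₂ (Φ ψ) = 0 := by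
      refine aux_ext hT fun i x hx => aux_ext hT fun j y hy => ?_
      simp only [LinearMap.compl₂_apply, LinearMap.comp_apply, LinearMap.zero_apply]
      rw [hΦ _ _ _ hx, hΦ _ _ _ hy]
      simp only [χ, ψ]
      split_ifs <;> simp
      exact hκ0 i j x y (by omega) hx hy
    simpa using LinearMap.congr_fun (LinearMap.congr_fun this x) y
  have hnd : κ.Nondegenerate := LieAlgebra.IsKilling.killingForm_nondegenerate k g
  have hsymm : LinearMap.IsSymm κ := LieModule.traceForm_isSymm k g g
  have hrange : LinearMap.range (Φ χ) ≤ LinearMap.range A := by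
    have e1 : LinearMap.BilinForm.orthogonal κ (LinearMap.range A) ≤ LinearMap.ker A := by
      intro x hx
      rw [LinearMap.BilinForm.mem_orthogonal_iff] at hx
      rw [LinearMap.mem_ker]
      refine hnd.2 _ fun y => ?_
      have := hx (A y) ⟨y, rfl⟩
      have h2 := hκT e y x
      change κ (A y) x = 0 at this
      change κ (A y) x = - κ y (A x) at h2
      rw [this] at h2
      simpa using h2.symm
    rw [← LinearMap.BilinForm.orthogonal_orthogonal hnd hsymm.isRefl (LinearMap.range A)]
    rintro _ ⟨x, rfl⟩
    rw [LinearMap.BilinForm.mem_orthogonal_iff]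
    intro y hy
    obtain ⟨z, rfl⟩ := hker (e1 hy)
    change κ (Φ ψ z) (Φ χ x) = 0
    have h3 := hsymm.eq (Φ ψ z) (Φ χ x)
    rw [hκ1] at h3
    simpa using h3
  have hmapA : (LinearMap.range (Φ ψ)).map A = LinearMap.range (Φ χ) := by
    apply le_antisymm
    · rintro _ ⟨_, ⟨x, rfl⟩, rfl⟩
      exact ⟨A x, LinearMap.congr_fun hψA x⟩
    · rintro y ⟨z, rfl⟩
      obtain ⟨x, hx⟩ := hrange ⟨z, rfl⟩
      exact ⟨x, ⟨x, hQ x (by rw [hx, hχχ])⟩, hx⟩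
  let ω : ℤ → k := fun j => if j = 0 then 0 else 1
  have hω : ∀ x, x = Φ ω x + Φ (Pi.single 0 1) x := fun x => by
    refine LinearMap.congr_fun (f := LinearMap.id) (g := Φ ω + Φ (Pi.single 0 1))
      (aux_ext hT fun i y hy => ?_) x
    rw [LinearMap.add_apply, hΦ _ _ _ hy, hΦ _ _ _ hy]
    by_cases hi : i = 0 <;> simp [hi, ω]
  have hkerω : LinearMap.ker (Φ ω) = T.eigenspace 0 := by
    apply le_antisymm
    · intro x hx
      have := hω x
      rw [LinearMap.mem_ker.mp hx, zero_add] at this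
      rw [this]
      simpa using hΦmem 0 x
    · intro x hx
      rw [LinearMap.mem_ker, hΦ ω 0 x (by simpa using hx)]
      simp [ω]
  have hωψ : ∀ x, Φ ω (Φ ψ x) = Φ χ x := fun x => by
    rw [← LinearMap.comp_apply, hΦmul]
    congr 2; funext i; simp only [Pi.mul_apply, χ, ψ, ω]; split_ifs <;> first | omega | simp
  have hmapω : (LinearMap.range (Φ ψ)).map (Φ ω) = LinearMap.range (Φ χ) := by
    apply le_antisymm
    · rintro _ ⟨_, ⟨x, rfl⟩, rfl⟩
      exact ⟨x, (hωψ x).symm⟩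
    · rintro y ⟨z, rfl⟩
      exact ⟨_, ⟨z, rfl⟩, hωψ z⟩
  have hkerω' : LinearMap.ker (Φ ω) ≤ LinearMap.range (Φ ψ) := by
    rw [hkerω]
    intro x hx
    exact ⟨x, by rw [hΦ ψ 0 x (by simpa using hx)]; simp [ψ]⟩
  have r1 := aux_finrank A _ _ hker hmapA
  have r2 := aux_finrank (Φ ω) _ _ hkerω' hmapω
  rw [hkerω] at r2
  change finrank k (LinearMap.ker A) = _
  omega

lemma aux_main {h0 e f : g} (he : ⁅h0, e⁆ = e) (hf : ⁅h0, f⁆ = -f) (hef : ⁅e, f⁆ = (2 : k) • h0)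
    (hT : ⨆ j : ℤ, (LieAlgebra.ad k g h0).eigenspace (j : k) = ⊤) (h0ne : h0 ≠ 0)
    (m : ℕ) (hm : 1 ≤ m) (ζ : k) (hζ : IsPrimitiveRoot ζ m) :
    ∃ θ : g ≃ₗ[k] g, θ ∈ IntG k g ∧ orderOf θ = m ∧
      e ∈ Module.End.eigenspace (θ : g →ₗ[k] g) ζ ∧ IsNilpotent (LieAlgebra.ad k g e) := by
  have hE : IsNilpotent (LieAlgebra.ad k g e) :=
    aux_nil hT 1 one_ne_zero fun j x hx => aux_shift (by simpa using he) j x hx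
  have hF : IsNilpotent (LieAlgebra.ad k g f) :=
    aux_nil hT (-1) (by norm_num) fun j x hx => aux_shift (by simpa using hf) j x hx
  have hF' : IsNilpotent (LieAlgebra.ad k g (-f)) := by rw [map_neg]; exact hF.neg
  have hene : e ≠ 0 := by
    rintro rfl
    rw [zero_lie] at hef
    exact h0ne ((smul_eq_zero.mp hef.symm).resolve_left two_ne_zero)
  set T := LieAlgebra.ad k g h0 with hTdef
  obtain ⟨Φ, hΦ⟩ := aux_exists_calc T
  have hΦmul : ∀ φ ψ : ℤ → k, Φ φ ∘ₗ Φ ψ = Φ (φ * ψ) := fun φ ψ =>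
    aux_ext hT fun j x hx => by
      rw [LinearMap.comp_apply, hΦ _ _ _ hx, map_smul, hΦ _ _ _ hx, hΦ _ _ _ hx, smul_smul,
        Pi.mul_apply, mul_comm]
  have hΦone : Φ 1 = LinearMap.id := aux_ext hT fun j x hx => by
    rw [hΦ _ _ _ hx]; simp
  -- the diagonal automorphisms
  have hD : ∀ s : k, s ≠ 0 → ∃ D : g ≃ₗ[k] g, ∀ (j : ℤ) x, x ∈ T.eigenspace (j : k) →
      D x = s ^ j • x := by
    intro s hs
    refine ⟨LinearEquiv.ofLinearMap (Φ fun j => s ^ j) (Φ fun j => s ^ (-j)) ?_ ?_, fun j x hx => ?_⟩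
    · rw [hΦmul, ← hΦone]; congr 1; funext j; simp [mul_inv_cancel₀ (zpow_ne_zero j hs)]
    · rw [hΦmul, ← hΦone]; congr 1; funext j; simp [inv_mul_cancel₀ (zpow_ne_zero j hs)]
    · exact hΦ _ j x hx
  have hζ0 : ζ ≠ 0 := hζ.ne_zero (by omega)
  obtain ⟨η, hη⟩ := IsAlgClosed.exists_pow_nat_eq ζ (n := 2) (by norm_num)
  have hη0 : η ≠ 0 := by rintro rfl; exact hζ0 (by rw [← hη]; simp)
  obtain ⟨D, hDx⟩ := hD η hη0
  have hext : ∀ A B : g ≃ₗ[k] g,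
      (∀ (j : ℤ) x, x ∈ T.eigenspace (j : k) → A x = B x) → A = B := fun A B h =>
    LinearEquiv.toLinearMap_injective (aux_ext hT h)
  -- conjugating exponentials by `D`
  have hconj : ∀ (n : g) (c : ℤ) (τ : g ≃ₗ[k] g), ⁅h0, n⁆ = (c : k) • n → c ≠ 0 →
      (τ : g →ₗ[k] g) = expEnd k g (LieAlgebra.ad k g n) → D * τ * D⁻¹ ∈ IntG k g := by
    intro n c τ hn hc hτ
    have hn' : ⁅h0, η ^ c • n⁆ = (c : k) • (η ^ c • n) := by
      rw [lie_smul, hn, smul_comm]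
    refine Subgroup.subset_closure ⟨η ^ c • n, aux_nil hT c hc fun j x hx =>
      aux_shift hn' j x hx, ?_⟩
    have h1 : (D : g →ₗ[k] g) * LieAlgebra.ad k g n =
        LieAlgebra.ad k g (η ^ c • n) * (D : g →ₗ[k] g) :=
      aux_ext hT fun j x hx => by
        have h2 := aux_shift hn j x hx
        simp only [Module.End.mul_apply, LinearEquiv.coe_coe, LieAlgebra.ad_apply]
        rw [hDx _ _ h2, hDx _ _ hx, smul_lie, lie_smul, smul_smul, add_comm, zpow_add₀ hη0]
    have h3 : ∀ i : ℕ, (D : g →ₗ[k] g) * (LieAlgebra.ad k g n) ^ i =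
        (LieAlgebra.ad k g (η ^ c • n)) ^ i * (D : g →ₗ[k] g) := fun i =>
      (SemiconjBy.pow_right (a := (D : Module.End k g)) h1 i)
    have h4 : (D : g →ₗ[k] g) * expEnd k g (LieAlgebra.ad k g n) =
        expEnd k g (LieAlgebra.ad k g (η ^ c • n)) * (D : g →ₗ[k] g) := by
      unfold expEnd
      rw [Finset.mul_sum, Finset.sum_mul]
      refine Finset.sum_congr rfl fun i _ => ?_
      rw [mul_smul_comm, smul_mul_assoc, h3]
    ext x
    have h5 := LinearMap.congr_fun h4 (D⁻¹ x)
    rw [← hτ] at h5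
    simp only [Module.End.mul_apply, LinearEquiv.coe_coe] at h5
    have h6 : D (D⁻¹ x) = x := D.apply_symm_apply x
    rw [h6] at h5
    exact h5
  obtain ⟨a, ha, haE, haL⟩ := aux_exp_equiv hE
  obtain ⟨b, hb, hbE, hbL⟩ := aux_exp_equiv hF'
  have hee : ⁅e, h0⁆ = -e := by rw [← lie_skew, he]
  have hfh : ⁅f, h0⁆ = f := by rw [← lie_skew, hf, neg_neg]
  have hfe : ⁅f, e⁆ = -((2 : k) • h0) := by rw [← lie_skew, hef]
  have ha' : ∀ x, ⁅e, ⁅e, ⁅e, x⁆⁆⁆ = 0 → a x = x + ⁅e, x⁆ + (2 : k)⁻¹ • ⁅e, ⁅e, x⁆⁆ :=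
    fun x hx => by rw [← aux_exp_apply hE hx, ← haE]; rfl
  have hb' : ∀ x, ⁅-f, ⁅-f, ⁅-f, x⁆⁆⁆ = 0 →
      b x = x + ⁅-f, x⁆ + (2 : k)⁻¹ • ⁅-f, ⁅-f, x⁆⁆ :=
    fun x hx => by rw [← aux_exp_apply hF' hx, ← hbE]; rfl
  have a1 : a h0 = h0 - e := by
    rw [ha' h0 (by simp [hee]), hee]; simp [sub_eq_add_neg]
  have a2 : a e = e := by rw [ha' e (by simp)]; simp
  have b1 : b h0 = h0 - f := by
    rw [hb' h0 (by simp [hfh]), neg_lie, hfh]; simp [sub_eq_add_neg]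
  have b2 : b e = e + (2 : k) • h0 - f := by
    rw [hb' e (by simp [hfe, hfh])]
    simp [hfe, hfh]
    abel
  have w1 : a (b (a h0)) = - h0 := by
    rw [a1, map_sub, b1, b2, show h0 - f - (e + (2 : k) • h0 - f) = - h0 - e by
      rw [two_smul]; abel, map_sub, map_neg, a1, a2]
    abel
  let w : g ≃ₗ[k] g := a * b * a
  have hwapp : ∀ x, w x = a (b (a x)) := fun x => rfl
  have hw : w ∈ IntG k g := mul_mem (mul_mem ha hb) ha
  have hwD : D * w * D⁻¹ ∈ IntG k g := by
    have e1 := hconj e 1 a (by simpa using he) one_ne_zero haE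
    have e2 := hconj (-f) (-1) b (by simp [hf]) (by norm_num) hbE
    have := mul_mem (mul_mem e1 e2) e1
    convert this using 1
    simp only [w]; group
  have hwV : ∀ (j : ℤ) x, x ∈ T.eigenspace (j : k) → w x ∈ T.eigenspace ((-j : ℤ) : k) := by
    intro j x hx
    rw [aux_mem] at hx ⊢
    have h2 : w ⁅h0, x⁆ = ⁅-h0, w x⁆ := by
      rw [← w1, hwapp, hwapp, haL, hbL, haL]
    rw [hx, map_smul, neg_lie] at h2
    rw [← neg_eq_iff_eq_neg.mpr h2]
    push_cast
    rw [neg_smul]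
  have hDw : D * w * D = w := hext _ _ fun j x hx => by
    change D (w (D x)) = w x
    rw [hDx _ _ hx, map_smul, map_smul, hDx _ _ (hwV j x hx), smul_smul, ← zpow_add₀ hη0]
    simp
  have hθ : D * D ∈ IntG k g := by
    have h1 : D * D = D * w * D⁻¹ * w⁻¹ := by
      have : w * D⁻¹ * w⁻¹ = D := by
        nth_rw 1 [← hDw]; group
      calc D * D = D * (w * D⁻¹ * w⁻¹) := by rw [this]
        _ = _ := by group
    rw [h1]
    exact mul_mem hwD (inv_mem hw)
  have hθx : ∀ (j : ℤ) x, x ∈ T.eigenspace (j : k) → (D * D) x = ζ ^ j • x := by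
    intro j x hx
    change D (D x) = _
    rw [hDx _ _ hx, map_smul, hDx _ _ hx, smul_smul, ← mul_zpow, ← hη, pow_two]
  have hθn : ∀ (n : ℕ) (j : ℤ) x, x ∈ T.eigenspace (j : k) →
      ((D * D) ^ n) x = (ζ ^ n) ^ j • x := by
    intro n j x hx
    induction n with
    | zero => simp
    | succ n ih =>
      rw [pow_succ']
      change (D * D) (((D * D) ^ n) x) = _
      rw [ih, map_smul, hθx _ _ hx, smul_smul, ← mul_zpow, pow_succ]
  have heV : e ∈ T.eigenspace ((1 : ℤ) : k) := by rw [aux_mem]; simpa using he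
  refine ⟨D * D, hθ, ?_, ?_, hE⟩
  · apply Nat.dvd_antisymm
    · apply orderOf_dvd_of_pow_eq_one
      refine hext _ _ fun j x hx => ?_
      rw [hθn m j x hx, hζ.pow_eq_one]
      simp
    · apply hζ.dvd_of_pow_eq_one
      have h1 := hθn (orderOf (D * D)) 1 e heV
      rw [pow_orderOf_eq_one, zpow_one] at h1
      have h2 : (ζ ^ orderOf (D * D) - 1) • e = 0 := by
        rw [sub_smul, ← h1]; simp
      exact sub_eq_zero.mp ((smul_eq_zero.mp h2).resolve_right hene)
  · rw [Module.End.mem_eigenspace_iff]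
    simpa using hθx 1 e heV

open LieAlgebra LieAlgebra.IsKilling LieModule in
lemma aux_cartan : ∃ H : LieSubalgebra k g, H.IsCartanSubalgebra ∧
    Module.finrank k H = LieAlgebra.rank k g := by
  have h : (Module.finrank k g : Cardinal) ≤ Cardinal.mk k :=
    (Cardinal.natCast_le_aleph0).trans (Cardinal.infinite_iff.mp inferInstance)
  obtain ⟨x, hx⟩ := LieAlgebra.exists_isRegular_of_finrank_le_card k g h
  have hr := (LieAlgebra.isRegular_iff_finrank_engel_eq_rank k x).mp hx
  refine ⟨LieSubalgebra.engel k x, ⟨?_, LieSubalgebra.normalizer_engel _ _⟩, hr⟩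
  apply LieSubalgebra.isNilpotent_of_forall_le_engel
  intro y hy
  set Ex : {LieSubalgebra.engel k z | z ∈ LieSubalgebra.engel k x} :=
    ⟨LieSubalgebra.engel k x, x, LieSubalgebra.self_mem_engel _ _, rfl⟩
  suffices IsBot Ex from @this ⟨LieSubalgebra.engel k y, y, hy, rfl⟩
  apply LieAlgebra.engel_isBot_of_isMin h (LieSubalgebra.engel k x) Ex le_rfl
  rintro ⟨_, y, hy, rfl⟩ hyx
  suffices Module.finrank k (LieSubalgebra.engel k x) ≤
      Module.finrank k (LieSubalgebra.engel k y) by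
    suffices LieSubalgebra.engel k y = LieSubalgebra.engel k x from this.ge
    apply LieSubalgebra.toSubmodule_injective
    exact Submodule.eq_of_le_of_finrank_le hyx this
  rw [hr]
  apply LieAlgebra.rank_le_finrank_engel

open LieAlgebra LieAlgebra.IsKilling LieModule in
lemma aux_struct [Nontrivial g] (H : LieSubalgebra k g) [H.IsCartanSubalgebra] :
    ∃ h0 e f : g, ⁅h0, e⁆ = e ∧ ⁅h0, f⁆ = -f ∧ ⁅e, f⁆ = (2 : k) • h0 ∧
      ⨆ j : ℤ, (LieAlgebra.ad k g h0).eigenspace (j : k) = ⊤ ∧ h0 ≠ 0 ∧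
      (LieAlgebra.ad k g h0).eigenspace 0 = H.toSubmodule := by
  classical
  obtain ⟨b⟩ := RootPairing.nonempty_base (rootSystem H)
  let h0 : H := (Module.evalEquiv k H).symm (b.toWeightBasis.constr k fun _ => (1 : k))
  have hev : ∀ φ : Module.Dual k H, φ h0 = b.toWeightBasis.constr k (fun _ => (1 : k)) φ := by
    intro φ
    have := (Module.evalEquiv k H).apply_symm_apply (b.toWeightBasis.constr k fun _ => (1 : k))
    exact LinearMap.congr_fun this φ
  have hsimple : ∀ i ∈ b.support, (rootSystem H).root i h0 = 1 := by
    intro i hi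
    rw [hev, ← b.toWeightBasis_apply ⟨i, hi⟩, Module.Basis.constr_basis]
  have hroot : ∀ i, (rootSystem H).root i h0 = (b.height i : k) := by
    intro i
    obtain ⟨c, -, -, hc⟩ := b.exists_root_eq_sum_int i
    rw [RootPairing.Base.height_eq_sum hc, hc, LinearMap.sum_apply]
    push_cast
    refine Finset.sum_congr rfl fun j hj => ?_
    rw [LinearMap.smul_apply, hsimple j hj]
    simp
  -- weights
  have hwt : ∀ α : Weight k H g, ∃ j : ℤ, (α h0 = (j : k)) ∧ (j = 0 → α.IsZero) := by
    intro α
    by_cases hα : α.IsZero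
    · refine ⟨0, ?_, fun _ => hα⟩
      rw [hα.eq]; simp
    · refine ⟨b.height ⟨α, by simpa using hα⟩, ?_, fun h => absurd h (b.height_ne_zero _)⟩
      exact hroot ⟨α, by simpa using hα⟩
  have hsp : ∀ (α : Weight k H g) (x : g), x ∈ rootSpace H α → ⁅(h0 : g), x⁆ = α h0 • x :=
    fun α x hx => lie_eq_smul_of_mem_rootSpace hx h0
  have hsup : ⨆ α : Weight k H g, (rootSpace H α).toSubmodule = ⊤ := by
    rw [← LieSubmodule.iSup_toSubmodule, LieModule.iSup_genWeightSpace_eq_top' k H g]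
    rfl
  have hT : ⨆ j : ℤ, (LieAlgebra.ad k g (h0 : g)).eigenspace (j : k) = ⊤ := by
    rw [eq_top_iff, ← hsup, iSup_le_iff]
    intro α x hx
    obtain ⟨j, hj, -⟩ := hwt α
    refine Submodule.mem_iSup_of_mem j ?_
    rw [aux_mem, ← hj]
    exact hsp α x hx
  have hV0 : (LieAlgebra.ad k g (h0 : g)).eigenspace 0 = H.toSubmodule := by
    apply le_antisymm
    · intro x hx
      obtain ⟨Φ, hΦ⟩ := aux_exists_calc (LieAlgebra.ad k g (h0 : g))
      have h1 : ∀ y : g, Φ (Pi.single 0 1) y ∈ H.toSubmodule := by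
        intro y
        suffices (⊤ : Submodule k g) ≤ H.toSubmodule.comap (Φ (Pi.single 0 1)) from
          this (Submodule.mem_top (x := y))
        rw [← hsup, iSup_le_iff]
        intro α y hy
        obtain ⟨j, hj, hj0⟩ := hwt α
        have hy' : y ∈ (LieAlgebra.ad k g (h0 : g)).eigenspace (j : k) := by
          rw [aux_mem, ← hj]; exact hsp α y hy
        rw [Submodule.mem_comap, hΦ _ j y hy']
        by_cases h : j = 0
        · apply Submodule.smul_mem
          have h2 : y ∈ rootSpace H α := hy
          rw [(hj0 h).eq, rootSpace_zero_eq] at h2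
          exact h2
        · simp [h]
      have h2 := hΦ (Pi.single 0 1) 0 x (by simpa using hx)
      have h3 := h1 x
      rw [h2] at h3
      simpa using h3
    · intro x hx
      rw [aux_mem, zero_smul]
      have : ⁅h0, (⟨x, hx⟩ : H)⁆ = 0 := trivial_lie_zero _ _ _ _
      exact congrArg (Subtype.val) this
  have hne : (h0 : g) ≠ 0 := by
    intro h
    rw [h] at hV0
    have htop : ∀ x : g, x ∈ H := fun x => by
      have : x ∈ (LieAlgebra.ad k g 0).eigenspace (0 : k) := by rw [aux_mem]; simp
      rw [hV0] at this
      exact this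
    have : IsLieAbelian g := ⟨fun x y => by
      have : ⁅(⟨x, htop x⟩ : H), (⟨y, htop y⟩ : H)⁆ = 0 := trivial_lie_zero _ _ _ _
      exact congrArg (Subtype.val) this⟩
    have := LieAlgebra.subsingleton_of_hasTrivialRadical_lie_abelian k g
    exact not_subsingleton g this
  -- Chevalley generators
  have hsl : ∀ i : b.support, ∃ e f : g, e ∈ rootSpace H (i : H.root).1 ∧
      f ∈ rootSpace H (-(i : H.root).1 : H → k) ∧
      ⁅e, f⁆ = ((rootSystem H).coroot i : H) := by
    intro i
    have hi : (i : H.root).1.IsNonZero := (Finset.mem_filter.mp (i : H.root).2).2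
    obtain ⟨h, e, f, ht, he, hf⟩ := exists_isSl2Triple_of_weight_isNonZero hi
    refine ⟨e, f, he, hf, ?_⟩
    rw [ht.lie_e_f, ht.h_eq_coroot hi he hf]
    rfl
  choose E F hE hF hEF using hsl
  let c := b.toCoweightBasis.repr ((2 : k) • h0)
  have hc : (2 : k) • h0 = ∑ i, c i • (rootSystem H).coroot i := by
    rw [← b.toCoweightBasis.sum_repr ((2 : k) • h0)]
    simp [c]
  have hzero : ∀ i j : b.support, i ≠ j → ⁅E i, F j⁆ = 0 := by
    intro i j hij
    have h1 := lie_mem_genWeightSpace_of_mem_genWeightSpace (hE i) (hF j)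
    by_contra h2
    have h3 : rootSpace H (((i : H.root).1 : H → k) + -((j : H.root).1 : H → k)) ≠ ⊥ := by
      intro h3
      have h4 : ⁅E i, F j⁆ ∈ rootSpace H
        (((i : H.root).1 : H → k) + -((j : H.root).1 : H → k)) := h1
      rw [h3] at h4
      exact h2 (by simpa using h4)
    let w : Weight k H g := ⟨_, h3⟩
    have hw : ∀ x, w x = (rootSystem H).root i x - (rootSystem H).root j x := fun x => by
      change (i : H.root).1 x + - (j : H.root).1 x = _
      rw [← sub_eq_add_neg]; rfl
    have hwn : w.IsNonZero := by
      intro hz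
      apply hij
      apply Subtype.ext
      apply (rootSystem H).root.injective
      ext x
      have := hw x
      rw [hz.eq] at this
      exact (sub_eq_zero.mp (this.symm.trans rfl))
    refine b.sub_notMem_range_root i.2 j.2 ⟨⟨w, by simpa using hwn⟩, ?_⟩
    ext x
    exact hw x
  have hiE : ∀ i, ⁅(h0 : g), E i⁆ = E i := fun i => by
    have h1 := hsp _ _ (hE i)
    have h2 := hsimple i i.2
    rw [rootSystem_root_apply] at h2
    rw [h1]
    change (((i : H.root).1.toLinear) h0) • E i = E i
    rw [h2, one_smul]
  have hiF : ∀ i, ⁅(h0 : g), F i⁆ = - F i := fun i => by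
    have h1 := lie_eq_smul_of_mem_rootSpace (hF i) h0
    have h2 := hsimple i i.2
    rw [rootSystem_root_apply] at h2
    refine (show ⁅(h0 : g), F i⁆ = _ from h1).trans ?_
    change (- ((i : H.root).1.toLinear) h0) • F i = _
    rw [h2, neg_smul, one_smul]
  refine ⟨h0, ∑ i, E i, ∑ i, c i • F i, ?_, ?_, ?_, hT, hne, hV0⟩
  · rw [lie_sum]; exact Finset.sum_congr rfl fun i _ => hiE i
  · rw [lie_sum, ← Finset.sum_neg_distrib]
    exact Finset.sum_congr rfl fun i _ => by rw [lie_smul, hiF, smul_neg]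
  · rw [sum_lie]
    have h1 : ∀ i, ⁅E i, ∑ j, c j • F j⁆ = c i • (((rootSystem H).coroot i : H) : g) := by
      intro i
      rw [lie_sum, Finset.sum_eq_single i]
      · rw [lie_smul, hEF]
      · intro j _ hj
        rw [lie_smul, hzero i j hj.symm, smul_zero]
      · simp
    simp_rw [h1]
    have h2 := congrArg (H.toSubmodule.subtype) hc
    rw [map_sum] at h2
    exact h2.symm

end helpers

theorem antonyan_inner [Nontrivial g]
    (m : ℕ) (hm : 1 ≤ m) (ζ : k) (hζ : IsPrimitiveRoot ζ m) :
    ∃ θ : g ≃ₗ[k] g, θ ∈ IntG k g ∧ orderOf θ = m ∧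
      ∃ e : g, e ∈ Module.End.eigenspace (θ : g →ₗ[k] g) ζ ∧
        IsNilpotent (LieAlgebra.ad k g e) ∧
        Module.finrank k (zc k g e) = LieAlgebra.rank k g := by
  obtain ⟨H, hH, hr⟩ := aux_cartan (k := k) (g := g)
  obtain ⟨h0, e, f, he, hf, hef, hT, hne, hV⟩ := aux_struct (k := k) (g := g) H
  obtain ⟨θ, h1, h2, h3, h4⟩ := aux_main he hf hef hT hne m hm ζ hζ
  refine ⟨θ, h1, h2, e, h3, h4, ?_⟩
  rw [aux_dim he hf hef hT hne, hV]
  exact hr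
end
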